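/- arXiv:1511.00743 — 2 statements merged into one kernel-verified Lean document; each statement's English description precedes it below -/
import Mathlib

section
/- Let Ω ⊂ ℝ³ be an open bounded domain with C² boundary, let A : cl(Ω) → Sym(3,ℝ) be a continuously differentiable symmetric matrix field which is uniformly elliptic with constant d > 0 (i.e. A(x)ζ·ζ ≥ d|ζ|² for all x ∈ cl(Ω) and ζ ∈ ℝ³), and let a : cl(Ω) → ℝ³ be a continuously differentiable vector field with div a = 0 on Ω. Assume f satisfies (F), g satisfies (G-ext), f'(0) + ln(g'(0)) > 0, and vol(Ω) < V_ex := (4π⁴d/3)·√(d/(f'(0) + ln(g'(0)))³). Then every solution of the impulsive reaction–diffusion system on Ω with diffusion operator div(A∇u) satisfies lim_{m→∞} N_m(x) = 0 for every x ∈ Ω. -/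
open Real Filter MeasureTheory
open scoped Topology ENNReal

noncomputable section

/-- First-order partial derivative of `u` in the `i`-th coordinate direction. -/
def pd {n : ℕ} (u : EuclideanSpace ℝ (Fin n) → ℝ) (i : Fin n)
    (x : EuclideanSpace ℝ (Fin n)) : ℝ :=
  fderiv ℝ u x (EuclideanSpace.single i 1)

/-- Second-order partial derivative `∂ᵢ∂ⱼ u`. -/
def pd2 {n : ℕ} (u : EuclideanSpace ℝ (Fin n) → ℝ) (i j : Fin n)
    (x : EuclideanSpace ℝ (Fin n)) : ℝ :=
  pd (fun y => pd u j y) i x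

/-- Laplacian of `u`. -/
def lap {n : ℕ} (u : EuclideanSpace ℝ (Fin n) → ℝ) (x : EuclideanSpace ℝ (Fin n)) : ℝ :=
  ∑ i, pd2 u i i x

/-- Assumption (F): `f` is locally Lipschitz, `f 0 = 0`, `f` is differentiable at `0`
with derivative `f'0 ≠ 0`, and there is a differentiable `h` with `h 0 = h' 0 = 0` such that
`f'0 * N - h N ≤ f N ≤ f'0 * N` for all `N ≥ 0`. -/
def SatF (f : ℝ → ℝ) (f'0 : ℝ) : Prop :=
  LocallyLipschitz f ∧ f 0 = 0 ∧ HasDerivAt f f'0 0 ∧ f'0 ≠ 0 ∧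
    ∃ h : ℝ → ℝ, Differentiable ℝ h ∧ h 0 = 0 ∧ deriv h 0 = 0 ∧
      ∀ N : ℝ, 0 ≤ N → f'0 * N - h N ≤ f N ∧ f N ≤ f'0 * N

/-- Assumption (G-ext): `g : [0,∞) → [0,∞)` is continuous, `g 0 = 0`, `g N > 0` for `N > 0`,
`g` is differentiable at `0` (within `[0,∞)`) with derivative `g'0 > 0`, and
`g N ≤ g'0 * N` for all `N > 0`. -/
def SatGext (g : ℝ → ℝ) (g'0 : ℝ) : Prop :=
  ContinuousOn g (Set.Ici 0) ∧ g 0 = 0 ∧ (∀ N : ℝ, 0 < N → 0 < g N) ∧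
    HasDerivWithinAt g g'0 (Set.Ici 0) 0 ∧ 0 < g'0 ∧ ∀ N : ℝ, 0 < N → g N ≤ g'0 * N

/-- `Ω` has a `C^k` boundary: near every boundary point, `Ω` is the sublevel set of a
`C^k` function with nonvanishing differential, whose zero set is the boundary. -/
def HasCkBoundary {n : ℕ} (k : ℕ∞) (Ω : Set (EuclideanSpace ℝ (Fin n))) : Prop :=
  ∀ x ∈ frontier Ω, ∃ U : Set (EuclideanSpace ℝ (Fin n)),
    ∃ φ : EuclideanSpace ℝ (Fin n) → ℝ,
      IsOpen U ∧ x ∈ U ∧ ContDiffOn ℝ k φ U ∧ (∀ y ∈ U, fderiv ℝ φ y ≠ 0) ∧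
        Ω ∩ U = {y ∈ U | φ y < 0} ∧ frontier Ω ∩ U = {y ∈ U | φ y = 0}

/-- A solution of the impulsive reaction-diffusion system with diffusion operator
`div (A ∇u)`, i.e. `∂ₜ u⁽ᵐ⁾ = ∑ᵢⱼ ∂ᵢ(Aᵢⱼ(x) ∂ⱼ u⁽ᵐ⁾) - a ⬝ ∇u⁽ᵐ⁾ + f (u⁽ᵐ⁾)` on `Ω × (0,1]`,
with Dirichlet boundary conditions, initial data `u⁽ᵐ⁾(·,0) = g (N_m ·)` and update rule
`N_{m+1} = u⁽ᵐ⁾(·,1)`. -/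
structure ImpSolA (n : ℕ) (Ω : Set (EuclideanSpace ℝ (Fin n)))
    (A : EuclideanSpace ℝ (Fin n) → Matrix (Fin n) (Fin n) ℝ)
    (a : EuclideanSpace ℝ (Fin n) → EuclideanSpace ℝ (Fin n)) (f g : ℝ → ℝ) where
  N : ℕ → EuclideanSpace ℝ (Fin n) → ℝ
  u : ℕ → EuclideanSpace ℝ (Fin n) → ℝ → ℝ
  N_cont : ∀ m, ContinuousOn (N m) (closure Ω)
  N_nonneg : ∀ m, ∀ x ∈ closure Ω, 0 ≤ N m x
  N0_bdry : ∀ x ∈ frontier Ω, N 0 x = 0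
  u_nonneg : ∀ m, ∀ x ∈ closure Ω, ∀ t ∈ Set.Icc (0:ℝ) 1, 0 ≤ u m x t
  u_cont : ∀ m, ContinuousOn (fun p : EuclideanSpace ℝ (Fin n) × ℝ => u m p.1 p.2)
    (closure Ω ×ˢ Set.Icc (0:ℝ) 1)
  u_space_C2 : ∀ m, ∀ t ∈ Set.Ioc (0:ℝ) 1, ∀ x ∈ Ω, ContDiffAt ℝ 2 (fun y => u m y t) x
  u_time_C1 : ∀ m, ∀ x ∈ Ω, ∀ t ∈ Set.Ioc (0:ℝ) 1, ContDiffAt ℝ 1 (fun s => u m x s) t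
  pde : ∀ m, ∀ x ∈ Ω, ∀ t ∈ Set.Ioc (0:ℝ) 1,
    deriv (fun s => u m x s) t =
      (∑ i, pd (fun y => ∑ j, A y i j * pd (fun z => u m z t) j y) i x)
        - (∑ i, a x i * pd (fun y => u m y t) i x) + f (u m x t)
  bdry : ∀ m, ∀ x ∈ frontier Ω, ∀ t ∈ Set.Ioc (0:ℝ) 1, u m x t = 0
  init : ∀ m, ∀ x ∈ Ω, u m x 0 = g (N m x)
  recur : ∀ m, ∀ x ∈ closure Ω, N (m + 1) x = u m x 1


/-- one-dimensional Brunn-Minkowski, in the form needed -/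
lemma bm_one_compact {K1 K2 T : Set ℝ} (h1 : IsCompact K1) (h2 : IsCompact K2)
    (n1 : K1.Nonempty) (n2 : K2.Nonempty) (hT : ∀ x ∈ K1, ∀ y ∈ K2, x + y ∈ T) :
    volume K1 + volume K2 ≤ volume T := by
  obtain ⟨a, ha, hamax⟩ := h1.exists_isGreatest n1
  obtain ⟨b, hb, hbmin⟩ := h2.exists_isLeast n2
  set L1 := (fun x => x + b) '' K1 with hL1
  set L2 := (fun x => a + x) '' K2 with hL2
  have hL1v : volume L1 = volume K1 := by
    rw [hL1]; simp
  have hL2v : volume L2 = volume K2 := by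
    rw [hL2]; simp
  have hm2 : MeasurableSet L2 := (h2.image (by fun_prop)).measurableSet
  have hsub : L1 ∪ L2 ⊆ T := by
    rintro z (⟨x, hx, rfl⟩ | ⟨x, hx, rfl⟩)
    · exact hT x hx b hb
    · exact hT a ha x hx
  have hint : L1 ∩ L2 ⊆ {a + b} := by
    rintro z ⟨⟨x, hx, rfl⟩, ⟨y, hy, hxy⟩⟩
    have := hamax hx
    have := hbmin hy
    simp only [Set.mem_singleton_iff] at *
    linarith
  have h0 : volume (L1 ∩ L2) = 0 := measure_mono_null hint (by simp)
  have := measure_union_add_inter (μ := volume) L1 hm2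
  rw [h0, add_zero, hL1v, hL2v] at this
  rw [← this]
  exact measure_mono hsub

lemma exists_compact_gt {A : Set ℝ} (hA : MeasurableSet A) (nA : A.Nonempty) {r : ℝ≥0∞}
    (hr : r < volume A) : ∃ K ⊆ A, IsCompact K ∧ K.Nonempty ∧ r < volume K := by
  obtain ⟨K, hKA, hK, hrK⟩ := hA.exists_lt_isCompact hr
  obtain ⟨a, ha⟩ := nA
  refine ⟨insert a K, Set.insert_subset ha hKA, hK.insert a, Set.insert_nonempty _ _, ?_⟩
  exact hrK.trans_le (measure_mono (Set.subset_insert _ _))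

lemma exists_compact_approx {A : Set ℝ} (hA : MeasurableSet A) (nA : A.Nonempty) :
    volume A = ⨆ K : {K : Set ℝ // K ⊆ A ∧ IsCompact K ∧ K.Nonempty}, volume (K : Set ℝ) := by
  apply le_antisymm
  · refine le_of_forall_lt fun r hr => ?_
    obtain ⟨K, h1, h2, h3, h4⟩ := exists_compact_gt hA nA hr
    exact h4.trans_le (le_iSup (fun K : {K : Set ℝ // K ⊆ A ∧ IsCompact K ∧ K.Nonempty} => volume (K : Set ℝ)) ⟨K, h1, h2, h3⟩)
  · exact iSup_le fun K => measure_mono K.2.1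

lemma bm_one {A B T : Set ℝ} (hA : MeasurableSet A) (hB : MeasurableSet B)
    (nA : A.Nonempty) (nB : B.Nonempty) (hT : ∀ x ∈ A, ∀ y ∈ B, x + y ∈ T) :
    volume A + volume B ≤ volume T := by
  rw [exists_compact_approx hA nA, exists_compact_approx hB nB]
  have : Nonempty {K : Set ℝ // K ⊆ A ∧ IsCompact K ∧ K.Nonempty} := by
    obtain ⟨a, ha⟩ := nA
    exact ⟨⟨{a}, by simpa using ha, isCompact_singleton, by simp⟩⟩
  have : Nonempty {K : Set ℝ // K ⊆ B ∧ IsCompact K ∧ K.Nonempty} := by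
    obtain ⟨a, ha⟩ := nB
    exact ⟨⟨{a}, by simpa using ha, isCompact_singleton, by simp⟩⟩
  refine ENNReal.iSup_add_iSup_le fun K1 K2 => ?_
  exact bm_one_compact K1.2.2.1 K2.2.2.1 K1.2.2.2 K2.2.2.2
    fun x hx y hy => hT x (K1.2.1 hx) y (K2.2.1 hy)

lemma bm_one_conv {A B T : Set ℝ} {p q : ℝ} (hp : 0 < p) (hq : 0 < q)
    (hA : MeasurableSet A) (hB : MeasurableSet B)
    (nA : A.Nonempty) (nB : B.Nonempty) (hT : ∀ x ∈ A, ∀ y ∈ B, p * x + q * y ∈ T) :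
    ENNReal.ofReal p * volume A + ENNReal.ofReal q * volume B ≤ volume T := by
  have e : ∀ (p : ℝ), 0 < p → ∀ A : Set ℝ, ENNReal.ofReal p * volume A
      = volume ((fun x => p⁻¹ * x) ⁻¹' A) := by
    intro p hp A
    rw [Real.volume_preimage_mul_left (inv_ne_zero hp.ne')]
    simp [abs_of_pos hp]
  rw [e p hp, e q hq]
  refine bm_one (hA.preimage (by fun_prop)) (hB.preimage (by fun_prop)) ?_ ?_ ?_
  · obtain ⟨a, ha⟩ := nA
    exact ⟨p * a, by simpa [← mul_assoc, inv_mul_cancel₀ hp.ne'] using ha⟩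
  · obtain ⟨a, ha⟩ := nB
    exact ⟨q * a, by simpa [← mul_assoc, inv_mul_cancel₀ hq.ne'] using ha⟩
  · intro x hx y hy
    have := hT _ hx _ hy
    simpa [← mul_assoc, mul_inv_cancel₀ hp.ne', mul_inv_cancel₀ hq.ne'] using this

/-- weighted AM-GM in `ENNReal` -/
lemma ennreal_amgm (p q : ℝ) (hp : 0 < p) (hq : 0 < q) (hpq : p + q = 1) (x y : ℝ≥0∞) :
    x ^ p * y ^ q ≤ ENNReal.ofReal p * x + ENNReal.ofReal q * y := by
  by_cases hx : x = ⊤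
  · subst hx
    rw [ENNReal.mul_top (by simpa using hp)]; simp
  by_cases hy : y = ⊤
  · subst hy
    rw [ENNReal.mul_top (by simpa using hq)]; simp
  lift x to NNReal using hx
  lift y to NNReal using hy
  have := NNReal.geom_mean_le_arith_mean2_weighted ⟨p, hp.le⟩ ⟨q, hq.le⟩ x y
    (by ext; exact hpq)
  rw [← ENNReal.coe_rpow_of_nonneg _ hp.le, ← ENNReal.coe_rpow_of_nonneg _ hq.le,
    ENNReal.ofReal_eq_coe_nnreal hp.le, ENNReal.ofReal_eq_coe_nnreal hq.le]
  exact_mod_cast this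

/-- layer cake for `ENNReal`-valued functions bounded by one -/
lemma layer_le_one {f : ℝ → ℝ≥0∞} (hf : Measurable f) (h1 : ∀ x, f x ≤ 1) :
    ∫⁻ x, f x = ∫⁻ t in Set.Ioi (0:ℝ), volume {x | t < (f x).toReal} := by
  rw [← lintegral_eq_lintegral_meas_lt volume (f := fun x => (f x).toReal)
    (Eventually.of_forall fun x => ENNReal.toReal_nonneg) hf.ennreal_toReal.aemeasurable]
  refine lintegral_congr fun x => ?_
  rw [ENNReal.ofReal_toReal ((h1 x).trans_lt ENNReal.one_lt_top).ne]

lemma pl_norm {p q : ℝ} (hp : 0 < p) (hq : 0 < q) (hpq : p + q = 1) {f g h : ℝ → ℝ≥0∞}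
    (hf : Measurable f) (hg : Measurable g) (hh : Measurable h)
    (f1 : ⨆ x, f x = 1) (g1 : ⨆ x, g x = 1)
    (H : ∀ x y, f x ^ p * g y ^ q ≤ h (p * x + q * y)) :
    ENNReal.ofReal p * (∫⁻ x, f x) + ENNReal.ofReal q * (∫⁻ x, g x) ≤ ∫⁻ x, h x := by
  have fl : ∀ x, f x ≤ 1 := fun x => f1 ▸ le_iSup f x
  have gl : ∀ x, g x ≤ 1 := fun x => g1 ▸ le_iSup g x
  have hle : ∫⁻ x, min (h x) 1 ≤ ∫⁻ x, h x := lintegral_mono fun x => min_le_left _ _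
  refine le_trans ?_ hle
  have m1 : ∀ f : ℝ → ℝ≥0∞, Measurable (fun t : ℝ => volume {x | t < (f x).toReal}) := by
    intro f
    refine Antitone.measurable fun s t hst => measure_mono fun x hx => ?_
    exact lt_of_le_of_lt hst hx
  rw [layer_le_one hf fl, layer_le_one hg gl,
    layer_le_one (hh.min measurable_const) (fun x => min_le_right _ _),
    ← lintegral_const_mul _ (m1 f), ← lintegral_const_mul _ (m1 g),
    ← lintegral_add_left ((m1 f).const_mul _)]
  refine setLIntegral_mono (m1 _) fun t (ht : 0 < t) => ?_
  by_cases ht1 : t < 1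
  · have key : ∀ f : ℝ → ℝ≥0∞, (⨆ x, f x = 1) → {x | t < (f x).toReal}.Nonempty := by
      intro f f1
      have : ENNReal.ofReal t < ⨆ x, f x := by
        rw [f1]; exact ENNReal.ofReal_lt_one.2 ht1
      obtain ⟨x, hx⟩ := lt_iSup_iff.1 this
      refine ⟨x, ?_⟩
      have hx' : f x ≤ 1 := f1 ▸ le_iSup f x
      exact (ENNReal.ofReal_lt_iff_lt_toReal ht.le (hx'.trans_lt ENNReal.one_lt_top).ne).1 hx
    refine bm_one_conv hp hq (measurableSet_lt measurable_const hf.ennreal_toReal)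
      (measurableSet_lt measurable_const hg.ennreal_toReal) (key f f1) (key g g1) ?_
    intro x hx y hy
    have hfx : ENNReal.ofReal t < f x :=
      (ENNReal.ofReal_lt_iff_lt_toReal ht.le ((fl x).trans_lt ENNReal.one_lt_top).ne).2 hx
    have hgy : ENNReal.ofReal t < g y :=
      (ENNReal.ofReal_lt_iff_lt_toReal ht.le ((gl y).trans_lt ENNReal.one_lt_top).ne).2 hy
    have e : ENNReal.ofReal t = ENNReal.ofReal t ^ p * ENNReal.ofReal t ^ q := by
      rw [← ENNReal.rpow_add _ _ (by simpa using ht) ENNReal.ofReal_ne_top, hpq, ENNReal.rpow_one]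
    have h2 : ENNReal.ofReal t < f x ^ p * g y ^ q := by
      rw [e]
      exact ENNReal.mul_lt_mul (ENNReal.rpow_lt_rpow hfx hp) (ENNReal.rpow_lt_rpow hgy hq)
    refine (ENNReal.ofReal_lt_iff_lt_toReal ht.le
      ((min_le_right _ _).trans_lt ENNReal.one_lt_top).ne).1 ?_
    exact lt_min (h2.trans_le (H x y)) (ENNReal.ofReal_lt_one.2 ht1)
  · have key : ∀ f : ℝ → ℝ≥0∞, (∀ x, f x ≤ 1) → {x | t < (f x).toReal} = ∅ := by
      intro f f1
      ext x
      have : (f x).toReal ≤ 1 := ENNReal.toReal_le_of_le_ofReal zero_le_one (by simpa using f1 x)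
      simp only [Set.mem_ofPred_eq, Set.mem_empty_iff_false, iff_false, not_lt]
      linarith
    rw [key f fl, key g gl]; simp

lemma pl_bdd {p q : ℝ} (hp : 0 < p) (hq : 0 < q) (hpq : p + q = 1) {f g h : ℝ → ℝ≥0∞}
    (hf : Measurable f) (hg : Measurable g) (hh : Measurable h)
    (f1 : ⨆ x, f x ≠ ⊤) (g1 : ⨆ x, g x ≠ ⊤)
    (H : ∀ x y, f x ^ p * g y ^ q ≤ h (p * x + q * y)) :
    (∫⁻ x, f x) ^ p * (∫⁻ x, g x) ^ q ≤ ∫⁻ x, h x := by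
  set a := ⨆ x, f x with ha
  set b := ⨆ x, g x with hb
  by_cases a0 : a = 0
  · have : ∀ x, f x = 0 := fun x => le_antisymm (a0 ▸ le_iSup f x) zero_le
    simp [this, ENNReal.zero_rpow_of_pos hp]
  by_cases b0 : b = 0
  · have : ∀ x, g x = 0 := fun x => le_antisymm (b0 ▸ le_iSup g x) zero_le
    simp [this, ENNReal.zero_rpow_of_pos hq]
  set c := a ^ p * b ^ q with hc
  have ap : a ^ p ≠ 0 := by simp [ENNReal.rpow_eq_zero_iff, a0, f1]
  have bq : b ^ q ≠ 0 := by simp [ENNReal.rpow_eq_zero_iff, b0, g1]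
  have ap' : a ^ p ≠ ⊤ := ENNReal.rpow_ne_top_of_nonneg hp.le f1
  have bq' : b ^ q ≠ ⊤ := ENNReal.rpow_ne_top_of_nonneg hq.le g1
  have c0 : c ≠ 0 := mul_ne_zero ap bq
  have ct : c ≠ ⊤ := ENNReal.mul_ne_top ap' bq'
  have cinv : c⁻¹ = (a⁻¹) ^ p * (b⁻¹) ^ q := by
    rw [hc, ENNReal.mul_inv (Or.inl ap) (Or.inl ap'), ENNReal.inv_rpow, ENNReal.inv_rpow]
  have N := pl_norm hp hq hpq (f := fun x => a⁻¹ * f x) (g := fun x => b⁻¹ * g x)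
    (h := fun x => c⁻¹ * h x) (hf.const_mul _) (hg.const_mul _) (hh.const_mul _)
    (by rw [← ENNReal.mul_iSup, ← ha, ENNReal.inv_mul_cancel a0 f1])
    (by rw [← ENNReal.mul_iSup, ← hb, ENNReal.inv_mul_cancel b0 g1])
    (by
      intro x y
      rw [ENNReal.mul_rpow_of_nonneg _ _ hp.le, ENNReal.mul_rpow_of_nonneg _ _ hq.le, cinv,
        mul_mul_mul_comm]
      gcongr
      exact H x y)
  have M := (ennreal_amgm p q hp hq hpq _ _).trans N
  rw [lintegral_const_mul _ hf, lintegral_const_mul _ hg, lintegral_const_mul _ hh,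
    ENNReal.mul_rpow_of_nonneg _ _ hp.le, ENNReal.mul_rpow_of_nonneg _ _ hq.le,
    mul_mul_mul_comm, ← cinv] at M
  exact (ENNReal.mul_le_mul_iff_right (ENNReal.inv_ne_zero.2 ct) (ENNReal.inv_ne_top.2 c0)).1 M

/-- Prékopa–Leindler property of a measure -/
def PLprop (E : Type) [AddCommGroup E] [Module ℝ E] [MeasurableSpace E] (μ : Measure E) : Prop :=
  ∀ (p q : ℝ), 0 < p → 0 < q → p + q = 1 → ∀ f g h : E → ℝ≥0∞,
    Measurable f → Measurable g → Measurable h →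
    (∀ x y, f x ^ p * g y ^ q ≤ h (p • x + q • y)) →
    (∫⁻ x, f x ∂μ) ^ p * (∫⁻ x, g x ∂μ) ^ q ≤ ∫⁻ x, h x ∂μ

lemma pl_real : PLprop ℝ volume := by
  intro p q hp hq hpq f g h hf hg hh H
  by_cases f0 : ∫⁻ x, f x = 0
  · simp [f0, ENNReal.zero_rpow_of_pos hp]
  by_cases g0 : ∫⁻ x, g x = 0
  · simp [g0, ENNReal.zero_rpow_of_pos hq]
  have T : ∀ f : ℝ → ℝ≥0∞, Measurable f →
      Tendsto (fun n : ℕ => ∫⁻ x, min (f x) n) atTop (𝓝 (∫⁻ x, f x)) := by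
    intro f hf
    refine lintegral_tendsto_of_tendsto_of_monotone
      (fun n => (hf.min measurable_const).aemeasurable) (Eventually.of_forall fun x => ?_)
      (Eventually.of_forall fun x => ?_)
    · intro n m hnm
      exact min_le_min le_rfl (by exact_mod_cast hnm)
    · have : Tendsto (fun n : ℕ => min (f x) (n : ℝ≥0∞)) atTop (𝓝 (min (f x) ⊤)) :=
        tendsto_const_nhds.min ENNReal.tendsto_nat_nhds_top
      simpa using this
  have L : Tendsto (fun n : ℕ => (∫⁻ x, min (f x) n) ^ p * (∫⁻ x, min (g x) n) ^ q) atTop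
      (𝓝 ((∫⁻ x, f x) ^ p * (∫⁻ x, g x) ^ q)) := by
    refine ENNReal.Tendsto.mul ((T f hf).ennrpow_const p) (Or.inl ?_)
      ((T g hg).ennrpow_const q) (Or.inl ?_)
    · simp [ENNReal.rpow_eq_zero_iff, f0, hp.le]
    · simp [ENNReal.rpow_eq_zero_iff, g0, hq.le]
  refine le_of_tendsto' L fun n => ?_
  have bd : ∀ f : ℝ → ℝ≥0∞, ⨆ x, min (f x) (n : ℝ≥0∞) ≠ ⊤ := fun f =>
    ((iSup_le fun x => min_le_right _ _).trans_lt (ENNReal.natCast_lt_top n)).ne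
  refine pl_bdd hp hq hpq (hf.min measurable_const) (hg.min measurable_const) hh (bd f) (bd g) ?_
  intro x y
  refine le_trans ?_ (H x y)
  gcongr <;> exact min_le_left _ _

lemma pl_prod {E F : Type} [AddCommGroup E] [Module ℝ E] [MeasurableSpace E]
    [AddCommGroup F] [Module ℝ F] [MeasurableSpace F] (μ : Measure E) (ν : Measure F)
    [SFinite μ] [SFinite ν] (hμ : PLprop E μ) (hν : PLprop F ν) :
    PLprop (E × F) (μ.prod ν) := by
  intro p q hp hq hpq f g h hf hg hh H
  rw [lintegral_prod _ hf.aemeasurable, lintegral_prod _ hg.aemeasurable,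
    lintegral_prod _ hh.aemeasurable]
  refine hμ p q hp hq hpq _ _ _ hf.lintegral_prod_right' hg.lintegral_prod_right'
    hh.lintegral_prod_right' fun x y => ?_
  refine hν p q hp hq hpq _ _ _ (hf.comp measurable_prodMk_left) (hg.comp measurable_prodMk_left)
    (hh.comp measurable_prodMk_left) fun x' y' => ?_
  exact H (x, x') (y, y')

lemma pl_map {E F : Type} [AddCommGroup E] [Module ℝ E] [MeasurableSpace E]
    [AddCommGroup F] [Module ℝ F] [MeasurableSpace F] (μ : Measure E) (ν : Measure F)
    (φ : E → F) (hφ : ∀ (p q : ℝ) x y, φ (p • x + q • y) = p • φ x + q • φ y) (h : MeasurePreserving φ μ ν) (hμ : PLprop E μ) : PLprop F ν := by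
  intro p q hp hq hpq f g h' hf hg hh H
  rw [← h.lintegral_comp hf, ← h.lintegral_comp hg, ← h.lintegral_comp hh]
  refine hμ p q hp hq hpq _ _ _ (hf.comp h.measurable) (hg.comp h.measurable)
    (hh.comp h.measurable) fun x y => ?_
  simpa [hφ] using H (φ x) (φ y)

lemma pl_pi (n : ℕ) : PLprop (Fin n → ℝ) volume := by
  induction n with
  | zero =>
    intro p q hp hq hpq f g h hf hg hh H
    rw [Measure.volume_pi_eq_dirac (fun _ => 0), lintegral_dirac, lintegral_dirac,
      lintegral_dirac]
    refine (H _ _).trans (le_of_eq ?_)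
    congr 1
    exact Subsingleton.elim _ _
  | succ n ih =>
    refine pl_map (volume : Measure (ℝ × (Fin n → ℝ))) volume
      (MeasurableEquiv.piFinSuccAbove (fun _ => ℝ) 0).symm ?_
      (volume_preserving_piFinSuccAbove (fun _ : Fin (n + 1) => ℝ) 0).symm
      (pl_prod volume volume pl_real ih)
    intro p q x y
    funext i
    refine Fin.cases ?_ (fun i => ?_) i <;> simp [MeasurableEquiv.piFinSuccAbove]

lemma pl_E3 : PLprop (EuclideanSpace ℝ (Fin 3)) volume :=
  pl_map volume volume (WithLp.toLp 2) (fun _ _ _ _ => rfl)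
    (PiLp.volume_preserving_toLp (Fin 3)) (pl_pi 3)

lemma bm_mult {A B T : Set (EuclideanSpace ℝ (Fin 3))} {p q : ℝ} (hp : 0 < p) (hq : 0 < q)
    (hpq : p + q = 1) (hA : MeasurableSet A) (hB : MeasurableSet B) (hTm : MeasurableSet T)
    (hT : ∀ x ∈ A, ∀ y ∈ B, p • x + q • y ∈ T) :
    volume A ^ p * volume B ^ q ≤ volume T := by
  have := pl_E3 p q hp hq hpq (A.indicator 1) (B.indicator 1) (T.indicator 1)
    (measurable_one.indicator hA) (measurable_one.indicator hB) (measurable_one.indicator hTm) ?_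
  · simpa [lintegral_indicator_one, hA, hB, hTm] using this
  · intro x y
    by_cases hx : x ∈ A
    · by_cases hy : y ∈ B
      · simp [hx, hy, hT x hx y hy]
      · simp [hy, ENNReal.zero_rpow_of_pos hq]
    · simp [hx, ENNReal.zero_rpow_of_pos hp]

/-- Brunn–Minkowski with a ball -/
lemma bm_thick {S : Set (EuclideanSpace ℝ (Fin 3))} (hS : IsOpen S) {r ε : ℝ} (hr : 0 < r)
    (hε : 0 < ε) (hv : volume S = ENNReal.ofReal (4 * π / 3 * r ^ 3)) :
    ENNReal.ofReal (4 * π / 3 * (r + ε) ^ 3) ≤ volume (Metric.thickening ε S) := by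
  have hre : 0 < r + ε := by linarith
  set p := r / (r + ε) with hp
  set q := ε / (r + ε) with hq
  have hp0 : 0 < p := by positivity
  have hq0 : 0 < q := by positivity
  have hpq : p + q = 1 := by rw [hp, hq]; field_simp
  have hsm : ∀ (p : ℝ), 0 < p → ∀ S : Set (EuclideanSpace ℝ (Fin 3)), volume ((fun x => p • x) ⁻¹' S) =
      ENNReal.ofReal ((p⁻¹) ^ 3) * volume S := by
    intro p hp S
    rw [Measure.addHaar_preimage_smul volume hp.ne']
    simp [abs_of_pos hp]
  have := bm_mult hp0 hq0 hpq (A := (fun x => p • x) ⁻¹' S)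
    (B := (fun x => q • x) ⁻¹' (Metric.ball 0 ε)) (T := Metric.thickening ε S)
    (hS.measurableSet.preimage (by fun_prop)) (Metric.isOpen_ball.measurableSet.preimage (by fun_prop))
    Metric.isOpen_thickening.measurableSet ?_
  · rw [hsm p hp0, hsm q hq0, hv, EuclideanSpace.volume_ball_fin_three,
      ← ENNReal.ofReal_mul (by positivity)] at this
    have e1 : (p⁻¹) ^ 3 * (4 * π / 3 * r ^ 3) = 4 * π / 3 * (r + ε) ^ 3 := by
      rw [hp]; field_simp
    have e2 : ENNReal.ofReal ((q⁻¹) ^ 3) * (ENNReal.ofReal ε ^ 3 * ENNReal.ofReal (π * 4 / 3))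
        = ENNReal.ofReal (4 * π / 3 * (r + ε) ^ 3) := by
      rw [← ENNReal.ofReal_pow hε.le, ← ENNReal.ofReal_mul (by positivity),
        ← ENNReal.ofReal_mul (by positivity)]
      congr 1
      rw [hq]; field_simp
    rw [e1, e2, ← ENNReal.rpow_add _ _ (by simp; positivity) ENNReal.ofReal_ne_top, hpq,
      ENNReal.rpow_one] at this
    exact this
  · intro x hx y hy
    rw [Metric.mem_thickening_iff]
    refine ⟨p • x, hx, ?_⟩
    simpa [dist_eq_norm] using hy


abbrev E3 := EuclideanSpace ℝ (Fin 3)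

def qf (κ r : ℝ) : ℝ := 1 / r - κ * cos (κ * r) / sin (κ * r)

def rad (v : ℝ) : ℝ := (3 * v / (4 * π)) ^ (1 / 3 : ℝ)

def kf (κ v : ℝ) : ℝ := κ ^ 2 + qf κ (rad v) ^ 2

def Gam (κ v : ℝ) : ℝ := 4 * π * rad v ^ 2 * qf κ (rad v)

lemma qf_zero (κ : ℝ) : qf κ 0 = 0 := by simp [qf]

lemma mul_cos_le_sin {x : ℝ} (h0 : 0 < x) (h1 : x < π) : x * cos x ≤ sin x := by
  by_cases hc : cos x ≤ 0
  · exact (mul_nonpos_of_nonneg_of_nonpos h0.le hc).trans (sin_pos_of_pos_of_lt_pi h0 h1).le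
  · push Not at hc
    have hx : x < π / 2 := by
      by_contra h
      push Not at h
      linarith [cos_nonpos_of_pi_div_two_le_of_le h (by linarith)]
    have := (Real.lt_tan h0 hx).le
    rw [tan_eq_sin_div_cos, le_div_iff₀ hc] at this
    exact this

lemma qf_nonneg {κ r : ℝ} (hκ : 0 < κ) (hr : 0 ≤ r) (h : κ * r < π) : 0 ≤ qf κ r := by
  rcases hr.eq_or_lt with rfl | hr
  · simp [qf_zero]
  · have hs := sin_pos_of_pos_of_lt_pi (mul_pos hκ hr) h
    have := mul_cos_le_sin (mul_pos hκ hr) h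
    rw [qf, sub_nonneg, div_le_div_iff₀ hs hr]
    linarith

lemma qf_deriv {κ r : ℝ} (hκ : 0 < κ) (hr : 0 < r) (h : κ * r < π) :
    HasDerivAt (qf κ) (-1 / r ^ 2 + κ ^ 2 / sin (κ * r) ^ 2) r := by
  have hs := (sin_pos_of_pos_of_lt_pi (mul_pos hκ hr) h).ne'
  have h1 : HasDerivAt (fun r : ℝ => κ * r) κ r := by
    simpa using (hasDerivAt_id r).const_mul κ
  have h2 := ((h1.cos.const_mul κ).div h1.sin hs)
  have h3 := ((hasDerivAt_const r (1:ℝ)).div (hasDerivAt_id r) hr.ne').sub h2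
  refine h3.congr_deriv ?_
  have := sin_sq_add_cos_sq (κ * r)
  simp only [id]
  generalize sin (κ * r) = S at *
  generalize cos (κ * r) = C at *
  field_simp
  linear_combination (κ ^ 2 * r ^ 2) * this

lemma qf_mono {κ r s : ℝ} (hκ : 0 < κ) (hr : 0 ≤ r) (hrs : r ≤ s) (h : κ * s < π) :
    qf κ r ≤ qf κ s := by
  rcases hr.eq_or_lt with rfl | hr
  · rw [qf_zero]; exact qf_nonneg hκ hrs h
  have key : MonotoneOn (qf κ) (Set.Icc r s) := by
    have hk : ∀ x ∈ Set.Icc r s, 0 < x ∧ κ * x < π := fun x hx =>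
      ⟨hr.trans_le hx.1, (mul_le_mul_of_nonneg_left hx.2 hκ.le).trans_lt h⟩
    refine monotoneOn_of_deriv_nonneg (convex_Icc r s) ?_ ?_ ?_
    · exact fun x hx => (qf_deriv hκ (hk x hx).1 (hk x hx).2).continuousAt.continuousWithinAt
    · intro x hx
      have hx := interior_subset hx
      exact (qf_deriv hκ (hk x hx).1 (hk x hx).2).differentiableAt.differentiableWithinAt
    · intro x hx
      have hx := interior_subset hx
      obtain ⟨h0, h1⟩ := hk x hx
      rw [(qf_deriv hκ h0 h1).deriv]
      have hs := sin_pos_of_pos_of_lt_pi (mul_pos hκ h0) h1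
      have hl : sin (κ * x) ≤ κ * x := sin_le (mul_pos hκ h0).le
      have : 1 / x ^ 2 ≤ κ ^ 2 / sin (κ * x) ^ 2 := by
        rw [div_le_div_iff₀ (by positivity) (by positivity), one_mul, ← mul_pow]
        gcongr
      have e : -1 / x ^ 2 = - (1 / x ^ 2) := by ring
      rw [e]; linarith
  exact key ⟨le_rfl, hrs⟩ ⟨hrs, le_rfl⟩ hrs

lemma rad_nonneg {v : ℝ} (hv : 0 ≤ v) : 0 ≤ rad v := by unfold rad; positivity

lemma rad_pos {v : ℝ} (hv : 0 < v) : 0 < rad v := by unfold rad; positivity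

lemma rad_zero : rad 0 = 0 := by simp [rad]

lemma rad_mono {v w : ℝ} (hv : 0 ≤ v) (h : v ≤ w) : rad v ≤ rad w := by
  unfold rad
  gcongr

lemma rad_cube {v : ℝ} (hv : 0 ≤ v) : 4 * π / 3 * rad v ^ 3 = v := by
  have : rad v ^ 3 = 3 * v / (4 * π) := by
    unfold rad
    rw [← Real.rpow_natCast, ← Real.rpow_mul (by positivity)]
    norm_num
  rw [this]
  field_simp

lemma rad_cont : Continuous rad := by
  unfold rad
  exact Continuous.rpow_const (by fun_prop) (fun x => Or.inr (by norm_num))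

lemma rad_deriv {v : ℝ} (hv : 0 < v) : HasDerivAt rad (1 / (4 * π * rad v ^ 2)) v := by
  have h1 : HasDerivAt (fun v : ℝ => 3 * v / (4 * π)) (3 / (4 * π)) v := by
    simpa using ((hasDerivAt_id v).const_mul 3).div_const (4 * π)
  have h2 := h1.rpow_const (p := (1/3 : ℝ)) (Or.inl (by positivity))
  refine h2.congr_deriv ?_
  have hp : 0 < 3 * v / (4 * π) := by positivity
  have e : (3 * v / (4 * π)) ^ ((1:ℝ) / 3 - 1) = (rad v ^ 2)⁻¹ := by
    unfold rad
    rw [← Real.rpow_natCast, ← Real.rpow_mul hp.le, ← Real.rpow_neg hp.le]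
    norm_num
  rw [e]
  have := rad_pos hv
  field_simp

lemma Gam_deriv {κ v : ℝ} (hκ : 0 < κ) (hv : 0 < v) (h : κ * rad v < π) :
    HasDerivAt (Gam κ) (kf κ v) v := by
  have hr := rad_pos hv
  have h1 := rad_deriv hv
  have h2 : HasDerivAt (fun v => qf κ (rad v)) _ v := (qf_deriv hκ hr h).comp v h1
  have h3 := ((h1.pow 2).const_mul (4 * π)).mul h2
  refine h3.congr_deriv ?_
  have hs := (sin_pos_of_pos_of_lt_pi (mul_pos hκ hr) h).ne'
  have := sin_sq_add_cos_sq (κ * rad v)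
  simp only [kf, qf, Pi.pow_apply]
  clear h1 h2 h3
  generalize sin (κ * rad v) = S at *
  generalize cos (κ * rad v) = C at *
  generalize rad v = r at *
  field_simp
  linear_combination (-κ ^ 2 * r ^ 3) * this

lemma kf_mono {κ v w : ℝ} (hκ : 0 < κ) (hv : 0 ≤ v) (hvw : v ≤ w) (h : κ * rad w < π) :
    kf κ v ≤ kf κ w := by
  unfold kf
  have h1 := rad_mono hv hvw
  have h2 := qf_mono hκ (rad_nonneg hv) h1 h
  have h3 := qf_nonneg hκ (rad_nonneg hv) ((mul_le_mul_of_nonneg_left h1 hκ.le).trans_lt h)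
  gcongr

lemma kf_nonneg (κ v : ℝ) : 0 ≤ kf κ v := by unfold kf; positivity

lemma kf_meas (κ : ℝ) : Measurable (kf κ) := by
  have := rad_cont.measurable
  unfold kf qf
  fun_prop

lemma Gam_nonneg {κ m : ℝ} (hκ : 0 < κ) (hm : 0 ≤ m) (h : κ * rad m < π) : 0 ≤ Gam κ m := by
  have := qf_nonneg hκ (rad_nonneg hm) h
  unfold Gam; positivity

lemma Gam_int {κ m : ℝ} (hκ : 0 < κ) (hm : 0 ≤ m) (h : κ * rad m < π) :
    ∫⁻ v in Set.Ioo 0 m, ENNReal.ofReal (kf κ v) ≤ ENNReal.ofReal (Gam κ m) := by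
  have hk : ∀ x ∈ Set.Icc 0 m, κ * rad x < π := fun x hx =>
    (mul_le_mul_of_nonneg_left (rad_mono hx.1 hx.2) hκ.le).trans_lt h
  have hcont : ContinuousOn (Gam κ) (Set.Icc 0 m) := by
    intro x hx
    rcases hx.1.eq_or_lt with rfl | h0
    · have e : Gam κ 0 = 0 := by simp [Gam, rad_zero]
      rw [ContinuousWithinAt, e]
      have hb : Tendsto (fun v => 4 * π * rad v ^ 2 * qf κ (rad m)) (𝓝[Set.Icc 0 m] 0) (𝓝 0) := by
        have : Continuous (fun v => 4 * π * rad v ^ 2 * qf κ (rad m)) := by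
          have := rad_cont
          fun_prop
        have := (this.tendsto 0).mono_left (nhdsWithin_le_nhds (s := Set.Icc 0 m))
        simpa [rad_zero] using this
      refine squeeze_zero' ?_ ?_ hb
      · filter_upwards [self_mem_nhdsWithin] with v hv
        exact Gam_nonneg hκ hv.1 (hk v hv)
      · filter_upwards [self_mem_nhdsWithin] with v hv
        unfold Gam
        have := qf_mono hκ (rad_nonneg hv.1) (rad_mono hv.1 hv.2) h
        gcongr
    · exact (Gam_deriv hκ h0 (hk x hx)).continuousAt.continuousWithinAt
  have hmono : MonotoneOn (kf κ) (Set.Icc 0 m) := fun a ha b hb hab =>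
    kf_mono hκ ha.1 hab (hk b hb)
  have hint : IntegrableOn (kf κ) (Set.Icc 0 m) := hmono.integrableOn_isCompact isCompact_Icc
  have := intervalIntegral.integral_le_sub_of_hasDeriv_right_of_le hm hcont
    (g' := kf κ) (φ := kf κ)
    (fun x hx => (Gam_deriv hκ hx.1 (hk x ⟨hx.1.le, hx.2.le⟩)).hasDerivWithinAt) hint
    (fun x _ => le_rfl)
  have e : Gam κ 0 = 0 := by simp [Gam, rad_zero]
  rw [e, sub_zero, intervalIntegral.integral_of_le hm, integral_Ioc_eq_integral_Ioo] at this
  rw [← ofReal_integral_eq_lintegral_ofReal (hint.mono_set Set.Ioo_subset_Icc_self)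
    (Eventually.of_forall fun x => kf_nonneg κ x)]
  exact ENNReal.ofReal_le_ofReal this

/-- distribution function -/
def dist_fn (w : E3 → ℝ) (t : ℝ) : ℝ := (volume {x | t < w x}).toReal

lemma dist_fn_anti {w : E3 → ℝ} (hfin : ∀ t, 0 ≤ t → volume {x | t < w x} ≠ ⊤) {s t : ℝ}
    (hs : 0 ≤ s) (hst : s ≤ t) : dist_fn w t ≤ dist_fn w s :=
  ENNReal.toReal_mono (hfin s hs) (measure_mono fun _ hx => lt_of_le_of_lt hst hx)

lemma dist_fn_nonneg (w : E3 → ℝ) (t : ℝ) : 0 ≤ dist_fn w t := ENNReal.toReal_nonneg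

lemma dist_fn_eq {w : E3 → ℝ} (hfin : ∀ t, 0 ≤ t → volume {x | t < w x} ≠ ⊤) {t : ℝ}
    (ht : 0 ≤ t) : volume {x | t < w x} = ENNReal.ofReal (dist_fn w t) :=
  (ENNReal.ofReal_toReal (hfin t ht)).symm

lemma quantile {w : E3 → ℝ} (hw : Measurable w)
    (hfin : ∀ t, 0 ≤ t → volume {x | t < w x} ≠ ⊤) {M : ℝ} (hM : ∀ x, w x ≤ M)
    {t s : ℝ} (ht : 0 ≤ t) (hs : 0 < s) (hst : s ≤ dist_fn w t) :
    ENNReal.ofReal s ≤ volume {x | t < w x ∧ dist_fn w (w x) < s} := by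
  set Q := {τ | t ≤ τ ∧ dist_fn w τ < s} with hQ
  have hne : Q.Nonempty := by
    refine ⟨max t M, le_max_left _ _, ?_⟩
    have : {x | max t M < w x} = ∅ := by
      ext x
      simp only [Set.mem_ofPred_eq, Set.mem_empty_iff_false, iff_false, not_lt]
      exact (hM x).trans (le_max_right _ _)
    change (volume {x | max t M < w x}).toReal < s
    rw [this]; simpa using hs
  have hbd : BddBelow Q := ⟨t, fun τ h => h.1⟩
  set T := sInf Q with hT
  have htT : t ≤ T := le_csInf hne fun τ h => h.1
  have hT0 : 0 ≤ T := ht.trans htT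
  have habove : ∀ τ, T < τ → dist_fn w τ < s := by
    intro τ hτ
    obtain ⟨σ, hσ, hστ⟩ := exists_lt_of_csInf_lt hne hτ
    exact (dist_fn_anti hfin (ht.trans hσ.1) hστ.le).trans_lt hσ.2
  by_cases hc : s ≤ dist_fn w T
  · calc ENNReal.ofReal s ≤ ENNReal.ofReal (dist_fn w T) := ENNReal.ofReal_le_ofReal hc
      _ = volume {x | T < w x} := (dist_fn_eq hfin hT0).symm
      _ ≤ _ := measure_mono fun x (hx : T < w x) => (⟨htT.trans_lt hx, habove _ hx⟩ : t < w x ∧ dist_fn w (w x) < s)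
  · push Not at hc
    have htT' : t < T := by
      rcases htT.eq_or_lt with h | h
      · rw [← h] at hc; linarith
      · exact h
    have hbelow : ∀ τ, t ≤ τ → τ < T → s ≤ dist_fn w τ := by
      intro τ h1 h2
      by_contra h3
      push Not at h3
      exact absurd (csInf_le hbd (show τ ∈ Q from ⟨h1, h3⟩)) (not_le.2 h2)
    have hsub : {x | T ≤ w x} ⊆ {x | t < w x ∧ dist_fn w (w x) < s} := by
      intro x hx
      exact ⟨htT'.trans_le hx, (dist_fn_anti hfin hT0 hx).trans_lt hc⟩
    refine le_trans ?_ (measure_mono hsub)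
    set τ : ℕ → ℝ := fun n => T - (T - t) / (n + 1) with hτ
    have hτt : ∀ n, t ≤ τ n := by
      intro n
      have : (T - t) / ((n:ℝ) + 1) ≤ T - t := div_le_self (by linarith) (by linarith [Nat.cast_nonneg (α := ℝ) n])
      simp only [hτ]; linarith
    have hτT : ∀ n, τ n < T := by
      intro n
      have : 0 < (T - t) / ((n:ℝ) + 1) := div_pos (by linarith) (by positivity)
      simp only [hτ]; linarith
    have hlim : Tendsto τ atTop (𝓝 T) := by
      have := (tendsto_one_div_add_atTop_nhds_zero_nat (𝕜 := ℝ)).const_mul (T - t)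
      have := this.const_sub T
      simpa [hτ, div_eq_mul_inv] using this
    have heq : {x | T ≤ w x} = ⋂ n, {x | τ n < w x} := by
      ext x
      simp only [Set.mem_ofPred_eq, Set.mem_iInter]
      exact ⟨fun h n => (hτT n).trans_le h, fun h => le_of_tendsto' hlim fun n => (h n).le⟩
    have hanti : Antitone (fun n => {x | τ n < w x}) := by
      intro n m hnm x (hx : τ m < w x)
      change τ n < w x
      refine lt_of_le_of_lt ?_ hx
      simp only [hτ]
      have h0 : 0 ≤ T - t := by linarith
      gcongr
    rw [heq]
    refine ge_of_tendsto' (tendsto_measure_iInter_atTop (μ := volume)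
      (fun n => (measurableSet_lt measurable_const hw).nullMeasurableSet) hanti
      ⟨0, hfin _ (ht.trans (hτt 0))⟩) fun n => ?_
    simp only [Function.comp]
    rw [dist_fn_eq hfin (ht.trans (hτt n))]
    exact ENNReal.ofReal_le_ofReal (hbelow _ (hτt n) (hτT n))

lemma domination {w : E3 → ℝ} (hw : Measurable w)
    (hfin : ∀ t, 0 ≤ t → volume {x | t < w x} ≠ ⊤) {M : ℝ} (hM : ∀ x, w x ≤ M)
    (hdm : Measurable (dist_fn w))
    {t : ℝ} (ht : 0 ≤ t) {K : ℝ → ℝ} (hK0 : ∀ v, 0 ≤ K v) (hKm : Measurable K)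
    (hK : MonotoneOn K (Set.Icc 0 (dist_fn w t))) :
    ∫⁻ x in {x | t < w x}, ENNReal.ofReal (K (dist_fn w (w x))) ≤
      ∫⁻ v in Set.Ioo 0 (dist_fn w t), ENNReal.ofReal (K v) := by
  set m := dist_fn w t with hm
  have hSm : MeasurableSet {x | t < w x} := measurableSet_lt measurable_const hw
  have hmeas : Measurable (fun x => K (dist_fn w (w x))) := hKm.comp (hdm.comp hw)
  rw [lintegral_eq_lintegral_meas_lt _ (Eventually.of_forall fun x => hK0 _) hmeas.aemeasurable,
    lintegral_eq_lintegral_meas_lt _ (Eventually.of_forall fun x => hK0 _) hKm.aemeasurable]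
  refine lintegral_mono fun τ => ?_
  rw [Measure.restrict_apply (measurableSet_lt measurable_const hmeas),
    Measure.restrict_apply (measurableSet_lt measurable_const hKm)]
  set J := {v | v ∈ Set.Icc 0 m ∧ τ < K v} with hJ
  have hin : ∀ x, t < w x → dist_fn w (w x) ∈ Set.Icc 0 m := fun x hx =>
    ⟨dist_fn_nonneg _ _, dist_fn_anti hfin ht hx.le⟩
  by_cases hne : J.Nonempty
  · have hbd : BddBelow J := ⟨0, fun v hv => hv.1.1⟩
    set s := sInf J with hs
    have hs0 : 0 ≤ s := le_csInf hne fun v hv => hv.1.1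
    have hsm : s ≤ m := by
      obtain ⟨v, hv⟩ := hne
      exact (csInf_le hbd hv).trans hv.1.2
    have hR : ENNReal.ofReal (m - s) ≤ volume ({a | τ < K a} ∩ Set.Ioo 0 m) := by
      rw [← Real.volume_Ioo]
      refine measure_mono fun v hv => ⟨?_, hs0.trans_lt hv.1, hv.2⟩
      obtain ⟨u, hu, huv⟩ := exists_lt_of_csInf_lt hne hv.1
      exact lt_of_lt_of_le hu.2 (hK hu.1 ⟨(hs0.trans_lt hv.1).le, hv.2.le⟩ huv.le)
    refine le_trans ?_ hR
    have hsub : {a | τ < K (dist_fn w (w a))} ∩ {x | t < w x} ⊆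
        {x | t < w x} \ {x | t < w x ∧ dist_fn w (w x) < s} := by
      rintro x ⟨hx1, hx2⟩
      refine ⟨hx2, fun h => ?_⟩
      have : dist_fn w (w x) ∈ J := ⟨hin x hx2, hx1⟩
      exact absurd (csInf_le hbd this) (not_le.2 h.2)
    refine (measure_mono hsub).trans ?_
    have hmS : MeasurableSet {x | t < w x ∧ dist_fn w (w x) < s} :=
      hSm.inter (measurableSet_lt (hdm.comp hw) measurable_const)
    have hsub2 : {x | t < w x ∧ dist_fn w (w x) < s} ⊆ {x | t < w x} := fun x hx => hx.1
    rw [measure_sdiff hsub2 hmS.nullMeasurableSet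
      ((measure_mono hsub2).trans_lt (hfin t ht).lt_top).ne, dist_fn_eq hfin ht,
      ENNReal.ofReal_sub _ hs0]
    refine tsub_le_tsub_left ?_ _
    rcases hs0.eq_or_lt with h | h
    · rw [← h]; simp
    · exact quantile hw hfin hM ht h hsm
  · have : {a | τ < K (dist_fn w (w a))} ∩ {x | t < w x} = ∅ := by
      ext x
      simp only [Set.mem_inter_iff, Set.mem_ofPred_eq, Set.mem_empty_iff_false, iff_false, not_and]
      intro h1 h2
      exact hne ⟨_, hin x h2, h1⟩
    rw [this]; simp


lemma lint_scale {F : ℝ → ℝ≥0∞} (hF : Measurable F) (c : ℝ) {ε : ℝ} (hε : 0 < ε) :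
    ∫⁻ t, F t = ENNReal.ofReal ε * ∫⁻ s, F (c + ε * s) := by
  have h1 : ∫⁻ t, F t = ∫⁻ t, F (c + t) := (lintegral_add_left_eq_self F c).symm
  rw [h1]
  conv_lhs => rw [← Real.smul_map_volume_mul_left hε.ne']
  rw [lintegral_smul_measure, abs_of_pos hε, lintegral_map (by fun_prop) (by fun_prop)]
  rfl

lemma dist_fn_meas (w : E3 → ℝ) : Measurable (dist_fn w) := by
  have : Antitone fun t : ℝ => volume {x | t < w x} := fun s t hst =>
    measure_mono fun x (hx : t < w x) => lt_of_le_of_lt hst hx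
  exact this.measurable.ennreal_toReal

lemma unif_taylor {w : E3 → ℝ} (hw : ContDiff ℝ 1 w) (hc : HasCompactSupport (fderiv ℝ w))
    {η : ℝ} (hη : 0 < η) : ∃ δ > 0, ∀ ε, ε ≤ δ → ∀ x y, dist x y < ε →
      w y < w x + ε * (‖fderiv ℝ w x‖ + η) := by
  have hu := hc.uniformContinuous_of_continuous (hw.continuous_fderiv one_ne_zero)
  obtain ⟨δ, hδ, h⟩ := Metric.uniformContinuous_iff.1 hu η hη
  refine ⟨δ, hδ, fun ε hε x y hxy => ?_⟩
  have hε0 : 0 < ε := dist_nonneg.trans_lt hxy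
  have := (convex_ball x δ).norm_image_sub_le_of_norm_fderiv_le' (𝕜 := ℝ) (f := w) (x := x) (y := y)
    (φ := fderiv ℝ w x) (C := η)
    (fun z _ => hw.differentiable one_ne_zero z) (fun z hz => by
      have := h (a := z) (b := x) hz
      rw [dist_eq_norm] at this; exact this.le) (Metric.mem_ball_self hδ)
      (by rw [Metric.mem_ball, dist_comm]; linarith)
  have h2 := (fderiv ℝ w x).le_opNorm (y - x)
  have h3 : ‖y - x‖ < ε := by rw [← dist_eq_norm, dist_comm]; exact hxy
  rw [Real.norm_eq_abs] at this h2
  have h4 := le_abs_self (w y - w x - fderiv ℝ w x (y - x))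
  have h5 := le_abs_self (fderiv ℝ w x (y - x))
  have h6 : (‖fderiv ℝ w x‖ + η) * ‖y - x‖ < (‖fderiv ℝ w x‖ + η) * ε :=
    mul_lt_mul_of_pos_left h3 (by positivity)
  linarith

lemma iso_step {w : E3 → ℝ} (hw : Continuous w) (hfin : ∀ t, 0 ≤ t → volume {x | t < w x} ≠ ⊤)
    {t ε : ℝ} (ht : 0 ≤ t) (hε : 0 < ε) :
    ENNReal.ofReal ε * ENNReal.ofReal (4 * π * rad (dist_fn w t) ^ 2) ≤
      volume (Metric.thickening ε {x | t < w x} \ {x | t < w x}) := by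
  have hS : IsOpen {x | t < w x} := isOpen_lt continuous_const hw
  rcases (dist_fn_nonneg w t).eq_or_lt with h0 | h0
  · simp [← h0, rad_zero]
  have hr := rad_pos h0
  have hv : volume {x | t < w x} = ENNReal.ofReal (4 * π / 3 * rad (dist_fn w t) ^ 3) := by
    rw [rad_cube h0.le, dist_fn_eq hfin ht]
  have := bm_thick hS hr hε hv
  rw [measure_sdiff (Metric.self_subset_thickening hε _) hS.measurableSet.nullMeasurableSet
    (hfin t ht), hv]
  refine le_trans ?_ (tsub_le_tsub_right this _)
  rw [← ENNReal.ofReal_sub _ (by positivity), ← ENNReal.ofReal_mul hε.le]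
  apply ENNReal.ofReal_le_ofReal
  have := pi_pos
  have h1 : 0 ≤ 4 * π * (rad (dist_fn w t)) * ε ^ 2 := by positivity
  have h2 : 0 ≤ 4 * π / 3 * ε ^ 3 := by positivity
  nlinarith

lemma coarea_eps {w : E3 → ℝ} (hw : ContDiff ℝ 1 w) 
    (hb : Bornology.IsBounded {x | 0 < w x}) {h : ℝ → ℝ} (hm : Measurable h)
    (hneg : ∀ t ≤ 0, h t = 0) {η ε : ℝ} (hε : 0 < ε) (hε1 : ε ≤ 1)
    (hT : ∀ x y, dist x y < ε → w y < w x + ε * (‖fderiv ℝ w x‖ + η)) :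
    ∫⁻ t in Set.Ioi 0, ENNReal.ofReal (h t) * ENNReal.ofReal (4 * π * rad (dist_fn w t) ^ 2) ≤
      ∫⁻ x in Metric.thickening 1 {x | 0 < w x}, 
        ∫⁻ s in Set.Ico 0 (‖fderiv ℝ w x‖ + η), ENNReal.ofReal (h (w x + ε * s)) := by
  have hfin : ∀ t, 0 ≤ t → volume {x | t < w x} ≠ ⊤ := fun t ht =>
    ((hb.subset fun x (hx : t < w x) => lt_of_le_of_lt ht hx).measure_lt_top).ne
  have hwm := hw.continuous.measurable
  have hDm : Measurable fun x => ‖fderiv ℝ w x‖ :=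
    (hw.continuous_fderiv one_ne_zero).norm.measurable
  set B := Metric.thickening 1 {x | 0 < w x} with hB
  have hBo : IsOpen B := Metric.isOpen_thickening
  -- the indicator on the product
  set T : Set (E3 × ℝ) := {p | w p.1 ≤ p.2 ∧ p.2 < w p.1 + ε * (‖fderiv ℝ w p.1‖ + η)} with hTd
  have hTm : MeasurableSet T := by
    apply MeasurableSet.inter
    · exact measurableSet_le (hwm.comp measurable_fst) measurable_snd
    · exact measurableSet_lt measurable_snd
        ((hwm.comp measurable_fst).add ((((hDm.comp measurable_fst)).add_const _).const_mul _))
  have key : ENNReal.ofReal ε * ∫⁻ t in Set.Ioi 0, ENNReal.ofReal (h t) * ENNReal.ofReal (4 * π * rad (dist_fn w t) ^ 2)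
     ≤ ENNReal.ofReal ε * ∫⁻ x in B, 
        ∫⁻ s in Set.Ico 0 (‖fderiv ℝ w x‖ + η), ENNReal.ofReal (h (w x + ε * s)) := by
    calc _ = ∫⁻ t in Set.Ioi 0, ENNReal.ofReal (h t) * (ENNReal.ofReal ε * ENNReal.ofReal (4 * π * rad (dist_fn w t) ^ 2)) := by
            rw [← lintegral_const_mul' _ _ ENNReal.ofReal_ne_top]
            congr 1; ext t; ring
      _ ≤ ∫⁻ t, ENNReal.ofReal (h t) * volume {x | x ∈ B ∧ (x, t) ∈ T} := by
            refine le_trans (setLIntegral_mono' measurableSet_Ioi fun t ht => ?_) (setLIntegral_le_lintegral (Set.Ioi 0) _)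
            refine mul_le_mul_right ((iso_step hw.continuous hfin (le_of_lt ht) hε).trans (measure_mono ?_)) _
            rintro x ⟨hx1, hx2⟩
            obtain ⟨y, hy, hxy⟩ := Metric.mem_thickening_iff.1 hx1
            refine ⟨Metric.mem_thickening_iff.2 ⟨y, (lt_trans ht hy : 0 < w y), by linarith⟩, ?_, ?_⟩
            · exact not_lt.1 hx2
            · exact lt_trans hy (hT x y hxy)
      _ = ∫⁻ t, ∫⁻ x in B, T.indicator (fun p => ENNReal.ofReal (h p.2)) (x, t) := by
            congr 1; ext t
            have : MeasurableSet {x | (x, t) ∈ T} := hTm.preimage (by fun_prop)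
            have e : ∀ x, T.indicator (fun p => ENNReal.ofReal (h p.2)) (x, t) =
              {x | (x, t) ∈ T}.indicator (fun _ => ENNReal.ofReal (h t)) x := fun x => rfl
            simp_rw [e]
            rw [lintegral_indicator this, setLIntegral_const, Measure.restrict_apply this]
            congr 2
            ext x; exact and_comm
      _ = ∫⁻ x in B, ∫⁻ t, T.indicator (fun p => ENNReal.ofReal (h p.2)) (x, t) := by
            rw [lintegral_lintegral_swap]
            apply Measurable.aemeasurable
            refine (Measurable.indicator (f := fun p : E3 × ℝ => ENNReal.ofReal (h p.2)) (by fun_prop) hTm).comp measurable_swap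
      _ = _ := by
            rw [← lintegral_const_mul' _ _ ENNReal.ofReal_ne_top]
            congr 1; ext x
            rw [lint_scale _ (w x) hε]
            · congr 1
              rw [← lintegral_indicator measurableSet_Ico]
              congr 1; ext s
              have : ((x, w x + ε * s) ∈ T) ↔ s ∈ Set.Ico 0 (‖fderiv ℝ w x‖ + η) := by
                simp only [hTd, Set.mem_ofPred_eq, Set.mem_Ico]
                constructor
                · rintro ⟨h1, h2⟩
                  exact ⟨nonneg_of_mul_nonneg_right (by linarith) hε, lt_of_mul_lt_mul_left (by linarith) hε.le⟩
                · rintro ⟨h1, h2⟩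
                  have := mul_nonneg hε.le h1
                  have := mul_lt_mul_of_pos_left h2 hε
                  constructor <;> linarith
              simp only [Set.indicator, this]
            · exact (Measurable.indicator (f := fun p : E3 × ℝ => ENNReal.ofReal (h p.2)) (by fun_prop) hTm).comp (by fun_prop)
  exact (ENNReal.mul_le_mul_iff_right (by simpa using hε) ENNReal.ofReal_ne_top).1 key

lemma coarea_eta {w : E3 → ℝ} (hw : ContDiff ℝ 1 w) (hc : HasCompactSupport (fderiv ℝ w))
    (hb : Bornology.IsBounded {x | 0 < w x}) {h : ℝ → ℝ} (hm : Measurable h)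
    (hneg : ∀ t ≤ 0, h t = 0) {H : ℝ} (hH : ∀ t, h t ≤ H)
    (hrc : ∀ τ, ContinuousWithinAt h (Set.Ici τ) τ) {η : ℝ} (hη : 0 < η) :
    ∫⁻ t in Set.Ioi 0, ENNReal.ofReal (h t) * ENNReal.ofReal (4 * π * rad (dist_fn w t) ^ 2) ≤
      ∫⁻ x in Metric.thickening 1 {x | 0 < w x}, 
        ENNReal.ofReal (h (w x)) * ENNReal.ofReal (‖fderiv ℝ w x‖ + η) := by
  obtain ⟨δ, hδ, hT⟩ := unif_taylor hw hc hη
  set B := Metric.thickening 1 {x | 0 < w x} with hB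
  have hBfin : volume B ≠ ⊤ := (hb.thickening (δ := 1)).measure_lt_top.ne
  have hDc := (hw.continuous_fderiv one_ne_zero).norm
  obtain ⟨C, hC⟩ := hDc.bounded_above_of_compact_support hc.norm
  have hC' : ∀ x, ‖fderiv ℝ w x‖ ≤ C := fun x => by simpa using hC x
  have hlim1 : ∀ x, Tendsto (fun n : ℕ => ∫⁻ s in Set.Ico 0 (‖fderiv ℝ w x‖ + η), ENNReal.ofReal (h (w x + (1 / ((n:ℝ) + 1)) * s))) atTop
     (𝓝 (∫⁻ s in Set.Ico 0 (‖fderiv ℝ w x‖ + η), ENNReal.ofReal (h (w x)))) := by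
    intro x
    refine tendsto_lintegral_of_dominated_convergence (fun _ => ENNReal.ofReal H) (fun n => by fun_prop)
      (fun n => ae_of_all _ fun s => ENNReal.ofReal_le_ofReal (hH _)) ?_ ?_
    · rw [setLIntegral_const, Real.volume_Ico]; exact ENNReal.mul_ne_top (by simp) (by simp)
    · refine (ae_restrict_iff' measurableSet_Ico).2 (ae_of_all _ fun s hs => ?_)
      refine (ENNReal.continuous_ofReal.tendsto _).comp ((hrc (w x)).tendsto.comp ?_)
      refine tendsto_nhdsWithin_iff.2 ⟨?_, Eventually.of_forall fun n => ?_⟩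
      · have := ((tendsto_one_div_add_atTop_nhds_zero_nat (𝕜 := ℝ)).mul_const s).const_add (w x)
        simpa using this
      · have : 0 ≤ 1 / ((n:ℝ) + 1) * s := mul_nonneg (by positivity) hs.1
        simp only [Set.mem_Ici]; linarith
  have hlim2 : Tendsto (fun n : ℕ => ∫⁻ x in B, ∫⁻ s in Set.Ico 0 (‖fderiv ℝ w x‖ + η), ENNReal.ofReal (h (w x + (1 / ((n:ℝ) + 1)) * s))) atTop
     (𝓝 (∫⁻ x in B, ∫⁻ s in Set.Ico 0 (‖fderiv ℝ w x‖ + η), ENNReal.ofReal (h (w x)))) := by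
    refine tendsto_lintegral_of_dominated_convergence (fun _ => ENNReal.ofReal H * ENNReal.ofReal (C + η)) (fun n => ?_)
      (fun n => ae_of_all _ fun x => ?_) ?_ (ae_of_all _ hlim1)
    · have hTm : MeasurableSet {p : E3 × ℝ | 0 ≤ p.2 ∧ p.2 < ‖fderiv ℝ w p.1‖ + η} := by
        apply MeasurableSet.inter
        · exact measurableSet_le measurable_const measurable_snd
        · exact measurableSet_lt measurable_snd ((hDc.measurable.comp measurable_fst).add_const _)
      have : Measurable fun p : E3 × ℝ => ENNReal.ofReal (h (w p.1 + (1 / ((n:ℝ) + 1)) * p.2)) := by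
        have := hw.continuous.measurable
        fun_prop
      have := (this.indicator hTm).lintegral_prod_right' (ν := volume)
      have e : (fun x => ∫⁻ s in Set.Ico 0 (‖fderiv ℝ w x‖ + η), ENNReal.ofReal (h (w x + (1 / ((n:ℝ) + 1)) * s))) = _ :=
        funext fun x => (lintegral_indicator measurableSet_Ico _).symm
      rw [e]
      exact this
    · refine (setLIntegral_mono' (g := fun _ => ENNReal.ofReal H) measurableSet_Ico fun s hs => ENNReal.ofReal_le_ofReal (hH _)).trans ?_
      rw [setLIntegral_const, Real.volume_Ico]
      exact mul_le_mul_right (ENNReal.ofReal_le_ofReal (by linarith [hC' x])) _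
    · rw [setLIntegral_const]
      exact ENNReal.mul_ne_top (ENNReal.mul_ne_top (by simp) (by simp)) hBfin
  have hfin : (∫⁻ x in B, ∫⁻ s in Set.Ico 0 (‖fderiv ℝ w x‖ + η), ENNReal.ofReal (h (w x))) = 
    ∫⁻ x in B, ENNReal.ofReal (h (w x)) * ENNReal.ofReal (‖fderiv ℝ w x‖ + η) := by
    congr 1; ext x
    rw [setLIntegral_const, Real.volume_Ico, sub_zero]
  rw [← hfin]
  refine ge_of_tendsto hlim2 ?_
  have : ∀ᶠ n : ℕ in atTop, 1 / ((n:ℝ) + 1) < δ :=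
    (tendsto_one_div_add_atTop_nhds_zero_nat (𝕜 := ℝ)).eventually (gt_mem_nhds hδ)
  filter_upwards [this] with n hn
  have h1 : 1 / ((n:ℝ) + 1) ≤ 1 := by
    rw [div_le_one (by positivity)]; linarith [(Nat.cast_nonneg n : (0:ℝ) ≤ n)]
  exact coarea_eps hw hb hm hneg (by positivity) h1 (fun x y => hT _ hn.le x y)

lemma coarea_ge {w : E3 → ℝ} (hw : ContDiff ℝ 1 w) (hc : HasCompactSupport (fderiv ℝ w))
    (hb : Bornology.IsBounded {x | 0 < w x}) {h : ℝ → ℝ} (hm : Measurable h)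
    (hneg : ∀ t ≤ 0, h t = 0) {H : ℝ} (hH : ∀ t, h t ≤ H)
    (hrc : ∀ τ, ContinuousWithinAt h (Set.Ici τ) τ) :
    ∫⁻ t in Set.Ioi 0, ENNReal.ofReal (h t) * ENNReal.ofReal (4 * π * rad (dist_fn w t) ^ 2) ≤
      ∫⁻ x in {x | 0 < w x}, ENNReal.ofReal (h (w x)) * ENNReal.ofReal (‖fderiv ℝ w x‖) := by
  set B := Metric.thickening 1 {x | 0 < w x} with hB
  have hBfin : volume B ≠ ⊤ := (hb.thickening (δ := 1)).measure_lt_top.ne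
  have hDc := (hw.continuous_fderiv one_ne_zero).norm
  have hwm := hw.continuous.measurable
  have e : ∫⁻ x in {x | 0 < w x}, ENNReal.ofReal (h (w x)) * ENNReal.ofReal (‖fderiv ℝ w x‖) =
      ∫⁻ x in B, ENNReal.ofReal (h (w x)) * ENNReal.ofReal (‖fderiv ℝ w x‖) := by
    rw [← lintegral_indicator (measurableSet_lt measurable_const hwm),
      ← lintegral_indicator Metric.isOpen_thickening.measurableSet]
    congr 1; ext x
    by_cases hx : 0 < w x
    · have h2 : x ∈ B := Metric.self_subset_thickening one_pos _ hx
      rw [Set.indicator_of_mem h2, Set.indicator_of_mem (by exact hx)]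
    · have h0 := hneg _ (not_lt.1 hx)
      simp [Set.indicator, h0]
  rw [e]
  have key : ∀ n : ℕ, ∫⁻ t in Set.Ioi 0, ENNReal.ofReal (h t) * ENNReal.ofReal (4 * π * rad (dist_fn w t) ^ 2) ≤
      (∫⁻ x in B, ENNReal.ofReal (h (w x)) * ENNReal.ofReal (‖fderiv ℝ w x‖)) + 
        ENNReal.ofReal (1 / ((n:ℝ) + 1)) * (ENNReal.ofReal H * volume B) := by
    intro n
    refine (coarea_eta hw hc hb hm hneg hH hrc (η := 1 / ((n:ℝ) + 1)) (by positivity)).trans ?_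
    have : ∀ x, ENNReal.ofReal (h (w x)) * ENNReal.ofReal (‖fderiv ℝ w x‖ + 1 / ((n:ℝ) + 1)) =
      ENNReal.ofReal (h (w x)) * ENNReal.ofReal (‖fderiv ℝ w x‖) + ENNReal.ofReal (1 / ((n:ℝ) + 1)) * ENNReal.ofReal (h (w x)) := by
      intro x
      rw [ENNReal.ofReal_add (norm_nonneg _) (by positivity)]; ring
    simp_rw [this]
    rw [lintegral_add_right _ (by fun_prop), lintegral_const_mul' _ _ ENNReal.ofReal_ne_top]
    gcongr
    refine (setLIntegral_mono' (g := fun _ => ENNReal.ofReal H) Metric.isOpen_thickening.measurableSet fun s hs => ENNReal.ofReal_le_ofReal (hH _)).trans ?_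
    rw [setLIntegral_const]
  refine ge_of_tendsto' (x := atTop) (f := fun n : ℕ => _) ?_ key
  have h1 : Tendsto (fun n : ℕ => ENNReal.ofReal (1 / ((n:ℝ) + 1))) atTop (𝓝 0) := by
    have h3 := (ENNReal.continuous_ofReal.tendsto 0).comp (tendsto_one_div_add_atTop_nhds_zero_nat (𝕜 := ℝ))
    rw [ENNReal.ofReal_zero] at h3
    exact h3
  have h2 := ENNReal.Tendsto.mul_const (b := ENNReal.ofReal H * volume B) h1 (Or.inr (ENNReal.mul_ne_top (by simp) hBfin))
  simpa using h2.const_add _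


lemma two_ofReal (x : ℝ) : 2 * ENNReal.ofReal x = ENNReal.ofReal (2 * x) := by
  rw [ENNReal.ofReal_mul (by norm_num)]; simp

lemma dist_fn_rc {w : E3 → ℝ} (hfin : ∀ t, 0 ≤ t → volume {x | t < w x} ≠ ⊤) {τ : ℝ} (hτ : 0 ≤ τ) :
    ContinuousWithinAt (dist_fn w) (Set.Ici τ) τ := by
  have hanti : ∀ s t : ℝ, s ≤ t → volume {x | t < w x} ≤ volume {x | s < w x} := fun s t hst =>
    measure_mono fun x (hx : t < w x) => lt_of_le_of_lt hst hx
  have : Tendsto (fun t : ℝ => volume {x | t < w x}) (𝓝[Set.Ici τ] τ) (𝓝 (volume {x | τ < w x})) := by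
    refine tendsto_order.2 ⟨fun a ha => ?_, fun a ha => ?_⟩
    · have hU : {x | τ < w x} = ⋃ n : ℕ, {x | τ + 1 / ((n:ℝ) + 1) < w x} := by
        ext x
        simp only [Set.mem_iUnion, Set.mem_ofPred_eq]
        constructor
        · intro hx
          obtain ⟨n, hn⟩ := exists_nat_one_div_lt (sub_pos.2 hx)
          exact ⟨n, by linarith⟩
        · rintro ⟨n, hn⟩
          have : 0 < 1 / ((n:ℝ) + 1) := by positivity
          linarith
      have hmono : Monotone fun n : ℕ => {x | τ + 1 / ((n:ℝ) + 1) < w x} := by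
        intro m n hmn x (hx : τ + 1 / ((m:ℝ) + 1) < w x)
        change τ + 1 / ((n:ℝ) + 1) < w x
        have : 1 / ((n:ℝ) + 1) ≤ 1 / ((m:ℝ) + 1) := Nat.one_div_le_one_div hmn
        linarith
      have hT := tendsto_measure_iUnion_atTop (μ := volume) hmono
      rw [← hU] at hT
      obtain ⟨n, hn⟩ := (hT.eventually (lt_mem_nhds ha)).exists
      have h1 : τ < τ + 1 / ((n:ℝ) + 1) := by
        have : 0 < 1 / ((n:ℝ) + 1) := by positivity
        linarith
      filter_upwards [nhdsWithin_le_nhds (Iio_mem_nhds h1)] with t ht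
      exact lt_of_lt_of_le hn (hanti _ _ (le_of_lt ht))
    · filter_upwards [self_mem_nhdsWithin] with t ht
      exact lt_of_le_of_lt (hanti _ _ ht) ha
  exact (ENNReal.tendsto_toReal (hfin τ hτ)).comp this

def hfun (κ : ℝ) (w : E3 → ℝ) (t : ℝ) : ℝ := if 0 < t then t * qf κ (rad (dist_fn w t)) else 0

section FK
variable {w : E3 → ℝ} {κ M : ℝ} 

lemma hfun_meas : Measurable (hfun κ w) := by
  have h1 := rad_cont.measurable
  have h2 := dist_fn_meas w
  refine Measurable.ite measurableSet_Ioi ?_ measurable_const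
  unfold qf
  fun_prop

lemma kr_lt (hκ : 0 < κ) (hfin : ∀ t, 0 ≤ t → volume {x | t < w x} ≠ ⊤)
    (hk : κ * rad (dist_fn w 0) < π) {t : ℝ} (ht : 0 ≤ t) : κ * rad (dist_fn w t) < π :=
  (mul_le_mul_of_nonneg_left (rad_mono (dist_fn_nonneg _ _) (dist_fn_anti hfin le_rfl ht)) hκ.le).trans_lt hk

lemma hfun_nonneg (hκ : 0 < κ) (hfin : ∀ t, 0 ≤ t → volume {x | t < w x} ≠ ⊤)
    (hk : κ * rad (dist_fn w 0) < π) (t : ℝ) : 0 ≤ hfun κ w t := by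
  unfold hfun
  split_ifs with h
  · exact mul_nonneg h.le (qf_nonneg hκ (rad_nonneg (dist_fn_nonneg _ _)) (kr_lt hκ hfin hk h.le))
  · exact le_rfl

lemma dist_fn_zero (hM : ∀ x, w x ≤ M) {t : ℝ} (ht : M ≤ t) : dist_fn w t = 0 := by
  have : {x | t < w x} = ∅ := by
    ext x
    simp only [Set.mem_ofPred_eq, Set.mem_empty_iff_false, iff_false, not_lt]
    exact (hM x).trans ht
  simp [dist_fn, this]

lemma hfun_le (hκ : 0 < κ) (hfin : ∀ t, 0 ≤ t → volume {x | t < w x} ≠ ⊤)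
    (hk : κ * rad (dist_fn w 0) < π) (hM0 : 0 ≤ M) (hM : ∀ x, w x ≤ M) (t : ℝ) :
    hfun κ w t ≤ M * qf κ (rad (dist_fn w 0)) := by
  have hq := qf_nonneg hκ (rad_nonneg (dist_fn_nonneg w 0)) hk
  unfold hfun
  split_ifs with h
  · rcases le_or_gt M t with hMt | hMt
    · rw [dist_fn_zero hM hMt, rad_zero, qf_zero, mul_zero]; positivity
    · refine mul_le_mul hMt.le (qf_mono hκ (rad_nonneg (dist_fn_nonneg _ _)) (rad_mono (dist_fn_nonneg _ _) (dist_fn_anti hfin le_rfl h.le)) hk)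
        (qf_nonneg hκ (rad_nonneg (dist_fn_nonneg _ _)) (kr_lt hκ hfin hk h.le)) hM0
  · positivity

lemma hfun_rc (hκ : 0 < κ) (hfin : ∀ t, 0 ≤ t → volume {x | t < w x} ≠ ⊤)
    (hk : κ * rad (dist_fn w 0) < π) (τ : ℝ) :
    ContinuousWithinAt (hfun κ w) (Set.Ici τ) τ := by
  rcases lt_trichotomy τ 0 with h | h | h
  · apply ContinuousAt.continuousWithinAt
    have : hfun κ w =ᶠ[𝓝 τ] fun _ => 0 := by
      filter_upwards [Iio_mem_nhds h] with t ht
      simp [hfun, (le_of_lt ht : t ≤ 0).not_gt]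
    exact continuousAt_const.congr this.symm
  · subst h
    have h0 : hfun κ w 0 = 0 := by simp [hfun]
    rw [ContinuousWithinAt, h0]
    have hT : Tendsto (fun t : ℝ => t * qf κ (rad (dist_fn w 0))) (𝓝[Set.Ici 0] 0) (𝓝 0) := by
      have : Continuous fun t : ℝ => t * qf κ (rad (dist_fn w 0)) := by fun_prop
      have := this.tendsto 0
      rw [zero_mul] at this
      exact this.mono_left nhdsWithin_le_nhds
    refine tendsto_of_tendsto_of_tendsto_of_le_of_le' tendsto_const_nhds hT
      (Eventually.of_forall fun t => hfun_nonneg hκ hfin hk t) ?_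
    filter_upwards [self_mem_nhdsWithin] with t (ht : 0 ≤ t)
    rcases ht.eq_or_lt with rfl | ht'
    · simp [hfun]
    · rw [hfun, if_pos ht']
      exact mul_le_mul_of_nonneg_left (qf_mono hκ (rad_nonneg (dist_fn_nonneg _ _)) (rad_mono (dist_fn_nonneg _ _) (dist_fn_anti hfin le_rfl ht)) hk) ht
  · have heq : Set.EqOn (hfun κ w) (fun t => t * qf κ (rad (dist_fn w t))) (Set.Ici τ) := fun t (ht : τ ≤ t) => by
      simp [hfun, h.trans_le ht]
    refine ContinuousWithinAt.congr ?_ heq (heq Set.self_mem_Ici)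
    refine continuousWithinAt_id.mul ?_
    rcases (dist_fn_nonneg w τ).eq_or_lt with h0 | h0
    · have : Set.EqOn (fun t => qf κ (rad (dist_fn w t))) (fun _ => 0) (Set.Ici τ) := fun t (ht : τ ≤ t) => by
        have h1 := dist_fn_anti hfin h.le ht
        have h2 : dist_fn w t = 0 := le_antisymm (by linarith) (dist_fn_nonneg _ _)
        simp [h2, rad_zero, qf_zero]
      exact continuousWithinAt_const.congr this (this Set.self_mem_Ici)
    · have hc : ContinuousAt (qf κ) (rad (dist_fn w τ)) := (qf_deriv hκ (rad_pos h0) (kr_lt hκ hfin hk h.le)).continuousAt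
      have hc2 : ContinuousAt (fun v => qf κ (rad v)) (dist_fn w τ) := ContinuousAt.comp (g := qf κ) (f := rad) hc rad_cont.continuousAt
      exact ContinuousAt.comp_continuousWithinAt (g := fun v => qf κ (rad v)) hc2 (dist_fn_rc hfin h.le)

lemma int_two_t {b : ℝ} (hb : 0 < b) : ∫⁻ t in Set.Ioo 0 b, ENNReal.ofReal (2 * t) = ENNReal.ofReal (b ^ 2) := by
  rw [← ofReal_integral_eq_lintegral_ofReal]
  · congr 1
    rw [← integral_Ioc_eq_integral_Ioo, ← intervalIntegral.integral_of_le hb.le, intervalIntegral.integral_const_mul, integral_id]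
    ring
  · exact (Continuous.integrableOn_Icc (by fun_prop)).mono_set Set.Ioo_subset_Icc_self
  · refine (ae_restrict_iff' measurableSet_Ioo).2 (ae_of_all _ fun t ht => ?_)
    have := ht.1
    simp only [Pi.zero_apply]; linarith

lemma fk_iii (hw : Measurable w) (hκ : 0 < κ) (hfin : ∀ t, 0 ≤ t → volume {x | t < w x} ≠ ⊤)
    (hk : κ * rad (dist_fn w 0) < π) (hM : ∀ x, w x ≤ M) :
    ∫⁻ x in {x | 0 < w x}, ENNReal.ofReal (kf κ (dist_fn w (w x)) * w x ^ 2) ≤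
      2 * ∫⁻ t in Set.Ioi 0, ENNReal.ofReal (hfun κ w t) * ENNReal.ofReal (4 * π * rad (dist_fn w t) ^ 2) := by
  have hkm := kf_meas κ
  have hdm := dist_fn_meas w
  set T : Set (ℝ × E3) := {p | 0 < p.1 ∧ p.1 < w p.2} with hT
  have hTm : MeasurableSet T := by
    apply MeasurableSet.inter
    · exact measurableSet_lt measurable_const measurable_fst
    · exact measurableSet_lt measurable_fst (hw.comp measurable_snd)
  set F : ℝ × E3 → ℝ≥0∞ := fun p => ENNReal.ofReal (2 * p.1) * ENNReal.ofReal (kf κ (dist_fn w (w p.2)))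
  have hF : Measurable F := by fun_prop
  have e1 : ∫⁻ t in Set.Ioi 0, ENNReal.ofReal (2 * t) * ∫⁻ x in {x | t < w x}, ENNReal.ofReal (kf κ (dist_fn w (w x))) =
     ∫⁻ t, ∫⁻ x, T.indicator F (t, x) := by
    rw [← lintegral_indicator measurableSet_Ioi]
    congr 1; ext t
    by_cases ht : 0 < t
    · rw [Set.indicator_of_mem (by exact ht), ← lintegral_const_mul' _ _ ENNReal.ofReal_ne_top, ← lintegral_indicator (measurableSet_lt measurable_const hw)]
      congr 1; ext x
      simp only [Set.indicator, hT, Set.mem_ofPred_eq, ht, true_and, F]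
    · rw [Set.indicator_of_notMem (by exact ht)]
      simp [Set.indicator, hT, ht]
  have e2 : ∫⁻ x in {x | 0 < w x}, ENNReal.ofReal (kf κ (dist_fn w (w x)) * w x ^ 2) = ∫⁻ x, ∫⁻ t, T.indicator F (t, x) := by
    rw [← lintegral_indicator (measurableSet_lt measurable_const hw)]
    congr 1; ext x
    have e3 : ∫⁻ t, T.indicator F (t, x) = ∫⁻ t in Set.Ioo 0 (w x), ENNReal.ofReal (2 * t) * ENNReal.ofReal (kf κ (dist_fn w (w x))) := by
      rw [← lintegral_indicator measurableSet_Ioo]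
      rfl
    rw [e3, lintegral_mul_const' _ _ ENNReal.ofReal_ne_top]
    by_cases hx : 0 < w x
    · rw [Set.indicator_of_mem (by exact hx), int_two_t hx, ENNReal.ofReal_mul (kf_nonneg _ _), mul_comm]
    · rw [Set.indicator_of_notMem (by exact hx), Set.Ioo_eq_empty hx]; simp
  rw [e2, lintegral_lintegral_swap (f := fun x t => T.indicator F (t, x)) ((hF.indicator hTm).comp measurable_swap).aemeasurable, ← e1, ← lintegral_const_mul' _ _ (by simp)]
  refine setLIntegral_mono' measurableSet_Ioi fun t (ht : 0 < t) => ?_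
  have hkt := kr_lt hκ hfin hk ht.le
  have h1 := domination hw hfin hM hdm ht.le (kf_nonneg κ) hkm (fun a ha b hb hab => kf_mono hκ ha.1 hab 
    ((mul_le_mul_of_nonneg_left (rad_mono hb.1 hb.2) hκ.le).trans_lt hkt))
  have h2 := h1.trans (Gam_int hκ (dist_fn_nonneg w t) hkt)
  refine (mul_le_mul_right h2 _).trans ?_
  rw [← ENNReal.ofReal_mul (by positivity), ← ENNReal.ofReal_mul (hfun_nonneg hκ hfin hk t), hfun, if_pos ht]
  have : (2 : ℝ≥0∞) = ENNReal.ofReal 2 := by simp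
  rw [this, ← ENNReal.ofReal_mul (by norm_num)]
  apply ENNReal.ofReal_le_ofReal
  apply le_of_eq
  rw [Gam]; ring

theorem faber_krahn (hw : ContDiff ℝ 1 w) (hc : HasCompactSupport (fderiv ℝ w))
    (hb : Bornology.IsBounded {x | 0 < w x}) (hM : ∀ x, w x ≤ M)
    (hκ : 0 < κ) (hk : κ * rad (dist_fn w 0) < π) :
    ∫⁻ x in {x | 0 < w x}, ENNReal.ofReal (κ ^ 2 * w x ^ 2) ≤ 
      ∫⁻ x in {x | 0 < w x}, ENNReal.ofReal (‖fderiv ℝ w x‖ ^ 2) := by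
  have hfin : ∀ t, 0 ≤ t → volume {x | t < w x} ≠ ⊤ := fun t ht =>
    ((hb.subset fun x (hx : t < w x) => lt_of_le_of_lt ht hx).measure_lt_top).ne
  have hwm := hw.continuous.measurable
  have hSm : MeasurableSet {x | 0 < w x} := measurableSet_lt measurable_const hwm
  have hM' : ∀ x, w x ≤ max M 0 := fun x => (hM x).trans (le_max_left _ _)
  have hD := (hw.continuous_fderiv one_ne_zero).norm.measurable
  have h1 := fk_iii hwm hκ hfin hk hM
  have h2 := coarea_ge hw hc hb (hfun_meas (κ := κ) (w := w)) (fun t ht => by simp [hfun, ht.not_gt])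
    (hfun_le hκ hfin hk (le_max_right M 0) hM') (hfun_rc hκ hfin hk)
  have h3 := h1.trans (mul_le_mul_right h2 2)
  have hh := hfun_meas (κ := κ) (w := w)
  have e1 : ∫⁻ x in {x | 0 < w x}, ENNReal.ofReal (kf κ (dist_fn w (w x)) * w x ^ 2) =
     (∫⁻ x in {x | 0 < w x}, ENNReal.ofReal (κ ^ 2 * w x ^ 2)) + ∫⁻ x in {x | 0 < w x}, ENNReal.ofReal (hfun κ w (w x) ^ 2) := by
    rw [← lintegral_add_right _ (by fun_prop)]
    refine setLIntegral_congr_fun hSm fun x (hx : 0 < w x) => ?_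
    rw [← ENNReal.ofReal_add (by positivity) (by positivity), hfun, if_pos hx, kf]
    congr 1; ring
  have e2 : 2 * ∫⁻ x in {x | 0 < w x}, ENNReal.ofReal (hfun κ w (w x)) * ENNReal.ofReal (‖fderiv ℝ w x‖) ≤
     (∫⁻ x in {x | 0 < w x}, ENNReal.ofReal (‖fderiv ℝ w x‖ ^ 2)) + ∫⁻ x in {x | 0 < w x}, ENNReal.ofReal (hfun κ w (w x) ^ 2) := by
    rw [← lintegral_add_right _ (by fun_prop), ← lintegral_const_mul' _ _ (by simp)]
    refine lintegral_mono fun x => ?_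
    rw [← ENNReal.ofReal_mul (hfun_nonneg hκ hfin hk _), two_ofReal, ← ENNReal.ofReal_add (by positivity) (by positivity)]
    apply ENNReal.ofReal_le_ofReal
    nlinarith [sq_nonneg (hfun κ w (w x) - ‖fderiv ℝ w x‖)]
  rw [e1] at h3
  refine (ENNReal.add_le_add_iff_right ?_).1 (h3.trans e2)
  have hle : ∫⁻ x in {x | 0 < w x}, ENNReal.ofReal (hfun κ w (w x) ^ 2) ≤ ∫⁻ x in {x | 0 < w x}, ENNReal.ofReal ((max M 0 * qf κ (rad (dist_fn w 0))) ^ 2) :=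
    lintegral_mono fun x => ENNReal.ofReal_le_ofReal (pow_le_pow_left₀ (hfun_nonneg hκ hfin hk _) (hfun_le hκ hfin hk (le_max_right M 0) hM' _) 2)
  refine (hle.trans_lt ?_).ne
  rw [setLIntegral_const]
  exact ENNReal.mul_lt_top (by simp) hb.measure_lt_top
end FK


structure Coef (Ω : Set E3) (A : E3 → Matrix (Fin 3) (Fin 3) ℝ) (a : E3 → E3) (d : ℝ) : Prop where
  op : IsOpen Ω
  bd : Bornology.IsBounded Ω
  A1 : ∀ i j, ∀ x ∈ Ω, ContDiffAt ℝ 1 (fun y => A y i j) x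
  sy : ∀ x ∈ Ω, (A x).IsSymm
  d0 : 0 < d
  el : ∀ x ∈ Ω, ∀ ζ : E3, d * ‖ζ‖ ^ 2 ≤ ∑ i, ∑ j, A x i j * ζ j * ζ i
  a1 : ∀ i, ∀ x ∈ Ω, ContDiffAt ℝ 1 (fun y => a y i) x
  dv : ∀ x ∈ Ω, (∑ i, pd (fun y => a y i) i x) = 0

def Fl (A : E3 → Matrix (Fin 3) (Fin 3) ℝ) (w : E3 → ℝ) (i : Fin 3) (y : E3) : ℝ :=
  ∑ j, A y i j * pd w j y

def Lop (A : E3 → Matrix (Fin 3) (Fin 3) ℝ) (a : E3 → E3) (w : E3 → ℝ) (x : E3) : ℝ :=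
  (∑ i, pd (Fl A w i) i x) - ∑ i, a x i * pd w i x

lemma pd_contDiffAt {w : E3 → ℝ} {x : E3} (hw : ContDiffAt ℝ 2 w x) (j : Fin 3) :
    ContDiffAt ℝ 1 (pd w j) x :=
  (hw.fderiv_right (m := 1) (by norm_num)).clm_apply contDiffAt_const

lemma pd_continuousAt {w : E3 → ℝ} {x : E3} (hw : ContDiffAt ℝ 1 w x) (j : Fin 3) :
    ContinuousAt (pd w j) x :=
  ((hw.fderiv_right (m := 0) (by norm_num)).clm_apply contDiffAt_const).continuousAt

section
variable {Ω : Set E3} {A : E3 → Matrix (Fin 3) (Fin 3) ℝ} {a : E3 → E3} {d : ℝ}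

lemma Fl_contDiffAt (hC : Coef Ω A a d) {w : E3 → ℝ} {x : E3} (hx : x ∈ Ω) (hw : ContDiffAt ℝ 2 w x)
    (i : Fin 3) : ContDiffAt ℝ 1 (Fl A w i) x :=
  ContDiffAt.sum fun j _ => (hC.A1 i j x hx).mul (pd_contDiffAt hw j)

lemma Lop_continuousAt (hC : Coef Ω A a d) {w : E3 → ℝ} {x : E3} (hx : x ∈ Ω) (hw : ContDiffAt ℝ 2 w x) :
    ContinuousAt (Lop A a w) x := by
  refine ContinuousAt.sub ?_ ?_
  · exact tendsto_finsetSum _ fun i _ => pd_continuousAt (Fl_contDiffAt hC hx hw i) i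
  · exact tendsto_finsetSum _ fun i _ => ((hC.a1 i x hx).continuousAt.mul
      (pd_continuousAt (hw.of_le (by norm_num)) i))

lemma pd_sub {w v : E3 → ℝ} {x : E3} (hw : DifferentiableAt ℝ w x) (hv : DifferentiableAt ℝ v x) (i : Fin 3) :
    pd (fun y => w y - v y) i x = pd w i x - pd v i x := by
  unfold pd
  rw [fderiv_fun_sub hw hv]; rfl

lemma Lop_sub (hC : Coef Ω A a d) {w v : E3 → ℝ} {x : E3} (hx : x ∈ Ω) (hw : ContDiffAt ℝ 2 w x)
    (hv : ContDiffAt ℝ 2 v x) : Lop A a (fun y => w y - v y) x = Lop A a w x - Lop A a v x := by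
  have he : ∀ᶠ y in 𝓝 x, DifferentiableAt ℝ w y ∧ DifferentiableAt ℝ v y := by
    filter_upwards [hw.eventually (by simp), hv.eventually (by simp)] with y h1 h2
    exact ⟨h1.differentiableAt (by norm_num), h2.differentiableAt (by norm_num)⟩
  have h1 : ∀ i, pd (Fl A (fun y => w y - v y) i) i x = pd (Fl A w i) i x - pd (Fl A v i) i x := by
    intro i
    rw [← pd_sub ((Fl_contDiffAt hC hx hw i).differentiableAt (by norm_num)) ((Fl_contDiffAt hC hx hv i).differentiableAt (by norm_num))]
    unfold pd
    congr 1
    apply Filter.EventuallyEq.fderiv_eq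
    filter_upwards [he] with y hy
    simp only [Fl]
    rw [← Finset.sum_sub_distrib]
    refine Finset.sum_congr rfl fun j _ => ?_
    rw [pd_sub hy.1 hy.2]; ring
  have h2 : ∀ i, a x i * pd (fun y => w y - v y) i x = a x i * pd w i x - a x i * pd v i x := by
    intro i
    rw [pd_sub he.self_of_nhds.1 he.self_of_nhds.2]; ring
  simp only [Lop, h1, h2, Finset.sum_sub_distrib]
  ring

lemma hess_nonpos {w : E3 → ℝ} {x : E3} (hw : ContDiffAt ℝ 2 w x) (hm : IsLocalMax w x) (v : E3) :
    fderiv ℝ (fderiv ℝ w) x v v ≤ 0 := by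
  by_contra hcon
  push Not at hcon
  set l : ℝ → E3 := fun s => x + s • v with hl
  have hl0 : l 0 = x := by simp [hl]
  have hld : ∀ s, HasDerivAt l v s := fun s => by
    simpa [hl] using ((hasDerivAt_id s).smul_const v).const_add x
  have hlc : ContinuousAt l 0 := (hld 0).continuousAt
  have hlt : Tendsto l (𝓝 0) (𝓝 x) := by simpa [ContinuousAt, hl0] using hlc
  have hmax : IsLocalMax (w ∘ l) 0 := by
    have := hlt.eventually hm
    filter_upwards [this] with s hs
    simpa [hl0] using hs
  have hd1 : deriv (w ∘ l) =ᶠ[𝓝 0] fun s => fderiv ℝ w (l s) v := by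
    have : ∀ᶠ y in 𝓝 x, DifferentiableAt ℝ w y := by
      filter_upwards [hw.eventually (by simp)] with y h1
      exact h1.differentiableAt (by norm_num)
    filter_upwards [hlt.eventually this] with s hs
    exact (hs.hasFDerivAt.comp_hasDerivAt s (hld s)).deriv
  have hd2 : HasDerivAt (fun s => fderiv ℝ w (l s) v) (fderiv ℝ (fderiv ℝ w) x v v) 0 := by
    have h1 : DifferentiableAt ℝ (fderiv ℝ w) (l 0) := by
      rw [hl0]; exact (hw.fderiv_right (m := 1) (by norm_num)).differentiableAt (by norm_num)
    have h2 := h1.hasFDerivAt.comp_hasDerivAt (0:ℝ) (hld 0)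
    rw [hl0] at h2
    have h3 := h2.clm_apply (hasDerivAt_const (0:ℝ) v)
    simpa using h3
  have hdd : deriv (deriv (w ∘ l)) 0 = fderiv ℝ (fderiv ℝ w) x v v := by
    rw [hd1.deriv_eq, hd2.deriv]
  have hcont : ContinuousAt (w ∘ l) 0 := by
    refine ContinuousAt.comp ?_ hlc
    rw [hl0]; exact hw.continuousAt
  have hmin := isLocalMin_of_deriv_deriv_pos (by rw [hdd]; exact hcon) hmax.deriv_eq_zero hcont
  have hconst : (w ∘ l) =ᶠ[𝓝 0] fun _ => (w ∘ l) 0 := by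
    filter_upwards [hmax, hmin] with s h1 h2
    exact le_antisymm h1 h2
  have : deriv (deriv (w ∘ l)) 0 = 0 := by
    have h1 : deriv (w ∘ l) =ᶠ[𝓝 0] deriv (fun _ => (w ∘ l) 0) := hconst.deriv
    rw [h1.deriv_eq]; simp
  linarith

lemma Lop_nonpos (hC : Coef Ω A a d) {w : E3 → ℝ} {x : E3} (hx : x ∈ Ω) (hw : ContDiffAt ℝ 2 w x)
    (hm : IsLocalMax w x) : Lop A a w x ≤ 0 := by
  have h0 : fderiv ℝ w x = 0 := hm.fderiv_eq_zero
  have hp : ∀ j, pd w j x = 0 := fun j => by simp [pd, h0]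
  have hpd : ∀ i j, pd (pd w j) i x = fderiv ℝ (fderiv ℝ w) x (EuclideanSpace.single i 1) (EuclideanSpace.single j 1) := by
    intro i j
    have h1 : DifferentiableAt ℝ (fderiv ℝ w) x := 
      (hw.fderiv_right (m := 1) (by norm_num)).differentiableAt (by norm_num)
    unfold pd
    rw [fderiv_clm_apply h1 (differentiableAt_const _)]
    simp
  have hF : ∀ i, pd (Fl A w i) i x = ∑ j, A x i j * pd (pd w j) i x := by
    intro i
    have h1 : ∀ j, DifferentiableAt ℝ (fun y => A y i j) x := fun j => (hC.A1 i j x hx).differentiableAt (by norm_num)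
    have h2 : ∀ j, DifferentiableAt ℝ (pd w j) x := fun j => (pd_contDiffAt hw j).differentiableAt (by norm_num)
    have h3 : HasFDerivAt (Fl A w i) (∑ j, (A x i j • fderiv ℝ (pd w j) x + pd w j x • fderiv ℝ (fun y => A y i j) x)) x :=
      HasFDerivAt.fun_sum fun j _ => (h1 j).hasFDerivAt.mul (h2 j).hasFDerivAt
    simp [pd, h3.fderiv, hp]
    simp [h0]
  have hpsd : (A x).PosSemidef := by
    refine Matrix.PosSemidef.of_dotProduct_mulVec_nonneg ?_ ?_
    · have := hC.sy x hx
      rw [Matrix.IsHermitian, Matrix.conjTranspose_eq_transpose_of_trivial]; exact this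
    · intro ζ
      have := hC.el x hx (WithLp.toLp 2 ζ)
      have h2 : 0 ≤ d * ‖WithLp.toLp 2 ζ‖ ^ 2 := mul_nonneg hC.d0.le (by positivity)
      refine h2.trans (this.trans (le_of_eq ?_))
      simp only [dotProduct, Matrix.mulVec, Pi.star_apply, star_trivial, Finset.mul_sum]
      refine Finset.sum_congr rfl fun i _ => Finset.sum_congr rfl fun j _ => ?_
      ring
  obtain ⟨m, v, hv⟩ := Matrix.posSemidef_iff_eq_sum_vecMulVec.1 hpsd
  have hA : ∀ i j, A x i j = ∑ k, v k i * v k j := by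
    intro i j
    rw [hv, Matrix.sum_apply]
    simp [Matrix.vecMulVec_apply]
  have key : Lop A a w x = ∑ k, fderiv ℝ (fderiv ℝ w) x (∑ i, v k i • EuclideanSpace.single i 1) (∑ j, v k j • EuclideanSpace.single j 1) := by
    simp only [Lop, hF, hp, hpd, hA, mul_zero, Finset.sum_const_zero, sub_zero, map_sum, map_smul, 
      ContinuousLinearMap.sum_apply, ContinuousLinearMap.smul_apply, smul_eq_mul, Finset.sum_mul, Finset.mul_sum]
    rw [Finset.sum_comm' (t' := Finset.univ) (s' := fun _ => Finset.univ) (by simp)]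
    simp only [Finset.sum_comm (s := (Finset.univ : Finset (Fin 3))) (t := (Finset.univ : Finset (Fin m)))]
    refine Finset.sum_congr rfl fun k _ => Finset.sum_congr rfl fun i _ => Finset.sum_congr rfl fun j _ => ?_
    ring
  rw [key]
  exact Finset.sum_nonpos fun k _ => hess_nonpos hw hm _

lemma Lop_le (hC : Coef Ω A a d) {w v : E3 → ℝ} {x : E3} (hx : x ∈ Ω) (hw : ContDiffAt ℝ 2 w x)
    (hv : ContDiffAt ℝ 2 v x) (hm : IsLocalMax (fun y => w y - v y) x) :
    Lop A a w x ≤ Lop A a v x := by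
  have := Lop_nonpos hC hx (hw.sub hv) hm
  have h2 := Lop_sub hC hx hw hv
  linarith
end


/-- half squared positive part -/
def pp (k s : ℝ) : ℝ := max (s - k) 0 ^ 2 / 2

lemma max_cont (k : ℝ) : Continuous fun s : ℝ => max (s - k) 0 := by fun_prop

lemma pp_deriv (k s : ℝ) : HasDerivAt (pp k) (max (s - k) 0) s := by
  rcases lt_trichotomy s k with h | h | h
  · have : pp k =ᶠ[𝓝 s] fun _ => 0 := by
      filter_upwards [Iio_mem_nhds h] with t ht
      have : t - k ≤ 0 := by have : t < k := ht; linarith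
      simp [pp, max_eq_right this]
    rw [max_eq_right (by linarith)]
    exact (hasDerivAt_const s (0:ℝ)).congr_of_eventuallyEq this
  · subst h
    simp only [sub_self, max_self]
    rw [hasDerivAt_iff_isLittleO]
    have h1 : pp s s = 0 := by simp [pp]
    simp only [h1, sub_zero, smul_zero]
    have : (fun t => pp s t) =O[𝓝 s] fun t => (t - s) ^ 2 := by
      refine Asymptotics.IsBigO.of_bound 1 (Eventually.of_forall fun t => ?_)
      simp only [pp, Real.norm_eq_abs, abs_div, abs_pow, one_mul, sq_abs, abs_two]
      rcases le_total (t - s) 0 with h | h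
      · rw [max_eq_right h]; simp; positivity
      · rw [max_eq_left h]; nlinarith [sq_nonneg (t - s)]
    exact this.trans_isLittleO (by simpa using Asymptotics.isLittleO_pow_sub_sub (m := 2) s (by norm_num))
  · have : pp k =ᶠ[𝓝 s] fun t => (t - k) ^ 2 / 2 := by
      filter_upwards [Ioi_mem_nhds h] with t ht
      have : 0 ≤ t - k := by have : k < t := ht; linarith
      simp [pp, max_eq_left this]
    rw [max_eq_left (by linarith)]
    have h2 := ((((hasDerivAt_id s).sub_const k).pow 2).div_const 2).congr_of_eventuallyEq this
    refine h2.congr_deriv ?_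
    simp

lemma pp_contDiff (k : ℝ) : ContDiff ℝ 1 (pp k) := by
  rw [contDiff_one_iff_deriv]
  refine ⟨fun s => (pp_deriv k s).differentiableAt, ?_⟩
  have : deriv (pp k) = fun s => max (s - k) 0 := funext fun s => (pp_deriv k s).deriv
  rw [this]; exact max_cont k

lemma pp_zero {k s : ℝ} (h : s ≤ k) : pp k s = 0 := by
  simp [pp, h]

section
variable {Ω : Set E3} {A : E3 → Matrix (Fin 3) (Fin 3) ℝ} {a : E3 → E3} {d : ℝ} {U : E3 → ℝ} {k : ℝ}

/-- spatial slice conditions -/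
structure Slice (Ω : Set E3) (U : E3 → ℝ) : Prop where
  op : IsOpen Ω
  bd : Bornology.IsBounded Ω
  ct : Continuous U
  zo : ∀ x, x ∉ Ω → U x = 0
  c2 : ∀ x ∈ Ω, ContDiffAt ℝ 2 U x

lemma Slice.sub (hU : Slice Ω U) (hk : 0 < k) : {x | k ≤ U x} ⊆ Ω := by
  intro x (hx : k ≤ U x)
  by_contra h
  rw [hU.zo x h] at hx
  linarith

lemma Slice.cpt (hU : Slice Ω U) (hk : 0 < k) : IsCompact {x | k ≤ U x} :=
  Metric.isCompact_of_isClosed_isBounded (isClosed_le continuous_const hU.ct) (hU.bd.subset (hU.sub hk))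

lemma Slice.supp (hU : Slice Ω U) (hk : 0 < k) {G : E3 → ℝ} (hG : ∀ x, U x < k → G x = 0) :
    HasCompactSupport G :=
  HasCompactSupport.intro (hU.cpt hk) fun x hx => hG x (not_le.1 hx)

lemma Slice.near (hU : Slice Ω U) (hk : 0 < k) {G : E3 → ℝ} (hG : ∀ x, U x < k → G x = 0) {x : E3} (hx : x ∉ Ω) :
    G =ᶠ[𝓝 x] fun _ => 0 := by
  have : ∀ᶠ y in 𝓝 x, U y < k := by
    have h1 : Tendsto U (𝓝 x) (𝓝 (U x)) := hU.ct.tendsto x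
    rw [hU.zo x hx] at h1
    exact h1.eventually (gt_mem_nhds hk)
  filter_upwards [this] with y hy using hG y hy

lemma Slice.cont (hU : Slice Ω U) (hk : 0 < k) {G : E3 → ℝ} (hG : ∀ x, U x < k → G x = 0)
    (hc : ∀ x ∈ Ω, ContinuousAt G x) : Continuous G := by
  refine continuous_iff_continuousAt.2 fun x => ?_
  by_cases hx : x ∈ Ω
  · exact hc x hx
  · exact continuousAt_const.congr (hU.near hk hG hx).symm

lemma Slice.integ (hU : Slice Ω U) (hk : 0 < k) {G : E3 → ℝ} (hG : ∀ x, U x < k → G x = 0)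
    (hc : ∀ x ∈ Ω, ContinuousAt G x) : Integrable G :=
  (hU.cont hk hG hc).integrable_of_hasCompactSupport (hU.supp hk hG)

lemma Slice.cd (hU : Slice Ω U) (hk : 0 < k) {G : E3 → ℝ} (hG : ∀ x, U x < k → G x = 0)
    (hc : ∀ x ∈ Ω, ContDiffAt ℝ 1 G x) : ContDiff ℝ 1 G := by
  refine contDiff_iff_contDiffAt.2 fun x => ?_
  by_cases hx : x ∈ Ω
  · exact hc x hx
  · exact contDiffAt_const.congr_of_eventuallyEq (hU.near hk hG hx)

lemma int_pd_zero {X : E3 → ℝ} (hX : ContDiff ℝ 1 X) (hc : HasCompactSupport X) (i : Fin 3) :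
    ∫ x, pd X i x = 0 := by
  have h1 : Continuous (pd X i) := continuous_iff_continuousAt.2 fun x => pd_continuousAt hX.contDiffAt i
  have h2 : HasCompactSupport (pd X i) := by
    refine (hc.fderiv (𝕜 := ℝ)).comp_left (g := fun L : E3 →L[ℝ] ℝ => L (EuclideanSpace.single i 1)) ?_
    simp
  have := integral_mul_fderiv_eq_neg_fderiv_mul_of_integrable (μ := (volume : Measure E3)) (f := fun _ => (1:ℝ)) (g := X) (v := EuclideanSpace.single i 1)
    (by simp) (by have := h1.integrable_of_hasCompactSupport (μ := (volume : Measure E3)) h2; simp only [one_mul]; exact this) (by simpa using hX.continuous.integrable_of_hasCompactSupport hc)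
    (fun x _ => differentiableAt_const _) (fun x _ => hX.differentiable (by norm_num) x)
  simpa [pd] using this

lemma ibp (hU : Slice Ω U) (hk : 0 < k) {ψ ψ' : ℝ → ℝ} (hψ : ContDiff ℝ 1 ψ) (hd : ∀ s, HasDerivAt ψ (ψ' s) s)
    (h0 : ∀ s ≤ k, ψ s = 0) (h0' : ∀ s ≤ k, ψ' s = 0) {F : E3 → ℝ} (hF : ∀ x ∈ Ω, ContDiffAt ℝ 1 F x) (i : Fin 3) :
    Integrable (fun x => ψ (U x) * pd F i x) ∧ Integrable (fun x => ψ' (U x) * (pd U i x * F x)) ∧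
    ∫ x, ψ (U x) * pd F i x = - ∫ x, ψ' (U x) * (pd U i x * F x) := by
  have hψ'c : Continuous ψ' := by
    have : deriv ψ = ψ' := funext fun s => (hd s).deriv
    rw [← this]; exact hψ.continuous_deriv le_rfl
  have i1 : Integrable (fun x => ψ (U x) * pd F i x) := by
    refine hU.integ hk (fun x hx => by simp [h0 _ hx.le]) fun x hx => ?_
    exact (hψ.continuous.comp hU.ct).continuousAt.mul (pd_continuousAt (hF x hx) i)
  have i2 : Integrable (fun x => ψ' (U x) * (pd U i x * F x)) := by
    refine hU.integ hk (fun x hx => by simp [h0' _ hx.le]) fun x hx => ?_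
    exact (hψ'c.comp hU.ct).continuousAt.mul ((pd_continuousAt ((hU.c2 x hx).of_le (by norm_num)) i).mul (hF x hx).continuousAt)
  refine ⟨i1, i2, ?_⟩
  set X : E3 → ℝ := fun x => ψ (U x) * F x with hX
  have hX0 : ∀ x, U x < k → X x = 0 := fun x hx => by simp [hX, h0 _ hx.le]
  have hX1 : ContDiff ℝ 1 X := hU.cd hk hX0 fun x hx =>
    (hψ.contDiffAt.comp x ((hU.c2 x hx).of_le (by norm_num))).mul (hF x hx)
  have e : ∀ x, pd X i x = ψ (U x) * pd F i x + ψ' (U x) * (pd U i x * F x) := by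
    intro x
    by_cases hx : x ∈ Ω
    · have h1 := (hd (U x)).comp_hasFDerivAt x ((hU.c2 x hx).differentiableAt (by norm_num)).hasFDerivAt
      have h2 := h1.mul ((hF x hx).differentiableAt (by norm_num)).hasFDerivAt
      have h3 : fderiv ℝ X x = _ := h2.fderiv
      simp only [pd, h3]
      simp
      ring
    · have h1 := hU.near hk hX0 hx
      have h2 : pd X i x = 0 := by simp [pd, h1.fderiv_eq]
      rw [h2, h0 _ (by rw [hU.zo x hx]; exact hk.le), h0' _ (by rw [hU.zo x hx]; exact hk.le)]
      simp
  have := int_pd_zero hX1 (hU.supp hk hX0) i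
  simp_rw [e] at this
  rw [integral_add i1 i2] at this
  linarith

lemma drift_zero (hC : Coef Ω A a d) (hU : Slice Ω U) (hk : 0 < k) :
    Integrable (fun x => max (U x - k) 0 * ∑ i, a x i * pd U i x) ∧
    ∫ x, max (U x - k) 0 * ∑ i, a x i * pd U i x = 0 := by
  have h := fun i => ibp hU hk (pp_contDiff k) (pp_deriv k) (fun s hs => pp_zero hs) (fun s hs => by simp [hs]) (F := fun y => a y i) (hC.a1 i) i
  have e : (fun x => max (U x - k) 0 * ∑ i, a x i * pd U i x) = fun x => ∑ i, max (U x - k) 0 * (pd U i x * a x i) := by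
    ext x; rw [Finset.mul_sum]; refine Finset.sum_congr rfl fun i _ => by ring
  rw [e]
  refine ⟨integrable_finsetSum _ fun i _ => (h i).2.1, ?_⟩
  rw [integral_finsetSum _ fun i _ => (h i).2.1]
  have h2 : ∑ i, ∫ x, max (U x - k) 0 * (pd U i x * a x i) = - ∑ i, ∫ x, pp k (U x) * pd (fun y => a y i) i x := by
    rw [← Finset.sum_neg_distrib]
    refine Finset.sum_congr rfl fun i _ => ?_
    rw [(h i).2.2]; ring
  rw [h2, ← integral_finsetSum _ fun i _ => (h i).1]
  have : ∀ x, ∑ i, pp k (U x) * pd (fun y => a y i) i x = 0 := by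
    intro x
    rw [← Finset.mul_sum]
    by_cases hx : x ∈ Ω
    · rw [hC.dv x hx, mul_zero]
    · rw [pp_zero (by rw [hU.zo x hx]; exact hk.le), zero_mul]
  simp [this]

lemma fderiv_norm_le (U : E3 → ℝ) (x : E3) : ‖fderiv ℝ U x‖ ≤ ‖(WithLp.toLp 2 fun i => pd U i x : E3)‖ := by
  refine ContinuousLinearMap.opNorm_le_bound _ (norm_nonneg _) fun v => ?_
  have hv : v = ∑ i, v i • EuclideanSpace.single i (1:ℝ) := by
    ext j
    simp [Finset.sum_apply, Pi.single_apply]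
  have : fderiv ℝ U x v = inner ℝ (WithLp.toLp 2 fun i => pd U i x : E3) v := by
    conv_lhs => rw [hv]
    rw [map_sum, PiLp.inner_apply]
    refine Finset.sum_congr rfl fun i _ => ?_
    simp [pd]
  rw [this]
  exact norm_inner_le_norm _ _

def psd (k δ s : ℝ) : ℝ := (pp k s - pp (k + δ) s) / δ
def psd' (k δ s : ℝ) : ℝ := (max (s - k) 0 - max (s - (k + δ)) 0) / δ

lemma psd_deriv (k δ s : ℝ) : HasDerivAt (psd k δ) (psd' k δ s) s :=
  ((pp_deriv k s).sub (pp_deriv (k + δ) s)).div_const δ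

lemma psd_contDiff (k δ : ℝ) : ContDiff ℝ 1 (psd k δ) := ((pp_contDiff k).sub (pp_contDiff _)).div_const δ

lemma psd_zero {k δ s : ℝ} (hδ : 0 < δ) (h : s ≤ k) : psd k δ s = 0 := by
  simp [psd, pp_zero h, pp_zero (show s ≤ k + δ by linarith)]

lemma psd'_zero {k δ s : ℝ} (hδ : 0 < δ) (h : s ≤ k) : psd' k δ s = 0 := by
  simp [psd', h, (show s ≤ k + δ by linarith)]

lemma psd'_nonneg {k δ s : ℝ} (hδ : 0 < δ) : 0 ≤ psd' k δ s := by
  refine div_nonneg (sub_nonneg.2 (max_le_max (by linarith) le_rfl)) hδ.le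

lemma psd'_one {k δ s : ℝ} (hδ : 0 < δ) (h : k + δ ≤ s) : psd' k δ s = 1 := by
  rw [psd', max_eq_left (by linarith), max_eq_left (by linarith)]; field_simp; ring

lemma psd_big {k δ s : ℝ} (hδ : 0 < δ) (h : k + δ ≤ s) : psd k δ s = s - k - δ / 2 := by
  rw [psd, pp, pp, max_eq_left (by linarith), max_eq_left (by linarith)]; field_simp; ring

lemma psd_small {k δ s : ℝ} (hδ : 0 < δ) (h : s ≤ k + δ) : psd k δ s ≤ δ / 2 := by
  rw [psd, pp_zero h, pp, sub_zero, div_le_iff₀ hδ]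
  have h1 : max (s - k) 0 ≤ δ := max_le (by linarith) hδ.le
  have h2 : 0 ≤ max (s - k) 0 := le_max_right _ _
  nlinarith

lemma psd_nonneg {k δ s : ℝ} (hδ : 0 < δ) : 0 ≤ psd k δ s := by
  rcases le_total s (k + δ) with h | h
  · rw [psd, pp_zero h, pp, sub_zero]; positivity
  · rw [psd_big hδ h]; linarith

lemma psd_le {k δ s : ℝ} (hδ : 0 < δ) : psd k δ s ≤ max (s - k) 0 := by
  rcases le_total s (k + δ) with h | h
  · rw [psd, pp_zero h, pp, sub_zero, div_le_iff₀ hδ]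
    have h1 : max (s - k) 0 ≤ δ := max_le (by linarith) hδ.le
    have h2 : 0 ≤ max (s - k) 0 := le_max_right _ _
    nlinarith
  · rw [psd_big hδ h]; exact le_max_of_le_left (by linarith)

lemma psd_ge {k δ s : ℝ} (hδ : 0 < δ) : max (s - k) 0 - δ ≤ psd k δ s := by
  rcases le_total s (k + δ) with h | h
  · have := psd_nonneg (k := k) (s := s) hδ
    have h1 : max (s - k) 0 ≤ δ := max_le (by linarith) hδ.le
    linarith
  · rw [psd_big hδ h, max_eq_left (by linarith)]; linarith
end


section
variable {Ω : Set E3} {A : E3 → Matrix (Fin 3) (Fin 3) ℝ} {a : E3 → E3} {d : ℝ} {U : E3 → ℝ} {k : ℝ}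

lemma psd_pos_iff {k δ s : ℝ} (hδ : 0 < δ) : 0 < psd k δ s - δ / 2 ↔ k + δ < s := by
  constructor
  · intro h
    by_contra h2
    have := psd_small hδ (not_lt.1 h2)
    linarith
  · intro h
    rw [psd_big hδ h.le]; linarith

lemma Slice.c1 (hU : Slice Ω U) {x : E3} (hx : x ∈ Ω) : ContDiffAt ℝ 1 U x := (hU.c2 x hx).of_le (by norm_num)

lemma psd'_cont (k δ : ℝ) : Continuous (psd' k δ) := by unfold psd'; fun_prop

lemma fderiv_contAt {x : E3} (hU : ContDiffAt ℝ 1 U x) : ContinuousAt (fun y => ‖fderiv ℝ U y‖ ^ 2) x :=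
  ((hU.fderiv_right (m := 0) (by norm_num)).continuousAt.norm).pow 2

lemma integ_grad (hU : Slice Ω U) (hk : 0 < k) {δ : ℝ} (hδ : 0 < δ) :
    Integrable fun x => psd' k δ (U x) * ‖fderiv ℝ U x‖ ^ 2 :=
  hU.integ hk (fun x hx => by rw [psd'_zero hδ hx.le, zero_mul]) fun x hx =>
    ((psd'_cont k δ).comp hU.ct).continuousAt.mul (fderiv_contAt (hU.c1 hx))

lemma fk_step (hU : Slice Ω U) (hk : 0 < k) {δ κ : ℝ} (hδ : 0 < δ) (hκ : 0 < κ)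
    (h : κ * rad ((volume {x | k < U x}).toReal) < π) :
    κ ^ 2 * ∫ x, max (U x - (k + δ)) 0 ^ 2 ≤ ∫ x, psd' k δ (U x) * ‖fderiv ℝ U x‖ ^ 2 := by
  set G : E3 → ℝ := fun x => psd k δ (U x) with hG
  have hG0 : ∀ x, U x < k → G x = 0 := fun x hx => psd_zero hδ hx.le
  have hG1 : ContDiff ℝ 1 G := hU.cd hk hG0 fun x hx => (psd_contDiff k δ).contDiffAt.comp x (hU.c1 hx)
  obtain ⟨C, hCb⟩ := hG1.continuous.bounded_above_of_compact_support (hU.supp hk hG0)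
  set w : E3 → ℝ := fun x => G x - δ / 2 with hw
  have hfw : ∀ x, fderiv ℝ w x = fderiv ℝ G x := fun x => by
    rw [hw]; exact fderiv_sub_const (δ / 2)
  have hset : {x | 0 < w x} = {x | k + δ < U x} := by
    ext x; exact psd_pos_iff hδ
  have hfin : volume {x | k < U x} ≠ ∞ := by
    refine ((measure_mono ?_).trans_lt hU.bd.measure_lt_top).ne
    intro x (hx : k < U x)
    exact hU.sub hk (by exact hx.le)
  have hfk := faber_krahn (w := w) (κ := κ) (M := C) (hG1.sub contDiff_const) ?_ ?_ ?_ hκ ?_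
  · have hmeas : MeasurableSet {x | 0 < w x} := by
      rw [hset]; exact (isOpen_lt continuous_const hU.ct).measurableSet
    have hi1 : Integrable fun x => κ ^ 2 * max (U x - (k + δ)) 0 ^ 2 := by
      refine hU.integ hk (fun x hx => ?_) fun x hx => ?_
      · rw [max_eq_right (by linarith)]; simp
      · have := hU.ct; fun_prop
    have e1 : ∫⁻ x, ENNReal.ofReal (κ ^ 2 * max (U x - (k + δ)) 0 ^ 2) =
        ∫⁻ x in {x | 0 < w x}, ENNReal.ofReal (κ ^ 2 * w x ^ 2) := by
      rw [← lintegral_indicator hmeas]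
      refine lintegral_congr fun x => ?_
      by_cases hx : 0 < w x
      · rw [Set.indicator_of_mem (by exact hx)]
        have h2 := (psd_pos_iff hδ).1 hx
        congr 2
        rw [max_eq_left (by linarith), hw]
        simp only [hG]
        rw [psd_big hδ h2.le]; ring
      · rw [Set.indicator_of_notMem (by exact hx)]
        have h2 : ¬ (k + δ < U x) := fun h => hx ((psd_pos_iff hδ).2 h)
        rw [max_eq_right (by linarith)]; simp
    have e2 : ∫⁻ x in {x | 0 < w x}, ENNReal.ofReal (‖fderiv ℝ w x‖ ^ 2) ≤
        ∫⁻ x, ENNReal.ofReal (psd' k δ (U x) * ‖fderiv ℝ U x‖ ^ 2) := by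
      refine (setLIntegral_mono' hmeas ?_).trans (setLIntegral_le_lintegral _ _)
      intro x (hx : 0 < w x)
      have h2 := (psd_pos_iff hδ).1 hx
      have hxΩ : x ∈ Ω := hU.sub hk (show k ≤ U x by linarith)
      have h3 := (psd_deriv k δ (U x)).comp_hasFDerivAt x ((hU.c1 hxΩ).differentiableAt (by norm_num)).hasFDerivAt
      have h4 : fderiv ℝ G x = _ := h3.fderiv
      rw [hfw, h4, psd'_one hδ h2.le]; simp
    have h5 := e1.trans_le (hfk.trans e2)
    rw [← ofReal_integral_eq_lintegral_ofReal hi1 (Eventually.of_forall fun x => by positivity),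
      ← ofReal_integral_eq_lintegral_ofReal (integ_grad hU hk hδ) (Eventually.of_forall fun x => mul_nonneg (psd'_nonneg hδ) (by positivity)),
      ENNReal.ofReal_le_ofReal_iff (integral_nonneg fun x => mul_nonneg (psd'_nonneg hδ) (by positivity)), integral_const_mul] at h5
    exact h5
  · refine HasCompactSupport.intro (hU.cpt hk) fun x hx => ?_
    have hx' : U x < k := not_le.1 hx
    rw [hfw]
    have : G =ᶠ[𝓝 x] fun _ => 0 := by
      filter_upwards [(hU.ct.tendsto x).eventually (gt_mem_nhds hx')] with y hy using hG0 y hy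
    rw [this.fderiv_eq]; simp
  · rw [hset]
    refine hU.bd.subset fun x (hx : k + δ < U x) => hU.sub hk (show k ≤ U x by linarith)
  · intro x
    have := (le_abs_self _).trans (hCb x)
    simp only [hw]; linarith
  · refine lt_of_le_of_lt ?_ h
    refine mul_le_mul_of_nonneg_left (rad_mono (dist_fn_nonneg _ _) ?_) hκ.le
    unfold dist_fn
    rw [hset]
    exact ENNReal.toReal_mono hfin (measure_mono fun x (hx : k + δ < U x) => show k < U x by linarith)

lemma ell_step (hC : Coef Ω A a d) (hU : Slice Ω U) (hk : 0 < k) {δ : ℝ} (hδ : 0 < δ) :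
    ∫ x, psd k δ (U x) * ∑ i, pd (Fl A U i) i x ≤ - (d * ∫ x, psd' k δ (U x) * ‖fderiv ℝ U x‖ ^ 2) := by
  have h := fun i => ibp hU hk (psd_contDiff k δ) (psd_deriv k δ) (fun s hs => psd_zero hδ hs) (fun s hs => psd'_zero hδ hs)
    (F := Fl A U i) (fun x hx => Fl_contDiffAt hC hx (hU.c2 x hx) i) i
  simp_rw [Finset.mul_sum]
  rw [integral_finsetSum _ fun i _ => (h i).1]
  simp_rw [fun i => (h i).2.2]
  rw [Finset.sum_neg_distrib, ← integral_finsetSum _ fun i _ => (h i).2.1, ← integral_const_mul]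
  refine neg_le_neg (integral_mono ((integ_grad hU hk hδ).const_mul d) (integrable_finsetSum _ fun i _ => (h i).2.1) fun x => ?_)
  dsimp only
  rw [← Finset.mul_sum]
  by_cases hx : x ∈ Ω
  · have h1 := hC.el x hx (WithLp.toLp 2 fun i => pd U i x : E3)
    have h2 := fderiv_norm_le U x
    have h3 : ∑ i, ∑ j, A x i j * (WithLp.toLp 2 fun i => pd U i x : E3) j * (WithLp.toLp 2 fun i => pd U i x : E3) i
        = ∑ i, pd U i x * Fl A U i x := by
      refine Finset.sum_congr rfl fun i _ => ?_
      simp only [Fl, Finset.mul_sum]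
      refine Finset.sum_congr rfl fun j _ => ?_
      ring
    rw [h3] at h1
    have h4 : d * ‖fderiv ℝ U x‖ ^ 2 ≤ ∑ i, pd U i x * Fl A U i x := by
      refine le_trans ?_ h1
      have := hC.d0
      gcongr
    calc _ = psd' k δ (U x) * (d * ‖fderiv ℝ U x‖ ^ 2) := by ring
      _ ≤ _ := mul_le_mul_of_nonneg_left h4 (psd'_nonneg hδ)
  · rw [psd'_zero hδ (by rw [hU.zo x hx]; exact hk.le)]; simp

lemma P_integ (hC : Coef Ω A a d) (hU : Slice Ω U) (hk : 0 < k) :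
    Integrable fun x => 2 * max (U x - k) 0 * Lop A a U x := by
  refine hU.integ hk (fun x hx => ?_) fun x hx => ?_
  · rw [max_eq_right (by linarith)]; simp
  · refine ContinuousAt.mul ?_ (Lop_continuousAt hC hx (hU.c2 x hx))
    have := hU.ct; fun_prop

theorem spatial (hC : Coef Ω A a d) (hU : Slice Ω U) (hk : 0 < k) {κ : ℝ} (hκ : 0 < κ)
    (h : κ * rad ((volume {x | k < U x}).toReal) < π) :
    ∫ x, 2 * max (U x - k) 0 * Lop A a U x ≤ - (2 * d * κ ^ 2) * ∫ x, max (U x - k) 0 ^ 2 := by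
  set S : E3 → ℝ := fun x => ∑ i, pd (Fl A U i) i x with hS
  have hSc : ∀ x ∈ Ω, ContinuousAt S x := fun x hx =>
    tendsto_finsetSum _ fun i _ => pd_continuousAt (Fl_contDiffAt hC hx (hU.c2 x hx) i) i
  have hct := hU.ct
  have i1 : Integrable fun x => max (U x - k) 0 * S x := by
    refine hU.integ hk (fun x hx => ?_) fun x hx => ?_
    · rw [max_eq_right (by linarith)]; simp
    · refine ContinuousAt.mul ?_ (hSc x hx)
      fun_prop
  have i2 : Integrable fun x => max (U x - k) 0 ^ 2 := by
    refine hU.integ hk (fun x hx => ?_) fun x hx => ?_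
    · rw [max_eq_right (by linarith)]; simp
    · fun_prop
  have key : ∫ x, max (U x - k) 0 * S x ≤ - (d * κ ^ 2 * ∫ x, max (U x - k) 0 ^ 2) := by
    set δ : ℕ → ℝ := fun n => 1 / ((n : ℝ) + 1) with hδ
    have hδp : ∀ n, 0 < δ n := fun n => by simp only [hδ]; positivity
    have hδt : Tendsto δ atTop (𝓝 0) := tendsto_one_div_add_atTop_nhds_zero_nat
    have t1 : Tendsto (fun n => ∫ x, psd k (δ n) (U x) * S x) atTop (𝓝 (∫ x, max (U x - k) 0 * S x)) := by
      refine tendsto_integral_of_dominated_convergence (fun x => ‖max (U x - k) 0 * S x‖) (fun n => ?_) i1.norm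
        (fun n => Eventually.of_forall fun x => ?_) (Eventually.of_forall fun x => ?_)
      · exact (hU.integ hk (G := fun x => psd k (δ n) (U x) * S x) (fun x hx => by rw [psd_zero (hδp n) hx.le, zero_mul]) fun x hx =>
          (((psd_contDiff k (δ n)).continuous.comp hct).continuousAt.mul (hSc x hx))).aestronglyMeasurable
      · rw [norm_mul, norm_mul]
        refine mul_le_mul_of_nonneg_right ?_ (norm_nonneg _)
        rw [Real.norm_eq_abs, Real.norm_eq_abs, abs_of_nonneg (psd_nonneg (hδp n)), abs_of_nonneg (le_max_right _ _)]
        exact psd_le (hδp n)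
      · refine Tendsto.mul_const _ ?_
        refine tendsto_of_tendsto_of_tendsto_of_le_of_le (g := fun n => max (U x - k) 0 - δ n) (h := fun n => max (U x - k) 0) ?_ tendsto_const_nhds
          (fun n => psd_ge (hδp n)) (fun n => psd_le (hδp n))
        simpa using hδt.const_sub (max (U x - k) 0)
    have t2 : Tendsto (fun n => ∫ x, max (U x - (k + δ n)) 0 ^ 2) atTop (𝓝 (∫ x, max (U x - k) 0 ^ 2)) := by
      refine tendsto_integral_of_dominated_convergence (fun x => max (U x - k) 0 ^ 2) (fun n => ?_) i2
        (fun n => Eventually.of_forall fun x => ?_) (Eventually.of_forall fun x => ?_)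
      · exact Continuous.aestronglyMeasurable (by fun_prop)
      · rw [Real.norm_eq_abs, abs_of_nonneg (by positivity)]
        have := hδp n
        gcongr
        linarith
      · have h1 : Continuous fun s : ℝ => max (U x - (k + s)) 0 ^ 2 := by fun_prop
        have h2 := (h1.tendsto 0).comp hδt
        simp only [add_zero] at h2
        exact h2
    refine le_of_tendsto_of_tendsto' t1 (t2.const_mul (d * κ ^ 2)).neg fun n => ?_
    refine (ell_step hC hU hk (hδp n)).trans (neg_le_neg ?_)
    rw [mul_assoc]
    exact mul_le_mul_of_nonneg_left (fk_step hU hk (hδp n) hκ h) hC.d0.le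
  have e : (fun x => 2 * max (U x - k) 0 * Lop A a U x) =
      fun x => 2 * (max (U x - k) 0 * S x) - 2 * (max (U x - k) 0 * ∑ i, a x i * pd U i x) := by
    ext x; simp only [Lop, hS]; ring
  obtain ⟨d1, d2⟩ := drift_zero hC hU hk
  rw [e, integral_sub (i1.const_mul 2) (d1.const_mul 2), integral_const_mul, integral_const_mul, d2]
  linarith
end


section
variable {Ω : Set E3} {A : E3 → Matrix (Fin 3) (Fin 3) ℝ} {a : E3 → E3} {d : ℝ} {V : E3 → ℝ → ℝ} {k : ℝ}

/-- nonnegative classical subsolution on the time interval (0,1) -/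
structure SubSol (Ω : Set E3) (A : E3 → Matrix (Fin 3) (Fin 3) ℝ) (a : E3 → E3) (d : ℝ) (V : E3 → ℝ → ℝ) : Prop where
  co : Coef Ω A a d
  ct : Continuous fun p : E3 × ℝ => V p.1 p.2
  zo : ∀ x t, x ∉ Ω → V x t = 0
  nn : ∀ x t, 0 ≤ V x t
  c2 : ∀ t ∈ Set.Ioo (0:ℝ) 1, ∀ x ∈ Ω, ContDiffAt ℝ 2 (fun y => V y t) x
  de : ∀ x ∈ Ω, ∀ t ∈ Set.Ioo (0:ℝ) 1, ∃ v', HasDerivAt (V x) v' t ∧ v' ≤ Lop A a (fun y => V y t) x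

lemma SubSol.ctx (h : SubSol Ω A a d V) (t : ℝ) : Continuous fun x => V x t :=
  h.ct.comp (continuous_id.prodMk continuous_const)

lemma SubSol.slice (h : SubSol Ω A a d V) {t : ℝ} (ht : t ∈ Set.Ioo (0:ℝ) 1) : Slice Ω fun x => V x t :=
  ⟨h.co.op, h.co.bd, h.ctx t, fun x hx => h.zo x t hx, h.c2 t ht⟩

lemma SubSol.cpt (h : SubSol Ω A a d V) : IsCompact (closure Ω) := h.co.bd.isCompact_closure

lemma SubSol.bound (h : SubSol Ω A a d V) : ∃ M, 0 ≤ M ∧ ∀ x, ∀ t ∈ Set.Icc (0:ℝ) 1, V x t ≤ M := by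
  obtain ⟨M, hM⟩ := ((h.cpt.prod (isCompact_Icc (a := (0:ℝ)) (b := 1))).bddAbove_image h.ct.continuousOn)
  refine ⟨max M 0, le_max_right _ _, fun x t ht => ?_⟩
  by_cases hx : x ∈ Ω
  · exact le_max_of_le_left (hM ⟨(x, t), ⟨subset_closure hx, ht⟩, rfl⟩)
  · rw [h.zo x t hx]; exact le_max_right _ _

lemma SubSol.kk (h : SubSol Ω A a d V) (hk : 0 < k) : IsCompact {x | ∃ s ∈ Set.Icc (0:ℝ) 1, k ≤ V x s} := by
  have h1 : IsCompact ((closure Ω ×ˢ Set.Icc (0:ℝ) 1) ∩ {p : E3 × ℝ | k ≤ V p.1 p.2}) :=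
    (h.cpt.prod isCompact_Icc).inter_right (isClosed_le continuous_const h.ct)
  have h2 := h1.image continuous_fst
  have e : {x | ∃ s ∈ Set.Icc (0:ℝ) 1, k ≤ V x s} = Prod.fst '' ((closure Ω ×ˢ Set.Icc (0:ℝ) 1) ∩ {p : E3 × ℝ | k ≤ V p.1 p.2}) := by
    ext x
    constructor
    · rintro ⟨s, hs, hx⟩
      have hxΩ : x ∈ Ω := by
        by_contra hx2
        rw [h.zo x s hx2] at hx; linarith
      exact ⟨(x, s), ⟨⟨subset_closure hxΩ, hs⟩, hx⟩, rfl⟩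
    · rintro ⟨⟨y, s⟩, ⟨⟨_, hs⟩, hx⟩, rfl⟩
      exact ⟨s, hs, hx⟩
  rw [e]; exact h2

lemma left_deriv {φ : ℝ → ℝ} {v s t : ℝ} (hts : t < s) (hd : HasDerivAt φ v s) (hm : ∀ r ∈ Set.Icc t s, φ r ≤ φ s) : 0 ≤ v := by
  by_contra hv
  push Not at hv
  have h1 := (hasDerivAt_iff_tendsto_slope.1 hd).mono_left (nhdsWithin_mono s (show Set.Iio s ⊆ {s}ᶜ from fun y hy => ne_of_lt hy))
  have h2 := h1.eventually (gt_mem_nhds hv)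
  obtain ⟨r, hr1, hr2⟩ := (h2.and (Ioo_mem_nhdsLT hts)).exists
  have h3 := hm r ⟨hr2.1.le, hr2.2.le⟩
  rw [slope_def_field] at hr1
  have : 0 ≤ (φ r - φ s) / (r - s) := div_nonneg_of_nonpos (by linarith) (by linarith [hr2.2])
  linarith

lemma SubSol.barrier (h : SubSol Ω A a d V) (hk : 0 < k) {t : ℝ} (ht : t ∈ Set.Ioo (0:ℝ) 1) :
    ∃ C, 0 ≤ C ∧ ∀ x, ∀ s ∈ Set.Ico t 1, k ≤ V x s → V x s ≤ V x t + C * (s - t) := by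
  set K : Set E3 := {x | ∃ s ∈ Set.Icc (0:ℝ) 1, k ≤ V x s} with hK
  have hKΩ : K ⊆ Ω := by
    rintro x ⟨s, _, hx⟩
    by_contra hx2
    rw [h.zo x s hx2] at hx; linarith
  obtain ⟨L, hL, hKL, hLΩ⟩ := exists_compact_between (h.kk hk) h.co.op hKΩ
  obtain ⟨ζ, hζ0, hζ1, hζr⟩ := exists_contMDiffMap_zero_one_of_isClosed (n := 2) (modelWithCornersSelf ℝ E3) (h.kk hk).isClosed
    (isOpen_interior (s := L)).isClosed_compl (Set.disjoint_compl_right_iff_subset.2 hKL)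
  have hζc : ContDiff ℝ 2 ζ := ζ.contMDiff.contDiff
  set W : E3 → ℝ := fun y => V y t + k * ζ y with hW
  have hWc : ∀ x ∈ Ω, ContDiffAt ℝ 2 W x := fun x hx => (h.c2 t ht x hx).add (contDiffAt_const.mul hζc.contDiffAt)
  obtain ⟨C0, hC0⟩ := hL.bddAbove_image (f := Lop A a W) (fun x hx => (Lop_continuousAt h.co (hLΩ hx) (hWc x (hLΩ hx))).continuousWithinAt)
  set C := max C0 0 + 1 with hC
  have hCp : 0 ≤ C := by positivity
  have hCL : ∀ x ∈ L, Lop A a W x < C := fun x hx => by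
    have := hC0 ⟨x, hx, rfl⟩
    have := le_max_left C0 0
    linarith
  refine ⟨C, hCp, fun x s hs hx => ?_⟩
  have hs01 : s ∈ Set.Icc (0:ℝ) 1 := ⟨ht.1.le.trans hs.1, hs.2.le⟩
  have hxK : x ∈ K := ⟨s, hs01, hx⟩
  have hxL : x ∈ L := interior_subset (hKL hxK)
  set Φ : E3 × ℝ → ℝ := fun p => V p.1 p.2 - W p.1 - C * (p.2 - t) with hΦ
  have hWct : Continuous W := (h.ctx t).add (continuous_const.mul hζc.continuous)
  have hΦc : Continuous Φ := by
    have h1 := h.ct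
    have h2 := hWct.comp (continuous_fst (X := E3) (Y := ℝ))
    exact (h1.sub h2).sub (by fun_prop)
  obtain ⟨⟨y, r⟩, hyr, hmax⟩ := (hL.prod (isCompact_Icc (a := t) (b := s))).exists_isMaxOn
    ⟨(x, s), hxL, hs.1, le_rfl⟩ hΦc.continuousOn
  have hyL : y ∈ L := hyr.1
  have hr : r ∈ Set.Icc t s := hyr.2
  have hval : Φ (y, r) ≤ 0 := by
    by_contra hcon
    push Not at hcon
    have hζy := hζr y
    have hWy : V y t ≤ W y := by
      have : 0 ≤ k * ζ y := mul_nonneg hk.le hζy.1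
      simp only [hW]; linarith
    have hr01 : r ∈ Set.Ioo (0:ℝ) 1 := ⟨ht.1.trans_le hr.1, hr.2.trans_lt hs.2⟩
    rcases hr.1.eq_or_lt with hrt | hrt
    · subst hrt
      simp only [hΦ] at hcon
      linarith
    by_cases hyi : y ∈ interior L
    · have hyΩ := hLΩ hyL
      have hloc : IsLocalMax (fun z => V z r - W z) y := by
        filter_upwards [mem_interior_iff_mem_nhds.1 hyi] with z hz
        have := hmax (show (z, r) ∈ L ×ˢ Set.Icc t s from ⟨hz, hr⟩)
        simp only [hΦ, Set.mem_ofPred_eq] at this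
        linarith
      have h1 := Lop_le h.co hyΩ (h.c2 r hr01 y hyΩ) (hWc y hyΩ) hloc
      obtain ⟨v', hv', hv'2⟩ := h.de y hyΩ r hr01
      have h2 : HasDerivAt (fun q => V y q - C * (q - t)) (v' - C * 1) r :=
        hv'.sub (((hasDerivAt_id r).sub_const t).const_mul C)
      have h3 := left_deriv hrt h2 fun q hq => by
        have := hmax (show (y, q) ∈ L ×ˢ Set.Icc t s from ⟨hyL, hq.1, hq.2.trans hr.2⟩)
        simp only [hΦ, Set.mem_ofPred_eq] at this
        linarith
      have := hCL y hyL
      linarith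
    · have hζy1 : ζ y = 1 := hζ1 hyi
      have hyK : V y r < k := by
        by_contra h1
        exact hyi (hKL ⟨r, ⟨hr01.1.le, hr01.2.le⟩, not_lt.1 h1⟩)
      have h2 : 0 ≤ C * (r - t) := mul_nonneg hCp (by linarith)
      have h3 := h.nn y t
      simp only [hΦ, hW, hζy1] at hcon
      linarith
  have h1 := hmax (show (x, s) ∈ L ×ˢ Set.Icc t s from ⟨hxL, hs.1, le_rfl⟩)
  have h2 : Φ (x, s) ≤ Φ (y, r) := h1
  have h3 : ζ x = 0 := hζ0 hxK
  simp only [hΦ, hW, h3] at h2 hval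
  linarith


/-- truncated energy -/
def En (V : E3 → ℝ → ℝ) (k t : ℝ) : ℝ := ∫ x, max (V x t - k) 0 ^ 2

lemma SubSol.integ0 (h : SubSol Ω A a d V) {G : E3 → ℝ} (hG : Continuous G) (h0 : ∀ x, x ∉ Ω → G x = 0) : Integrable G :=
  hG.integrable_of_hasCompactSupport (HasCompactSupport.intro h.cpt fun x hx => h0 x fun h2 => hx (subset_closure h2))

lemma SubSol.en_integ (h : SubSol Ω A a d V) (hk : 0 ≤ k) (t : ℝ) : Integrable fun x => max (V x t - k) 0 ^ 2 := by
  refine h.integ0 ?_ fun x hx => ?_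
  · have := h.ctx t; fun_prop
  · rw [h.zo x t hx, max_eq_right (by linarith)]; simp

lemma SubSol.en_cont (h : SubSol Ω A a d V) (hk : 0 ≤ k) : Continuous (En V k) := by
  have e : En V k = fun t => ∫ x in closure Ω, max (V x t - k) 0 ^ 2 := by
    ext t
    refine (setIntegral_eq_integral_of_forall_compl_eq_zero fun x hx => ?_).symm
    rw [h.zo x t fun h2 => hx (subset_closure h2), max_eq_right (by linarith)]; simp
  rw [e]
  refine continuous_parametric_integral_of_continuous ?_ h.cpt
  have h1 : Continuous fun p : ℝ × E3 => V p.2 p.1 := h.ct.comp continuous_swap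
  exact ((h1.sub continuous_const).max continuous_const).pow 2

lemma SubSol.dini (h : SubSol Ω A a d V) (hk : 0 < k) {t : ℝ} (ht : t ∈ Set.Ioo (0:ℝ) 1) {r : ℝ}
    (hr : ∫ x, 2 * max (V x t - k) 0 * Lop A a (fun y => V y t) x < r) :
    ∀ᶠ s in 𝓝[>] t, (s - t)⁻¹ * (En V k s - En V k t) < r := by
  set P : E3 → ℝ := fun x => 2 * max (V x t - k) 0 * Lop A a (fun y => V y t) x with hP
  have hPi : Integrable P := P_integ h.co (h.slice ht) hk
  set q : ℝ → E3 → ℝ := fun s x => (s - t)⁻¹ * (max (V x s - k) 0 ^ 2 - max (V x t - k) 0 ^ 2) with hq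
  have hqi : ∀ s, Integrable (q s) := fun s => ((h.en_integ hk.le s).sub (h.en_integ hk.le t)).const_mul _
  obtain ⟨C, hC, hbar⟩ := h.barrier hk ht
  obtain ⟨M, hM, hVM⟩ := h.bound
  have hev : ∀ᶠ s in 𝓝[>] t, s ∈ Set.Ioo t 1 := Ioo_mem_nhdsGT ht.2
  have hP0 : ∀ x, x ∉ Ω → P x = 0 := fun x hx => by
    simp only [hP]; rw [h.zo x t hx, max_eq_right (by linarith)]; simp
  have hq0 : ∀ s x, x ∉ Ω → q s x = 0 := fun s x hx => by
    simp only [hq]; rw [h.zo x t hx, h.zo x s hx]; simp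
  have hqb : ∀ s ∈ Set.Ioo t 1, ∀ x, q s x ≤ 2 * M * C := by
    intro s hs x
    have hst : 0 < s - t := by linarith [hs.1]
    simp only [hq]
    rw [inv_mul_le_iff₀ hst]
    set X := max (V x s - k) 0 with hX
    set Y := max (V x t - k) 0 with hY
    have hX0 : 0 ≤ X := le_max_right _ _
    have hY0 : 0 ≤ Y := le_max_right _ _
    have hXM : X ≤ M := max_le (by linarith [hVM x s ⟨by linarith [ht.1, hs.1], hs.2.le⟩]) hM
    have hYM : Y ≤ M := max_le (by linarith [hVM x t ⟨ht.1.le, ht.2.le⟩]) hM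
    have hCs : 0 ≤ C * (s - t) := by positivity
    have hXY : X ≤ Y + C * (s - t) := by
      rcases le_total k (V x s) with h1 | h1
      · have h2 := hbar x s ⟨hs.1.le, hs.2⟩ h1
        have h3 : V x t - k ≤ Y := le_max_left _ _
        refine max_le ?_ (by linarith)
        linarith
      · rw [hX, max_eq_right (by linarith)]; linarith
    have h4 : X ^ 2 - Y ^ 2 = (X - Y) * (X + Y) := by ring
    rw [h4]
    calc (X - Y) * (X + Y) ≤ (C * (s - t)) * (X + Y) := mul_le_mul_of_nonneg_right (by linarith) (by linarith)
      _ ≤ (C * (s - t)) * (M + M) := mul_le_mul_of_nonneg_left (by linarith) hCs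
      _ = _ := by ring
  have hBi : Integrable fun x => |P x| + (closure Ω).indicator (fun _ => 2 * M * C) x :=
    hPi.abs.add ((integrable_indicator_iff h.cpt.isClosed.measurableSet).2 (integrableOn_const (h.cpt.measure_lt_top.ne)))
  have hMC : 0 ≤ 2 * M * C := by positivity
  have T : Tendsto (fun s => ∫ x, max (q s x) (P x)) (𝓝[>] t) (𝓝 (∫ x, P x)) := by
    refine tendsto_integral_filter_of_dominated_convergence _ ?_ ?_ hBi ?_
    · exact Eventually.of_forall fun s => ((hqi s).sup hPi).aestronglyMeasurable
    · filter_upwards [hev] with s hs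
      refine Eventually.of_forall fun x => ?_
      by_cases hx : x ∈ Ω
      · rw [Set.indicator_of_mem (subset_closure hx), Real.norm_eq_abs, abs_le]
        have h1 := hqb s hs x
        have h2 := neg_abs_le (P x)
        have h3 := le_abs_self (P x)
        have h4 := abs_nonneg (P x)
        constructor
        · exact le_max_of_le_right (by linarith)
        · exact max_le (by linarith) (by linarith)
      · rw [hP0 x hx, hq0 s x hx]
        simp only [max_self, norm_zero, abs_zero, zero_add]
        exact Set.indicator_nonneg (fun _ _ => hMC) _
    · refine Eventually.of_forall fun x => ?_
      by_cases hx : x ∈ Ω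
      · obtain ⟨v', hv', hle⟩ := h.de x hx t ht
        have h1 := ((pp_deriv k (V x t)).comp t hv').const_mul 2
        have h2 := (hasDerivAt_iff_tendsto_slope.1 h1).mono_left (nhdsWithin_mono t (show Set.Ioi t ⊆ {t}ᶜ from fun y hy => ne_of_gt hy))
        have h3 : Tendsto (fun s => q s x) (𝓝[>] t) (𝓝 (2 * (max (V x t - k) 0 * v'))) := by
          refine h2.congr fun s => ?_
          simp only [hq, slope_def_field, pp, Function.comp]
          ring
        have h4 := h3.max (tendsto_const_nhds (x := P x))
        rwa [max_eq_right (a := 2 * (max (V x t - k) 0 * v'))] at h4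
        simp only [hP]
        rw [mul_assoc]
        have : 0 ≤ max (V x t - k) 0 := le_max_right _ _
        gcongr
      · simp only [hP0 x hx, hq0 _ x hx, max_self]
        exact tendsto_const_nhds
  filter_upwards [T.eventually (gt_mem_nhds hr)] with s hs
  refine lt_of_le_of_lt ?_ hs
  have e : (s - t)⁻¹ * (En V k s - En V k t) = ∫ x, q s x := by
    simp only [hq]
    rw [integral_const_mul, integral_sub (h.en_integ hk.le s) (h.en_integ hk.le t)]; rfl
  rw [e]
  exact integral_mono (hqi s) ((hqi s).sup hPi) fun x => le_max_left _ _

theorem SubSol.decay (h : SubSol Ω A a d V) (hk : 0 < k) {κ t1 t2 : ℝ} (hκ : 0 < κ) (h1 : 0 ≤ t1) (h12 : t1 < t2) (h2 : t2 ≤ 1)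
    (hv : ∀ s ∈ Set.Ioo t1 t2, κ * rad ((volume {x | k < V x s}).toReal) < π) :
    En V k t2 ≤ En V k t1 * exp (- (2 * d * κ ^ 2) * (t2 - t1)) := by
  have hc := h.en_cont hk.le
  have key : ∀ t ∈ Set.Ioo t1 t2, En V k t2 ≤ En V k t * exp (- (2 * d * κ ^ 2) * (t2 - t)) := by
    intro t ht
    have := le_gronwallBound_of_liminf_deriv_right_le (f := En V k) (f' := fun t => ∫ x, 2 * max (V x t - k) 0 * Lop A a (fun y => V y t) x)
      (δ := En V k t) (K := - (2 * d * κ ^ 2)) (ε := 0) (a := t) (b := t2) hc.continuousOn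
      (fun s hs r hr => (h.dini hk ⟨by linarith [ht.1, hs.1], by linarith [hs.2]⟩ hr).frequently)
      le_rfl
      (fun s hs => by
        rw [add_zero]
        exact spatial h.co (h.slice ⟨by linarith [ht.1, hs.1], by linarith [hs.2]⟩) hk hκ (hv s ⟨by linarith [ht.1, hs.1], hs.2⟩))
      t2 ⟨ht.2.le, le_rfl⟩
    rwa [gronwallBound_ε0] at this
  have T : Tendsto (fun t => En V k t * exp (- (2 * d * κ ^ 2) * (t2 - t))) (𝓝[>] t1) (𝓝 (En V k t1 * exp (- (2 * d * κ ^ 2) * (t2 - t1)))) := by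
    have : Continuous fun t => En V k t * exp (- (2 * d * κ ^ 2) * (t2 - t)) := by fun_prop
    exact (this.tendsto t1).mono_left nhdsWithin_le_nhds
  refine ge_of_tendsto T ?_
  filter_upwards [Ioo_mem_nhdsGT h12] with t ht using key t ht

end


section
variable {Ω : Set E3} {A : E3 → Matrix (Fin 3) (Fin 3) ℝ} {a : E3 → E3} {d : ℝ} {V : E3 → ℝ → ℝ} {k : ℝ}

lemma rad_lt {v R : ℝ} (hv : 0 ≤ v) (hR : 0 ≤ R) (h : v < 4 * π / 3 * R ^ 3) : rad v < R := by
  by_contra h2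
  push Not at h2
  have h3 := rad_cube hv
  have h4 : R ^ 3 ≤ rad v ^ 3 := pow_le_pow_left₀ hR h2 3
  have : 4 * π / 3 * R ^ 3 ≤ 4 * π / 3 * rad v ^ 3 := mul_le_mul_of_nonneg_left h4 (by positivity)
  linarith

lemma SubSol.set_sub (h : SubSol Ω A a d V) (hk : 0 ≤ k) (t : ℝ) : {x | k < V x t} ⊆ Ω := by
  intro x (hx : k < V x t)
  by_contra h2
  rw [h.zo x t h2] at hx; linarith

lemma SubSol.vol_le (h : SubSol Ω A a d V) (hk : 0 ≤ k) (t : ℝ) : (volume {x | k < V x t}).toReal ≤ (volume Ω).toReal :=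
  ENNReal.toReal_mono h.co.bd.measure_lt_top.ne (measure_mono (h.set_sub hk t))

lemma SubSol.decay_all (h : SubSol Ω A a d V) (hk : 0 < k) {κ t1 t2 : ℝ} (hκ : 0 < κ) (h1 : 0 ≤ t1) (h12 : t1 < t2) (h2 : t2 ≤ 1)
    (hv : κ * rad ((volume Ω).toReal) < π) :
    En V k t2 ≤ En V k t1 * exp (- (2 * d * κ ^ 2) * (t2 - t1)) :=
  h.decay hk hκ h1 h12 h2 fun s _ => lt_of_le_of_lt (mul_le_mul_of_nonneg_left (rad_mono ENNReal.toReal_nonneg (h.vol_le hk.le s)) hκ.le) hv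

lemma En_nonneg (V : E3 → ℝ → ℝ) (k t : ℝ) : 0 ≤ En V k t := integral_nonneg fun x => by positivity

lemma SubSol.mono_t (h : SubSol Ω A a d V) (hk : 0 < k) {t1 t2 : ℝ} (h1 : 0 ≤ t1) (h12 : t1 ≤ t2) (h2 : t2 ≤ 1) :
    En V k t2 ≤ En V k t1 := by
  rcases h12.eq_or_lt with rfl | h12
  · exact le_rfl
  set r := rad ((volume Ω).toReal) with hr
  have hr0 : 0 ≤ r := rad_nonneg ENNReal.toReal_nonneg
  have hd := h.co.d0
  refine (h.decay_all hk (κ := 1 / (r + 1)) (by positivity) h1 h12 h2 ?_).trans ?_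
  · rw [← hr, div_mul_eq_mul_div, one_mul, div_lt_iff₀ (by positivity)]
    nlinarith [Real.pi_gt_three]
  · refine mul_le_of_le_one_right (En_nonneg _ _ _) (exp_le_one_iff.2 ?_)
    have : 0 ≤ (2 * d * (1 / (r + 1)) ^ 2) * (t2 - t1) := mul_nonneg (by positivity) (by linarith)
    linarith

lemma SubSol.mono_k (h : SubSol Ω A a d V) {k' : ℝ} (hk : 0 ≤ k) (hkk : k ≤ k') (t : ℝ) : En V k' t ≤ En V k t := by
  refine integral_mono (h.en_integ (hk.trans hkk) t) (h.en_integ hk t) fun x => ?_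
  dsimp only
  gcongr

lemma SubSol.cheb (h : SubSol Ω A a d V) {k' : ℝ} (hk : 0 ≤ k) (hkk : k < k') (t : ℝ) :
    (volume {x | k' < V x t}).toReal * (k' - k) ^ 2 ≤ En V k t := by
  have hm : MeasurableSet {x | k' < V x t} := (isOpen_lt continuous_const (h.ctx t)).measurableSet
  have hfin : volume {x | k' < V x t} ≠ ∞ :=
    ((measure_mono (h.set_sub (hk.trans hkk.le) t)).trans_lt h.co.bd.measure_lt_top).ne
  have e : (volume {x | k' < V x t}).toReal * (k' - k) ^ 2 = ∫ x, {x | k' < V x t}.indicator (fun _ => (k' - k) ^ 2) x := by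
    rw [integral_indicator hm, setIntegral_const]; rfl
  rw [e]
  refine integral_mono ((integrable_indicator_iff hm).2 (integrableOn_const hfin)) (h.en_integ hk t) fun x => ?_
  dsimp only
  by_cases hx : k' < V x t
  · rw [Set.indicator_of_mem (by exact hx)]
    have h1 : k' - k ≤ max (V x t - k) 0 := le_max_of_le_left (by linarith)
    exact pow_le_pow_left₀ (by linarith) h1 2
  · rw [Set.indicator_of_notMem (by exact hx)]; positivity

lemma SubSol.en_zero (h : SubSol Ω A a d V) (t : ℝ) : Tendsto (fun n : ℕ => En V (1 / ((n:ℝ) + 1)) t) atTop (𝓝 (En V 0 t)) := by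
  refine tendsto_integral_of_dominated_convergence (fun x => max (V x t - 0) 0 ^ 2) (fun n => ?_) (h.en_integ le_rfl t)
    (fun n => Eventually.of_forall fun x => ?_) (Eventually.of_forall fun x => ?_)
  · exact (h.en_integ (by positivity) t).aestronglyMeasurable
  · rw [Real.norm_eq_abs, abs_of_nonneg (by positivity)]
    gcongr
    positivity
  · have h1 : Continuous fun s : ℝ => max (V x t - s) 0 ^ 2 := by fun_prop
    exact (h1.tendsto 0).comp tendsto_one_div_add_atTop_nhds_zero_nat

lemma SubSol.decay0 (h : SubSol Ω A a d V) {κ : ℝ} (hκ : 0 < κ) (hv : κ * rad ((volume Ω).toReal) < π) :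
    En V 0 1 ≤ En V 0 0 * exp (- (2 * d * κ ^ 2)) := by
  refine le_of_tendsto_of_tendsto' (h.en_zero 1) ((h.en_zero 0).mul_const _) fun n => ?_
  have := h.decay_all (k := 1 / ((n:ℝ) + 1)) (by positivity) hκ le_rfl zero_lt_one le_rfl hv
  simpa using this

lemma exp5 : exp (-5) ≤ 1 / 32 := by
  rw [exp_neg, one_div]
  refine inv_anti₀ (by norm_num) ?_
  have h1 : (2:ℝ) ≤ exp 1 := by have := Real.add_one_le_exp 1; linarith
  have h2 : exp 5 = exp 1 ^ 5 := by rw [← exp_nat_mul]; norm_num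
  rw [h2]
  calc (32:ℝ) = 2 ^ 5 := by norm_num
    _ ≤ _ := pow_le_pow_left₀ (by norm_num) h1 5

theorem SubSol.sup_bound (h : SubSol Ω A a d V) {ρ b K : ℝ} (hρ : 0 < ρ) (hρd : 5 * ρ ^ 2 = d * π ^ 2) (hb : En V 0 0 ≤ b) (hb0 : 0 < b)
    (hK : 0 < K) (hKb : b ≤ K ^ 2 * ρ ^ 3) (x : E3) : V x 1 ≤ 2 * K := by
  have hd := h.co.d0
  set p : ℕ → ℝ := fun j => (1 / 2 : ℝ) ^ j with hp
  have hp0 : ∀ j, 0 < p j := fun j => by simp only [hp]; positivity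
  have hp1 : ∀ j, p j ≤ 1 := fun j => pow_le_one₀ (by norm_num) (by norm_num)
  have hps : ∀ j, p (j + 1) = p j / 2 := fun j => by simp only [hp, pow_succ]; ring
  have claim : ∀ j, En V (K * (2 - p j)) (1 - p j) ≤ b * p j ^ 5 := by
    intro j
    induction j with
    | zero =>
      have : p 0 = 1 := by simp [hp]
      rw [this]
      norm_num
      exact (h.mono_k le_rfl hK.le 0).trans hb
    | succ j ih =>
      set q := p j with hq
      have hq0 : 0 < q := hp0 j
      have hq1 : q ≤ 1 := hp1 j
      rw [hps j, ← hq]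
      have hkj : 0 < K * (2 - q) := mul_pos hK (by linarith)
      have hkj1 : 0 < K * (2 - q / 2) := mul_pos hK (by linarith)
      have hkk : K * (2 - q) < K * (2 - q / 2) := mul_lt_mul_of_pos_left (by linarith) hK
      have hdec := h.decay (k := K * (2 - q / 2)) (κ := π / (ρ * q)) (t1 := 1 - q) (t2 := 1 - q / 2) hkj1 (by positivity) (by linarith) (by linarith) (by linarith) ?_
      · refine hdec.trans ?_
        have h1 : En V (K * (2 - q / 2)) (1 - q) ≤ b * q ^ 5 := (h.mono_k hkj.le hkk.le _).trans ih
        have h2 : - (2 * d * (π / (ρ * q)) ^ 2) * (1 - q / 2 - (1 - q)) ≤ -5 := by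
          have : - (2 * d * (π / (ρ * q)) ^ 2) * (1 - q / 2 - (1 - q)) = - ((d * π ^ 2) / (ρ ^ 2 * q)) := by
            field_simp; ring
          rw [this, ← hρd]
          have : 5 ≤ 5 * ρ ^ 2 / (ρ ^ 2 * q) := by
            rw [le_div_iff₀ (by positivity)]
            nlinarith [mul_le_mul_of_nonneg_left hq1 (sq_nonneg ρ)]
          linarith
        calc _ ≤ (b * q ^ 5) * (1 / 32) :=
              mul_le_mul h1 ((exp_le_exp.2 h2).trans exp5) (exp_nonneg _) (by positivity)
          _ = _ := by ring
      · intro s hs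
        have h1 := h.cheb hkj.le hkk s
        have h2 := (h.mono_t hkj (t1 := 1 - q) (t2 := s) (by linarith) hs.1.le (by linarith [hs.2])).trans ih
        set v := (volume {x | K * (2 - q / 2) < V x s}).toReal with hv
        have hv0 : 0 ≤ v := ENNReal.toReal_nonneg
        have h3 : v * (K * q / 2) ^ 2 ≤ (K ^ 2 * ρ ^ 3) * q ^ 5 := by
          have e : K * (2 - q / 2) - K * (2 - q) = K * q / 2 := by ring
          rw [e] at h1
          exact (h1.trans h2).trans (mul_le_mul_of_nonneg_right hKb (by positivity))
        have h4 : v ≤ 4 * (ρ * q) ^ 3 := by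
          have e1 : v * (K * q / 2) ^ 2 = (K ^ 2 * q ^ 2 / 4) * v := by ring
          have e2 : (K ^ 2 * ρ ^ 3) * q ^ 5 = (K ^ 2 * q ^ 2 / 4) * (4 * (ρ * q) ^ 3) := by ring
          rw [e1, e2] at h3
          exact le_of_mul_le_mul_left h3 (by positivity)
        have h5 : rad v < ρ * q := by
          refine rad_lt hv0 (by positivity) (h4.trans_lt ?_)
          have : 0 < (ρ * q) ^ 3 := by positivity
          nlinarith [Real.pi_gt_three]
        rw [div_mul_eq_mul_div, div_lt_iff₀ (by positivity)]
        exact mul_lt_mul_of_pos_left h5 Real.pi_pos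
  have hpt : Tendsto p atTop (𝓝 0) := tendsto_pow_atTop_nhds_zero_of_lt_one (by norm_num) (by norm_num)
  have hE : En V (2 * K) 1 ≤ 0 := by
    have t1 : Tendsto (fun j => En V (2 * K) (1 - p j)) atTop (𝓝 (En V (2 * K) 1)) := by
      have h1 := ((h.en_cont (k := 2 * K) (by positivity)).tendsto 1)
      have h2 : Tendsto (fun j => 1 - p j) atTop (𝓝 1) := by simpa using hpt.const_sub 1
      exact h1.comp h2
    have t2 : Tendsto (fun j => b * p j ^ 5) atTop (𝓝 0) := by
      simpa using (hpt.pow 5).const_mul b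
    refine le_of_tendsto_of_tendsto' t1 t2 fun j => ?_
    refine le_trans (h.mono_k (mul_nonneg hK.le (by linarith [hp1 j])) ?_ _) (claim j)
    nlinarith [mul_pos hK (hp0 j)]
  have hE0 : ∫ y, max (V y 1 - 2 * K) 0 ^ 2 = 0 := le_antisymm hE (En_nonneg _ _ _)
  rw [integral_eq_zero_iff_of_nonneg (fun y => by positivity) (h.en_integ (by positivity) 1)] at hE0
  have hc : Continuous fun y => max (V y 1 - 2 * K) 0 ^ 2 := by have := h.ctx 1; fun_prop
  have := (hc.ae_eq_iff_eq volume continuous_const).1 hE0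
  have h2 : max (V x 1 - 2 * K) 0 ^ 2 = 0 := congrFun this x
  have h3 : max (V x 1 - 2 * K) 0 = 0 := pow_eq_zero_iff (two_ne_zero) |>.1 h2
  have h4 := le_max_left (V x 1 - 2 * K) 0
  linarith
end


section
variable {Ω : Set E3} {A : E3 → Matrix (Fin 3) (Fin 3) ℝ} {a : E3 → E3} {d : ℝ}

lemma pd_cmul (c : ℝ) (w : E3 → ℝ) (i : Fin 3) (x : E3) : pd (fun y => c * w y) i x = c * pd w i x := by
  have h : fderiv ℝ (fun y => c * w y) = c • fderiv ℝ w := fderiv_const_smul_field c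
  unfold pd
  rw [h]; simp

lemma Lop_cmul (c : ℝ) (w : E3 → ℝ) (x : E3) : Lop A a (fun y => c * w y) x = c * Lop A a w x := by
  have h1 : ∀ i, Fl A (fun y => c * w y) i = fun y => c * Fl A w i y := by
    intro i; ext y
    simp only [Fl, Finset.mul_sum, pd_cmul]
    refine Finset.sum_congr rfl fun j _ => by ring
  simp only [Lop, h1, pd_cmul, mul_sub, Finset.mul_sum]
  congr 1
  refine Finset.sum_congr rfl fun j _ => by ring

lemma Lop_congr {w v : E3 → ℝ} {x : E3} (h : w =ᶠ[𝓝 x] v) : Lop A a w x = Lop A a v x := by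
  have h1 : ∀ i, pd w i =ᶠ[𝓝 x] pd v i := fun i => by
    filter_upwards [h.fderiv (𝕜 := ℝ)] with y hy
    simp only [pd, hy]
  have h2 : ∀ i, Fl A w i =ᶠ[𝓝 x] Fl A v i := fun i => by
    filter_upwards [eventually_all.2 h1] with y hy
    simp only [Fl, hy]
  have h3 : ∀ i, pd (Fl A w i) i x = pd (Fl A v i) i x := fun i => by
    simp only [pd, (h2 i).fderiv_eq]
  simp only [Lop, h3, fun i => (h1 i).self_of_nhds]

def clp (t : ℝ) : ℝ := max 0 (min t 1)

lemma clp_mem (t : ℝ) : clp t ∈ Set.Icc (0:ℝ) 1 := ⟨le_max_left _ _, max_le zero_le_one (min_le_right _ _)⟩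
lemma clp_eq {t : ℝ} (ht : t ∈ Set.Icc (0:ℝ) 1) : clp t = t := by
  rw [clp, min_eq_left ht.2, max_eq_right ht.1]
lemma clp_cont : Continuous clp := by unfold clp; fun_prop

open Classical in
/-- rescaled zero extension -/
def VV (Ω : Set E3) (u : E3 → ℝ → ℝ) (c : ℝ) (x : E3) (t : ℝ) : ℝ :=
  if x ∈ Ω then exp (-c * clp t) * u x (clp t) else 0

lemma VV_in {u : E3 → ℝ → ℝ} {c : ℝ} {x : E3} (hx : x ∈ Ω) {t : ℝ} (ht : t ∈ Set.Icc (0:ℝ) 1) :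
    VV Ω u c x t = exp (-c * t) * u x t := by
  rw [VV, if_pos hx, clp_eq ht]

lemma VV_out {u : E3 → ℝ → ℝ} {c : ℝ} {x : E3} (hx : x ∉ Ω) (t : ℝ) : VV Ω u c x t = 0 := by
  rw [VV, if_neg hx]

open Classical in
lemma VV_cont {u : E3 → ℝ → ℝ} (c : ℝ)
    (hu : ContinuousOn (fun p : E3 × ℝ => u p.1 p.2) (closure Ω ×ˢ Set.Icc (0:ℝ) 1))
    (h0 : ∀ x ∈ frontier Ω, ∀ t ∈ Set.Ioc (0:ℝ) 1, u x t = 0) :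
    Continuous fun p : E3 × ℝ => VV Ω u c p.1 p.2 := by
  have hF : ∀ x ∈ frontier Ω, ∀ t ∈ Set.Icc (0:ℝ) 1, u x t = 0 := by
    intro x hx t ht
    rcases ht.1.eq_or_lt with rfl | h1
    · have h2 : ContinuousOn (fun s => u x s) (Set.Icc (0:ℝ) 1) :=
        hu.comp (f := fun s : ℝ => (x, s)) (by fun_prop) fun s hs => ⟨frontier_subset_closure hx, hs⟩
      have h3 : Tendsto (fun s => u x s) (𝓝[>] 0) (𝓝 (u x 0)) := by
        refine (h2 0 ht).mono_left ?_
        rw [← nhdsWithin_Ioc_eq_nhdsGT (show (0:ℝ) < 1 by norm_num)]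
        exact nhdsWithin_mono _ Set.Ioc_subset_Icc_self
      have h4 : Tendsto (fun s => u x s) (𝓝[>] 0) (𝓝 0) := by
        refine tendsto_const_nhds.congr' ?_
        filter_upwards [Ioc_mem_nhdsGT (show (0:ℝ) < 1 by norm_num)] with s hs
        exact (h0 x hx s hs).symm
      exact tendsto_nhds_unique h3 h4
    · exact h0 x hx t ⟨h1, ht.2⟩
  have e : {p : E3 × ℝ | p.1 ∈ Ω} = Ω ×ˢ Set.univ := by ext p; simp
  unfold VV
  refine continuous_if (p := fun p : E3 × ℝ => p.1 ∈ Ω) ?_ ?_ continuousOn_const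
  · rintro ⟨x, t⟩ hp
    rw [e, frontier_prod_univ_eq] at hp
    dsimp only
    rw [hF x hp.1 _ (clp_mem t), mul_zero]
  · rw [e, closure_prod_eq, closure_univ]
    refine ContinuousOn.mul ?_ ?_
    · have := clp_cont; exact Continuous.continuousOn (by fun_prop)
    · have := clp_cont
      exact hu.comp (f := fun p : E3 × ℝ => (p.1, clp p.2)) (by fun_prop) fun p hp => ⟨hp.1, clp_mem _⟩

lemma VV_sub (hC : Coef Ω A a d) {f g : ℝ → ℝ} {c : ℝ} (hf : ∀ N, 0 ≤ N → f N ≤ c * N) (sol : ImpSolA 3 Ω A a f g) (m : ℕ) :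
    SubSol Ω A a d (VV Ω (sol.u m) c) := by
  refine ⟨hC, VV_cont c (sol.u_cont m) (sol.bdry m), fun x t hx => VV_out hx t, ?_, ?_, ?_⟩
  · intro x t
    by_cases hx : x ∈ Ω
    · rw [VV, if_pos hx]
      exact mul_nonneg (exp_nonneg _) (sol.u_nonneg m x (subset_closure hx) _ (clp_mem t))
    · rw [VV_out hx]
  · intro t ht x hx
    have h1 : (fun y => VV Ω (sol.u m) c y t) =ᶠ[𝓝 x] fun y => exp (-c * t) * sol.u m y t := by
      filter_upwards [hC.op.mem_nhds hx] with y hy using VV_in hy ⟨ht.1.le, ht.2.le⟩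
    exact (contDiffAt_const.mul (sol.u_space_C2 m t ⟨ht.1, ht.2.le⟩ x hx)).congr_of_eventuallyEq h1
  · intro x hx t ht
    have ht' : t ∈ Set.Ioc (0:ℝ) 1 := ⟨ht.1, ht.2.le⟩
    have h1 : (fun y => VV Ω (sol.u m) c y t) =ᶠ[𝓝 x] fun y => exp (-c * t) * sol.u m y t := by
      filter_upwards [hC.op.mem_nhds hx] with y hy using VV_in hy ⟨ht.1.le, ht.2.le⟩
    have h2 : VV Ω (sol.u m) c x =ᶠ[𝓝 t] fun s => exp (-c * s) * sol.u m x s := by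
      filter_upwards [Ioo_mem_nhds ht.1 ht.2] with s hs using VV_in hx ⟨hs.1.le, hs.2.le⟩
    have h3 : HasDerivAt (fun s => sol.u m x s) (deriv (fun s => sol.u m x s) t) t :=
      ((sol.u_time_C1 m x hx t ht').differentiableAt (by norm_num)).hasDerivAt
    have h4 : HasDerivAt (fun s => exp (-c * s)) (exp (-c * t) * (-c * 1)) t :=
      ((hasDerivAt_id t).const_mul (-c)).exp
    refine ⟨_, (h4.mul h3).congr_of_eventuallyEq h2, ?_⟩
    rw [Lop_congr h1, Lop_cmul, sol.pde m x hx t ht']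
    have h5 : (∑ i, pd (fun y => ∑ j, A y i j * pd (fun z => sol.u m z t) j y) i x)
        - (∑ i, a x i * pd (fun y => sol.u m y t) i x) = Lop A a (fun y => sol.u m y t) x := rfl
    rw [h5]
    have h6 := hf (sol.u m x t) (sol.u_nonneg m x (subset_closure hx) t ⟨ht.1.le, ht.2.le⟩)
    have h7 := mul_le_mul_of_nonneg_left h6 (exp_nonneg (-c * t))
    linarith
end

lemma vex_eq {d l : ℝ} (hd : 0 < d) (hl : 0 < l) :
    4 * π ^ 4 * d / 3 * √(d / l ^ 3) = 4 * π / 3 * (π * √(d / l)) ^ 3 := by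
  have h1 : d / l ^ 3 = (d / l) / l ^ 2 := by field_simp
  rw [h1, Real.sqrt_div (by positivity), Real.sqrt_sq hl.le]
  have h2 : √(d / l) ^ 2 = d / l := Real.sq_sqrt (by positivity)
  have h3 : (π * √(d / l)) ^ 3 = π ^ 3 * (√(d / l) ^ 2 * √(d / l)) := by ring
  rw [h3, h2]
  ring

/-- Extinction for the general diffusion operator `div (A ∇u)` with divergence free drift
on a bounded domain in `ℝ³` with `C²` boundary whose volume is below the extreme volume
size `V_ex = (4π⁴d/3)·√(d/(f'(0) + ln g'(0))³)`. -/
theorem extreme_volume_extinction_matrix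
    (Ω : Set (EuclideanSpace ℝ (Fin 3)))
    (hopen : IsOpen Ω) (hne : Ω.Nonempty) (hbdd : Bornology.IsBounded Ω)
    (hbd : HasCkBoundary 2 Ω)
    (A : EuclideanSpace ℝ (Fin 3) → Matrix (Fin 3) (Fin 3) ℝ)
    (hAC1 : ∀ i j, ContDiffOn ℝ 1 (fun y => A y i j) (closure Ω))
    (hAsymm : ∀ x ∈ closure Ω, (A x).IsSymm)
    (d : ℝ) (hd : 0 < d)
    (hell : ∀ x ∈ closure Ω, ∀ ζ : EuclideanSpace ℝ (Fin 3),
      d * ‖ζ‖ ^ 2 ≤ ∑ i, ∑ j, A x i j * ζ j * ζ i)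
    (a : EuclideanSpace ℝ (Fin 3) → EuclideanSpace ℝ (Fin 3))
    (ha : ContDiffOn ℝ 1 a (closure Ω))
    (hdiv : ∀ x ∈ Ω, (∑ i, pd (fun y => a y i) i x) = 0)
    (f g : ℝ → ℝ) (f'0 g'0 : ℝ) (hf : SatF f f'0) (hg : SatGext g g'0)
    (hpos : 0 < f'0 + Real.log g'0)
    (hvol : volume Ω < ENNReal.ofReal
      (4 * Real.pi ^ 4 * d / 3 * Real.sqrt (d / (f'0 + Real.log g'0) ^ 3)))
    (sol : ImpSolA 3 Ω A a f g) :
    ∀ x ∈ Ω, Tendsto (fun m => sol.N m x) atTop (𝓝 0) := by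
  have hnb : ∀ x ∈ Ω, closure Ω ∈ 𝓝 x := fun x hx => mem_of_superset (hopen.mem_nhds hx) subset_closure
  have hC : Coef Ω A a d := by
    refine ⟨hopen, hbdd, fun i j x hx => (hAC1 i j).contDiffAt (hnb x hx), fun x hx => hAsymm x (subset_closure hx), hd,
      fun x hx => hell x (subset_closure hx), fun i x hx => ?_, hdiv⟩
    exact contDiffAt_euclidean.1 (ha.contDiffAt (hnb x hx)) i
  obtain ⟨-, -, -, -, hF, -, -, -, hfb⟩ := hf
  obtain ⟨-, hg0, -, -, hgp, hgb⟩ := hg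
  have hgb' : ∀ N, 0 ≤ N → g N ≤ g'0 * N := by
    intro N hN
    rcases hN.eq_or_lt with rfl | h
    · simp [hg0]
    · exact hgb N h
  set l := f'0 + Real.log g'0 with hl
  set V : ℕ → E3 → ℝ → ℝ := fun m => VV Ω (sol.u m) f'0 with hV
  have hS : ∀ m, SubSol Ω A a d (V m) := fun m => VV_sub hC (fun N hN => (hfb N hN).2) sol m
  have hVin : ∀ m, ∀ x ∈ Ω, ∀ t ∈ Set.Icc (0:ℝ) 1, V m x t = exp (-f'0 * t) * sol.u m x t := fun m x hx t ht => VV_in hx ht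
  have hN1 : ∀ m, ∀ x ∈ Ω, sol.N (m + 1) x = exp f'0 * V m x 1 := by
    intro m x hx
    rw [sol.recur m x (subset_closure hx), hVin m x hx 1 ⟨zero_le_one, le_rfl⟩, ← mul_assoc, ← exp_add]
    simp
  -- choice of κ
  have hrad : rad ((volume Ω).toReal) < π * √(d / l) := by
    refine rad_lt ENNReal.toReal_nonneg (by positivity) ?_
    rw [← vex_eq hd hpos]
    have h1 := (ENNReal.toReal_lt_toReal hvol.ne_top ENNReal.ofReal_ne_top).2 hvol
    rwa [ENNReal.toReal_ofReal (by positivity)] at h1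
  have hκ0 : 0 < √(l / d) := Real.sqrt_pos.2 (by positivity)
  obtain ⟨κ, hκ1, hκ2⟩ : ∃ κ, √(l / d) < κ ∧ κ * rad ((volume Ω).toReal) < π := by
    have h1 : √(l / d) * rad ((volume Ω).toReal) < π := by
      refine (mul_lt_mul_of_pos_left hrad hκ0).trans_eq ?_
      have : √(l / d) * √(d / l) = 1 := by
        rw [← Real.sqrt_mul (by positivity)]
        have : l / d * (d / l) = 1 := by field_simp
        rw [this, Real.sqrt_one]
      calc _ = π * (√(l / d) * √(d / l)) := by ring
        _ = π := by rw [this, mul_one]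
    have h2 : Continuous fun κ : ℝ => κ * rad ((volume Ω).toReal) := by fun_prop
    have h3 : ∀ᶠ κ in 𝓝[>] √(l / d), κ * rad ((volume Ω).toReal) < π :=
      nhdsWithin_le_nhds ((h2.tendsto _).eventually (gt_mem_nhds h1))
    obtain ⟨κ, hk1, hk2⟩ := (h3.and self_mem_nhdsWithin).exists
    exact ⟨κ, hk2, hk1⟩
  have hκ : 0 < κ := hκ0.trans hκ1
  have hκl : l < d * κ ^ 2 := by
    have h1 := (Real.sqrt_lt' hκ).1 hκ1
    rw [div_lt_iff₀ hd] at h1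
    linarith
  set θ := exp (2 * (l - d * κ ^ 2)) with hθ
  have hθ0 : 0 < θ := exp_pos _
  have hθ1 : θ < 1 := by rw [hθ, exp_lt_one_iff]; linarith
  have hstep : ∀ m, En (V (m + 1)) 0 0 ≤ θ * En (V m) 0 0 := by
    intro m
    have h1 := (hS m).decay0 hκ hκ2
    have h2 : En (V (m + 1)) 0 0 ≤ (g'0 * exp f'0) ^ 2 * En (V m) 0 1 := by
      unfold En
      rw [← integral_const_mul]
      refine integral_mono ((hS (m + 1)).en_integ le_rfl 0) (((hS m).en_integ le_rfl 1).const_mul _) fun x => ?_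
      dsimp only
      rw [sub_zero, sub_zero, max_eq_left ((hS _).nn x _), max_eq_left ((hS _).nn x _), ← mul_pow]
      refine pow_le_pow_left₀ ((hS _).nn x _) ?_ 2
      by_cases hx : x ∈ Ω
      · rw [hVin (m + 1) x hx 0 ⟨le_rfl, zero_le_one⟩, sol.init (m + 1) x hx]
        simp only [mul_zero, exp_zero, one_mul]
        refine (hgb' _ (sol.N_nonneg _ x (subset_closure hx))).trans_eq ?_
        rw [hN1 m x hx]; ring
      · rw [(hS _).zo x _ hx, (hS _).zo x _ hx, mul_zero]
    have h3 : θ = (g'0 * exp f'0) ^ 2 * exp (- (2 * d * κ ^ 2)) := by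
      have : g'0 * exp f'0 = exp l := by rw [hl, exp_add, exp_log hgp]; ring
      rw [this, ← exp_nat_mul, ← exp_add, hθ]
      congr 1
      push_cast; ring
    calc _ ≤ _ := h2
      _ ≤ (g'0 * exp f'0) ^ 2 * (En (V m) 0 0 * exp (- (2 * d * κ ^ 2))) := mul_le_mul_of_nonneg_left h1 (by positivity)
      _ = _ := by rw [h3]; ring
  set e0 := En (V 0) 0 0 + 1 with he0
  have he0p : 0 < e0 := by have := En_nonneg (V 0) 0 0; linarith
  have hen : ∀ m, En (V m) 0 0 ≤ θ ^ m * e0 := by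
    intro m
    induction m with
    | zero => simp [he0]
    | succ m ih =>
      refine (hstep m).trans ?_
      rw [pow_succ', mul_assoc]
      exact mul_le_mul_of_nonneg_left ih hθ0.le
  set ρ := √(d * π ^ 2 / 5) with hρ
  have hρ0 : 0 < ρ := Real.sqrt_pos.2 (by positivity)
  have hρd : 5 * ρ ^ 2 = d * π ^ 2 := by
    rw [hρ, Real.sq_sqrt (by positivity)]; ring
  intro x hx
  have hub : ∀ m, sol.N (m + 1) x ≤ exp f'0 * (2 * √(θ ^ m * e0 / ρ ^ 3)) := by
    intro m
    rw [hN1 m x hx]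
    refine mul_le_mul_of_nonneg_left ?_ (exp_nonneg _)
    have hb0 : 0 < θ ^ m * e0 := by positivity
    refine (hS m).sup_bound hρ0 hρd (hen m) hb0 (Real.sqrt_pos.2 (by positivity)) ?_ x
    rw [Real.sq_sqrt (by positivity)]
    exact le_of_eq (by field_simp)
  have ht : Tendsto (fun m : ℕ => exp f'0 * (2 * √(θ ^ m * e0 / ρ ^ 3))) atTop (𝓝 0) := by
    have h1 : Continuous fun s : ℝ => exp f'0 * (2 * √(s * e0 / ρ ^ 3)) := by fun_prop
    have h2 := (h1.tendsto 0).comp (tendsto_pow_atTop_nhds_zero_of_lt_one hθ0.le hθ1)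
    simp only [zero_mul, zero_div, Real.sqrt_zero, mul_zero] at h2
    exact h2
  refine (tendsto_add_atTop_iff_nat 1).1 ?_
  exact squeeze_zero (fun m => sol.N_nonneg _ x (subset_closure hx)) hub ht
end
end

section
/- Let n ≥ 1, d > 0, a ∈ ℝⁿ a constant vector, L₁,…,Lₙ > 0, and Ω = (0,L₁) × ⋯ × (0,Lₙ). Assume f satisfies (F) and g satisfies (G-ext). If either (i) 4d·[f'(0) + ln(g'(0))] < |a|², or (ii) 4d·[f'(0) + ln(g'(0))] > |a|² and ∏_{i=1}^n Lᵢ < (4d²π²n/(4d·[f'(0) + ln(g'(0))] − |a|²))^{n/2}, then every solution of the impulsive reaction–diffusion system on Ω satisfies lim_{m→∞} N_m(x) = 0 for every x ∈ Ω. -/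
open Real Filter MeasureTheory
open scoped Topology ENNReal

noncomputable section

/-- A solution of the impulsive reaction-diffusion system
`∂ₜ u⁽ᵐ⁾ = d Δu⁽ᵐ⁾ - a ⬝ ∇u⁽ᵐ⁾ + f (u⁽ᵐ⁾)` on `Ω × (0,1]` with hostile (Dirichlet) boundary
conditions, initial data `u⁽ᵐ⁾(·,0) = g (N_m ·)` and update rule `N_{m+1} = u⁽ᵐ⁾(·,1)`. -/
structure ImpSol (n : ℕ) (Ω : Set (EuclideanSpace ℝ (Fin n))) (d : ℝ)
    (a : EuclideanSpace ℝ (Fin n) → EuclideanSpace ℝ (Fin n)) (f g : ℝ → ℝ) where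
  N : ℕ → EuclideanSpace ℝ (Fin n) → ℝ
  u : ℕ → EuclideanSpace ℝ (Fin n) → ℝ → ℝ
  N_cont : ∀ m, ContinuousOn (N m) (closure Ω)
  N_nonneg : ∀ m, ∀ x ∈ closure Ω, 0 ≤ N m x
  N0_bdry : ∀ x ∈ frontier Ω, N 0 x = 0
  u_nonneg : ∀ m, ∀ x ∈ closure Ω, ∀ t ∈ Set.Icc (0:ℝ) 1, 0 ≤ u m x t
  u_cont : ∀ m, ContinuousOn (fun p : EuclideanSpace ℝ (Fin n) × ℝ => u m p.1 p.2)
    (closure Ω ×ˢ Set.Icc (0:ℝ) 1)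
  u_space_C2 : ∀ m, ∀ t ∈ Set.Ioc (0:ℝ) 1, ∀ x ∈ Ω, ContDiffAt ℝ 2 (fun y => u m y t) x
  u_time_C1 : ∀ m, ∀ x ∈ Ω, ∀ t ∈ Set.Ioc (0:ℝ) 1, ContDiffAt ℝ 1 (fun s => u m x s) t
  pde : ∀ m, ∀ x ∈ Ω, ∀ t ∈ Set.Ioc (0:ℝ) 1,
    deriv (fun s => u m x s) t =
      d * lap (fun y => u m y t) x - (∑ i, a x i * pd (fun y => u m y t) i x) + f (u m x t)
  bdry : ∀ m, ∀ x ∈ frontier Ω, ∀ t ∈ Set.Ioc (0:ℝ) 1, u m x t = 0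
  init : ∀ m, ∀ x ∈ Ω, u m x 0 = g (N m x)
  recur : ∀ m, ∀ x ∈ closure Ω, N (m + 1) x = u m x 1

lemma aux_second {p q : ℝ → ℝ} {q1 : ℝ → ℝ} {q2 : ℝ}
    (hp : ContDiffAt ℝ 2 p 0) (hq : ∀ s, HasDerivAt q (q1 s) s) (hq1 : HasDerivAt q1 q2 0)
    (hle : ∀ᶠ s in 𝓝 (0:ℝ), p s ≤ q s) (heq : p 0 = q 0) :
    deriv p 0 = q1 0 ∧ deriv (deriv p) 0 ≤ q2 := by
  have hpd : ∀ᶠ s in 𝓝 (0:ℝ), DifferentiableAt ℝ p s := by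
    filter_upwards [hp.eventually (by simp)] with s hs
    exact hs.differentiableAt (by norm_num)
  have hp2 : DifferentiableAt ℝ (deriv p) 0 := by
    have h1 : ContDiffAt ℝ 1 (fderiv ℝ p) 0 := hp.fderiv_right (by norm_num)
    have h2 : DifferentiableAt ℝ (fderiv ℝ p) 0 := h1.differentiableAt (by norm_num)
    have : deriv p = fun s => fderiv ℝ p s 1 := by ext s; simp
    rw [this]
    exact h2.clm_apply (differentiableAt_const _)
  set w : ℝ → ℝ := fun s => q s - p s with hw
  have hmin : IsLocalMin w 0 := by
    filter_upwards [hle] with s hs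
    simp only [hw]; linarith
  have hwd : deriv w =ᶠ[𝓝 0] fun s => q1 s - deriv p s := by
    filter_upwards [hpd] with s hs
    exact ((hq s).sub hs.hasDerivAt).deriv
  have h0 : deriv w 0 = 0 := hmin.deriv_eq_zero
  have h0' := hwd.eq_of_nhds
  have hdd : deriv (deriv w) 0 = q2 - deriv (deriv p) 0 := by
    rw [hwd.deriv_eq]
    exact (hq1.sub hp2.hasDerivAt).deriv
  refine ⟨by rw [h0] at h0'; linarith, ?_⟩
  by_contra hcon
  push Not at hcon
  have hneg : deriv (deriv w) 0 < 0 := by rw [hdd]; linarith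
  have hwc : ContinuousAt w 0 := ((hq 0).sub hpd.self_of_nhds.hasDerivAt).continuousAt
  have hmax : IsLocalMax w 0 := isLocalMax_of_deriv_deriv_neg hneg h0 hwc
  have hconst : w =ᶠ[𝓝 0] fun _ => w 0 := by
    filter_upwards [hmin, hmax] with s h1 h2
    exact le_antisymm h2 h1
  have h3 : deriv w =ᶠ[𝓝 0] fun _ => (0:ℝ) := by
    have := hconst.deriv
    simpa using this
  have := h3.deriv_eq
  simp at this
  linarith

lemma aux_line {n : ℕ} {v : EuclideanSpace ℝ (Fin n) → ℝ} {x : EuclideanSpace ℝ (Fin n)}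
    (hv : ContDiffAt ℝ 2 v x) (i : Fin n) :
    ContDiffAt ℝ 2 (fun s : ℝ => v (x + s • EuclideanSpace.single i (1:ℝ))) 0 ∧
    pd v i x = deriv (fun s : ℝ => v (x + s • EuclideanSpace.single i (1:ℝ))) 0 ∧
    pd2 v i i x = deriv (deriv (fun s : ℝ => v (x + s • EuclideanSpace.single i (1:ℝ)))) 0 := by
  set e : EuclideanSpace ℝ (Fin n) := EuclideanSpace.single i (1:ℝ) with he
  have hl : ∀ s : ℝ, HasDerivAt (fun s : ℝ => x + s • e) e s := by
    intro s
    simpa using ((hasDerivAt_id s).smul_const e).const_add x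
  have hlc : ContDiff ℝ 2 (fun s : ℝ => x + s • e) := by fun_prop
  have hx0 : x + (0:ℝ) • e = x := by simp
  have hc : ContDiffAt ℝ 2 (fun s : ℝ => v (x + s • e)) 0 := by
    apply ContDiffAt.comp (0:ℝ) (g := v) (f := fun s : ℝ => x + s • e)
    · simpa using hv
    · exact hlc.contDiffAt
  have hev : ∀ᶠ y in 𝓝 x, DifferentiableAt ℝ v y := by
    filter_upwards [hv.eventually (by simp)] with s hs
    exact hs.differentiableAt (by norm_num)
  have ht : Tendsto (fun s : ℝ => x + s • e) (𝓝 0) (𝓝 x) := by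
    have := hlc.continuous.tendsto 0
    simpa using this
  have hd1 : deriv (fun s : ℝ => v (x + s • e)) =ᶠ[𝓝 0] fun s => pd v i (x + s • e) := by
    filter_upwards [ht.eventually hev] with s hs
    exact (hs.hasFDerivAt.comp_hasDerivAt s (hl s)).deriv
  have hpdd : DifferentiableAt ℝ (fun y => pd v i y) x := by
    have h1 : ContDiffAt ℝ 1 (fderiv ℝ v) x := hv.fderiv_right (by norm_num)
    exact (h1.differentiableAt (by norm_num)).clm_apply (differentiableAt_const _)
  refine ⟨hc, ?_, ?_⟩
  · rw [hd1.eq_of_nhds, hx0]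
  · rw [hd1.deriv_eq]
    have h1 : HasFDerivAt (fun y => pd v i y) (fderiv ℝ (fun y => pd v i y) x)
        (x + (0:ℝ) • e) := by rw [hx0]; exact hpdd.hasFDerivAt
    exact (h1.comp_hasDerivAt (0:ℝ) (hl 0)).deriv.symm

/-- the positive supersolution -/
def phi {n : ℕ} (α β γ : Fin n → ℝ) (x : EuclideanSpace ℝ (Fin n)) : ℝ :=
  ∏ i, (Real.exp (α i * x i) * Real.sin (β i * x i + γ i))

lemma phi_cont {n : ℕ} (α β γ : Fin n → ℝ) : Continuous (phi α β γ) := by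
  unfold phi; fun_prop

lemma phi_line {n : ℕ} (α β γ : Fin n → ℝ) (x : EuclideanSpace ℝ (Fin n)) (i : Fin n) :
    ∃ B : ℝ, ∀ s : ℝ, phi α β γ (x + s • EuclideanSpace.single i (1:ℝ)) =
      B * (Real.exp (α i * (x i + s)) * Real.sin (β i * (x i + s) + γ i)) := by
  refine ⟨∏ j ∈ Finset.univ.erase i, (Real.exp (α j * x j) * Real.sin (β j * x j + γ j)), ?_⟩
  intro s
  unfold phi
  rw [← Finset.mul_prod_erase Finset.univ _ (Finset.mem_univ i), mul_comm]
  congr 1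
  · apply Finset.prod_congr rfl
    intro j hj
    have : j ≠ i := Finset.ne_of_mem_erase hj
    simp [this]
  · simp

lemma aux_ineq {n : ℕ} (d : ℝ) (hd : 0 < d) (α β γ : Fin n → ℝ)
    {v : EuclideanSpace ℝ (Fin n) → ℝ} {x : EuclideanSpace ℝ (Fin n)}
    (hv : ContDiffAt ℝ 2 v x) (c : ℝ)
    (hle : ∀ᶠ y in 𝓝 x, v y ≤ c * phi α β γ y) (heq : v x = c * phi α β γ x) :
    d * lap v x - (∑ i, 2 * d * α i * pd v i x) ≤ - (∑ i, d * (α i ^ 2 + β i ^ 2)) * v x := by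
  unfold lap
  rw [Finset.mul_sum, ← Finset.sum_sub_distrib, ← Finset.sum_neg_distrib, Finset.sum_mul]
  apply Finset.sum_le_sum
  intro i _
  obtain ⟨h1, h2, h3⟩ := aux_line hv i
  obtain ⟨B, hB⟩ := phi_line α β γ x i
  have hlc : Continuous (fun s : ℝ => x + s • EuclideanSpace.single i (1:ℝ)) := by fun_prop
  have ht : Tendsto (fun s : ℝ => x + s • EuclideanSpace.single i (1:ℝ)) (𝓝 0) (𝓝 x) := by
    have := hlc.tendsto 0
    simpa using this
  have hE : ∀ s : ℝ, HasDerivAt (fun s => Real.exp (α i * (x i + s)))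
      (Real.exp (α i * (x i + s)) * α i) s := by
    intro s
    have : HasDerivAt (fun s => α i * (x i + s)) (α i) s := by
      simpa using ((hasDerivAt_id s).const_add (x i)).const_mul (α i)
    exact this.exp
  have hT : ∀ s : ℝ, HasDerivAt (fun s => β i * (x i + s) + γ i) (β i) s := by
    intro s
    simpa using (((hasDerivAt_id s).const_add (x i)).const_mul (β i)).add_const (γ i)
  have hS := fun s => (hT s).sin
  have hC := fun s => (hT s).cos
  have hq : ∀ s, HasDerivAt (fun s => c * (B * (Real.exp (α i * (x i + s)) *
      Real.sin (β i * (x i + s) + γ i)))) _ s :=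
    fun s => (((hE s).mul (hS s)).const_mul B).const_mul c
  have hq1 := ((((((hE 0).mul_const (α i)).mul (hS 0)).add
    ((hE 0).mul ((hC 0).mul_const (β i)))).const_mul B).const_mul c)
  have h0 : v x = c * (B * (Real.exp (α i * (x i + 0)) *
      Real.sin (β i * (x i + 0) + γ i))) := by rw [← hB 0]; simpa using heq
  have key := aux_second h1 hq hq1 (by
    filter_upwards [ht.eventually hle] with s hs
    rwa [hB] at hs) (by simpa using h0)
  obtain ⟨k1, k2⟩ := key
  rw [← h2] at k1
  rw [← h3] at k2
  rw [k1, h0]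
  have := mul_le_mul_of_nonneg_left k2 hd.le
  refine (sub_le_sub_right this _).trans (le_of_eq ?_)
  ring

lemma aux_compare {n : ℕ} (Ω : Set (EuclideanSpace ℝ (Fin n))) (hΩo : IsOpen Ω)
    (hΩc : IsCompact (closure Ω)) (d : ℝ) (hd : 0 < d) (α β γ : Fin n → ℝ)
    (hφ : ∀ x ∈ closure Ω, 0 < phi α β γ x) (f : ℝ → ℝ) (f'0 : ℝ)
    (hf : ∀ N, 0 ≤ N → f N ≤ f'0 * N)
    (u : EuclideanSpace ℝ (Fin n) → ℝ → ℝ)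
    (hu0 : ∀ x ∈ closure Ω, ∀ t ∈ Set.Icc (0:ℝ) 1, 0 ≤ u x t)
    (huc : ContinuousOn (fun p : EuclideanSpace ℝ (Fin n) × ℝ => u p.1 p.2)
      (closure Ω ×ˢ Set.Icc (0:ℝ) 1))
    (hu2 : ∀ t ∈ Set.Ioc (0:ℝ) 1, ∀ x ∈ Ω, ContDiffAt ℝ 2 (fun y => u y t) x)
    (hu1 : ∀ x ∈ Ω, ∀ t ∈ Set.Ioc (0:ℝ) 1, ContDiffAt ℝ 1 (fun s => u x s) t)
    (pde : ∀ x ∈ Ω, ∀ t ∈ Set.Ioc (0:ℝ) 1, deriv (fun s => u x s) t =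
      d * lap (fun y => u y t) x - (∑ i, 2 * d * α i * pd (fun y => u y t) i x) + f (u x t))
    (bdry : ∀ x ∈ frontier Ω, ∀ t ∈ Set.Ioc (0:ℝ) 1, u x t = 0)
    (K : ℝ) (hK : 0 ≤ K) (hinit : ∀ x ∈ Ω, u x 0 ≤ K * phi α β γ x) :
    ∀ x ∈ closure Ω, u x 1 ≤
      K * Real.exp (f'0 - ∑ i, d * (α i ^ 2 + β i ^ 2)) * phi α β γ x := by
  set Λ := ∑ i, d * (α i ^ 2 + β i ^ 2) with hΛ
  set σ := f'0 - Λ with hσ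
  have hinit' : ∀ x ∈ closure Ω, u x 0 ≤ K * phi α β γ x := by
    intro x hx
    have hc0 : ContinuousOn (fun x => u x 0) (closure Ω) := by
      refine huc.comp (f := fun x => (x, (0:ℝ))) (by fun_prop) ?_
      intro y hy
      exact ⟨hy, by simp⟩
    exact ContinuousWithinAt.closure_le hx ((hc0 x hx).mono subset_closure)
      ((phi_cont α β γ).const_mul K |>.continuousWithinAt) hinit
  intro x hx
  have main : ∀ ε : ℝ, 0 < ε → u x 1 * Real.exp (-σ) / phi α β γ x - ε ≤ K := by
    intro ε hε
    set W : EuclideanSpace ℝ (Fin n) × ℝ → ℝ := fun p =>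
      u p.1 p.2 * Real.exp (-σ * p.2) / phi α β γ p.1 - ε * p.2 with hW
    have hWc : ContinuousOn W (closure Ω ×ˢ Set.Icc (0:ℝ) 1) := by
      refine ContinuousOn.sub (ContinuousOn.div (huc.mul (by fun_prop)) ?_ ?_) (by fun_prop)
      · exact ((phi_cont α β γ).comp continuous_fst).continuousOn
      · rintro ⟨y, t⟩ ⟨hy, -⟩
        exact (hφ y hy).ne'
    obtain ⟨⟨y, t⟩, ⟨hy, ht⟩, hmax⟩ := (hΩc.prod isCompact_Icc).exists_isMaxOn
      ⟨(x, 1), hx, by simp⟩ hWc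
    simp only at hy ht
    have hxW : W (x, 1) ≤ W (y, t) := hmax ⟨hx, by simp⟩
    have hgoal : W (x, 1) = u x 1 * Real.exp (-σ) / phi α β γ x - ε := by simp [hW]
    rw [← hgoal]
    refine hxW.trans ?_
    rcases eq_or_lt_of_le ht.1 with h0 | hpos
    · subst h0
      simp only [hW, mul_zero, Real.exp_zero, mul_one, sub_zero]
      rw [div_le_iff₀ (hφ y hy)]
      exact hinit' y hy
    have htI : t ∈ Set.Ioc (0:ℝ) 1 := ⟨hpos, ht.2⟩
    by_cases hyΩ : y ∈ Ω
    swap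
    · have hfr : y ∈ frontier Ω := by
        rw [hΩo.frontier_eq]; exact ⟨hy, hyΩ⟩
      have : W (y, t) = - (ε * t) := by simp [hW, bdry y hfr t htI]
      rw [this]
      have := mul_pos hε hpos
      linarith
    exfalso
    have hφy := hφ y hy
    have hu_y := hu0 y hy t ht
    -- space
    set c := u y t / phi α β γ y with hc
    have hineq := aux_ineq d hd α β γ (hu2 t htI y hyΩ) c (by
      filter_upwards [hΩo.mem_nhds hyΩ] with z hz
      have h1 : W (z, t) ≤ W (y, t) := hmax ⟨subset_closure hz, ht⟩
      have hφz := hφ z (subset_closure hz)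
      simp only [hW] at h1
      have h2 : (u z t / phi α β γ z) * Real.exp (-σ * t) ≤
          (u y t / phi α β γ y) * Real.exp (-σ * t) := by
        rw [div_mul_eq_mul_div, div_mul_eq_mul_div]; linarith
      have h3 := le_of_mul_le_mul_right h2 (Real.exp_pos _)
      rwa [div_le_iff₀ hφz] at h3) (by rw [hc]; field_simp)
    have hpde := pde y hyΩ t htI
    have hfu := hf _ hu_y
    have hut : deriv (fun s => u y s) t ≤ σ * u y t := by
      rw [hpde, hσ]
      linarith
    -- time
    have hdu : HasDerivAt (fun s => u y s) (deriv (fun s => u y s) t) t :=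
      ((hu1 y hyΩ t htI).differentiableAt (by norm_num)).hasDerivAt
    have hde : HasDerivAt (fun s : ℝ => Real.exp (-σ * s)) (Real.exp (-σ * t) * (-σ)) t := by
      have : HasDerivAt (fun s : ℝ => -σ * s) (-σ) t := by
        simpa using (hasDerivAt_id t).const_mul (-σ)
      exact this.exp
    have hdl : HasDerivAt (fun s : ℝ => ε * s) ε t := by
      simpa using (hasDerivAt_id t).const_mul ε
    have hdW := ((hdu.mul hde).div_const (phi α β γ y)).sub hdl
    have hneg : (deriv (fun s => u y s) t * Real.exp (-σ * t) +
        u y t * (Real.exp (-σ * t) * (-σ))) / phi α β γ y - ε < 0 := by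
      have : (deriv (fun s => u y s) t * Real.exp (-σ * t) +
        u y t * (Real.exp (-σ * t) * (-σ))) / phi α β γ y ≤ 0 := by
        apply div_nonpos_of_nonpos_of_nonneg _ hφy.le
        have := mul_le_mul_of_nonneg_right hut (Real.exp_pos (-σ * t)).le
        linarith
      linarith
    -- slope is negative just to the left, contradiction
    have hslope := (hasDerivAt_iff_tendsto_slope.1 hdW).eventually (gt_mem_nhds hneg)
    have hslope' := hslope.filter_mono
      (nhdsWithin_mono t (fun s (hs : s ∈ Set.Iio t) => ne_of_lt hs))
    have hIoo : ∀ᶠ s in 𝓝[<] t, s ∈ Set.Ioo 0 t := Ioo_mem_nhdsLT hpos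
    obtain ⟨s, hs1, hs2⟩ := (hslope'.and hIoo).exists
    have h1 : W (y, s) ≤ W (y, t) := hmax ⟨hy, ⟨hs2.1.le, hs2.2.le.trans ht.2⟩⟩
    rw [slope_def_field] at hs1
    have h2 : s - t < 0 := by linarith [hs2.2]
    have h3 : 0 ≤ (W (y, s) - W (y, t)) / (s - t) :=
      div_nonneg_of_nonpos (by linarith) h2.le
    simp only [hW] at h3
    simp only [Pi.sub_apply, Pi.mul_apply] at hs1
    linarith
  have hle : u x 1 * Real.exp (-σ) / phi α β γ x ≤ K :=
    le_of_forall_pos_le_add fun ε hε => by linarith [main ε hε]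
  rw [div_le_iff₀ (hφ x hx)] at hle
  have h1 := mul_le_mul_of_nonneg_right hle (Real.exp_pos σ).le
  have h2 : Real.exp (-σ) * Real.exp σ = 1 := by rw [← Real.exp_add]; simp
  calc u x 1 = u x 1 * Real.exp (-σ) * Real.exp σ := by rw [mul_assoc, h2, mul_one]
    _ ≤ _ := h1
    _ = _ := by ring

lemma aux_amgm (n : ℕ) (hn : 1 ≤ n) (d : ℝ) (hd : 0 < d) (A r : ℝ) (L : Fin n → ℝ)
    (hL : ∀ i, 0 < L i) (hA : A < 4 * d * r)
    (h : (∏ i, L i) < (4 * d ^ 2 * Real.pi ^ 2 * n / (4 * d * r - A)) ^ ((n : ℝ) / 2)) :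
    r < A / (4 * d) + d * Real.pi ^ 2 * ∑ i, 1 / (L i) ^ 2 := by
  by_contra hcon
  push Not at hcon
  have hn0 : (0:ℝ) < n := by exact_mod_cast hn
  set D := 4 * d * r - A with hD
  have hDpos : 0 < D := by linarith
  set C := 4 * d ^ 2 * Real.pi ^ 2 * n / D with hC
  have hpi := Real.pi_pos
  have hCpos : 0 < C := by positivity
  set S := ∑ i, 1 / (L i) ^ 2 with hS
  have hSle : S * (1 / n) ≤ 1 / C := by
    have h1 : 4 * d ^ 2 * Real.pi ^ 2 * S ≤ D := by
      have := mul_le_mul_of_nonneg_left hcon (by positivity : 0 ≤ 4 * d)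
      have e : 4 * d * (A / (4 * d) + d * Real.pi ^ 2 * S) = A + 4 * d ^ 2 * Real.pi ^ 2 * S := by
        field_simp
      rw [e] at this
      linarith
    rw [hC, one_div_div, mul_one_div, div_le_div_iff₀ hn0 (by positivity)]
    have := mul_le_mul_of_nonneg_right h1 hn0.le
    linarith
  have hag := Real.geom_mean_le_arith_mean_weighted (Finset.univ : Finset (Fin n))
    (fun _ => 1 / (n:ℝ)) (fun i => 1 / (L i) ^ 2) (fun _ _ => by positivity)
    (by simp [hn0.ne']) (fun i _ => by have := hL i; positivity)
  rw [← Finset.mul_sum, ← hS, mul_comm] at hag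
  have h2 := hag.trans hSle
  have hz : 0 ≤ ∏ i, (1 / (L i) ^ 2) ^ (1 / (n:ℝ)) :=
    Finset.prod_nonneg fun i _ => by positivity
  have h3 := pow_le_pow_left₀ hz h2 n
  rw [← Finset.prod_pow] at h3
  have e : ∀ i, ((1 / (L i) ^ 2) ^ (1 / (n:ℝ))) ^ n = 1 / (L i) ^ 2 := by
    intro i
    have := hL i
    rw [← Real.rpow_natCast, ← Real.rpow_mul (by positivity), one_div_mul_cancel hn0.ne',
      Real.rpow_one]
  rw [Finset.prod_congr rfl (fun i _ => e i), Finset.prod_div_distrib, Finset.prod_const_one,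
    Finset.prod_pow, one_div_pow] at h3
  have hP : 0 < ∏ i, L i := Finset.prod_pos fun i _ => hL i
  rw [one_div_le_one_div (by positivity) (by positivity)] at h3
  have h4 : (∏ i, L i) ^ 2 < C ^ n := by
    have := pow_lt_pow_left₀ h hP.le two_ne_zero
    rwa [← Real.rpow_natCast (C ^ _), ← Real.rpow_mul hCpos.le, Nat.cast_ofNat,
      div_mul_cancel₀ _ (two_ne_zero), Real.rpow_natCast] at this
  linarith

/-- Extreme volume size for hyperrectangles: extinction when either the advection is too
strong, or the volume `∏ Lᵢ` is below the extreme volume size. -/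
theorem hyperrectangle_extreme_volume
    (n : ℕ) (hn : 1 ≤ n) (d : ℝ) (hd : 0 < d)
    (a : EuclideanSpace ℝ (Fin n)) (L : Fin n → ℝ) (hL : ∀ i, 0 < L i)
    (Ω : Set (EuclideanSpace ℝ (Fin n)))
    (hΩ : Ω = {x | ∀ i, x i ∈ Set.Ioo 0 (L i)})
    (f g : ℝ → ℝ) (f'0 g'0 : ℝ) (hf : SatF f f'0) (hg : SatGext g g'0)
    (hcase : 4 * d * (f'0 + Real.log g'0) < ‖a‖ ^ 2 ∨
      (‖a‖ ^ 2 < 4 * d * (f'0 + Real.log g'0) ∧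
        (∏ i, L i) < (4 * d ^ 2 * Real.pi ^ 2 * n /
          (4 * d * (f'0 + Real.log g'0) - ‖a‖ ^ 2)) ^ ((n : ℝ) / 2)))
    (sol : ImpSol n Ω d (fun _ => a) f g) :
    ∀ x ∈ Ω, Tendsto (fun m => sol.N m x) atTop (𝓝 0) := by
  have hr : f'0 + Real.log g'0 < ‖a‖ ^ 2 / (4 * d) + d * Real.pi ^ 2 * ∑ i, 1 / (L i) ^ 2 := by
    rcases hcase with h | ⟨h1, h2⟩
    · have : f'0 + Real.log g'0 < ‖a‖ ^ 2 / (4 * d) := by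
        rw [lt_div_iff₀ (by positivity)]; linarith
      have : 0 ≤ d * Real.pi ^ 2 * ∑ i, 1 / (L i) ^ 2 :=
        mul_nonneg (by positivity) (Finset.sum_nonneg fun i _ => by positivity)
      linarith
    · exact aux_amgm n hn d hd _ _ L hL h1 h2
  -- slightly larger box
  obtain ⟨δ, hδr, hδ⟩ : ∃ δ : ℝ, f'0 + Real.log g'0 <
      ‖a‖ ^ 2 / (4 * d) + d * Real.pi ^ 2 * ∑ i, 1 / (L i + 2 * δ) ^ 2 ∧ 0 < δ := by
    have hc : ContinuousAt (fun δ : ℝ => ‖a‖ ^ 2 / (4 * d) +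
        d * Real.pi ^ 2 * ∑ i, 1 / (L i + 2 * δ) ^ 2) 0 := by
      refine continuousAt_const.add (continuousAt_const.mul ?_)
      refine tendsto_finsetSum _ fun i _ => ?_
      refine ContinuousAt.div (f := fun _ => (1:ℝ)) (g := fun δ : ℝ => (L i + 2 * δ) ^ 2)
        continuousAt_const (by fun_prop) ?_
      simpa using (hL i).ne'
    have h1 := hc.eventually (lt_mem_nhds (by simpa using hr))
    have h2 := h1.filter_mono (nhdsWithin_le_nhds (s := Set.Ioi 0))
    exact (h2.and self_mem_nhdsWithin).exists
  set α : Fin n → ℝ := fun i => a i / (2 * d) with hα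
  set β : Fin n → ℝ := fun i => Real.pi / (L i + 2 * δ) with hβ
  set γ : Fin n → ℝ := fun i => β i * δ with hγ
  have hΛ : ∑ i, d * (α i ^ 2 + β i ^ 2) =
      ‖a‖ ^ 2 / (4 * d) + d * Real.pi ^ 2 * ∑ i, 1 / (L i + 2 * δ) ^ 2 := by
    rw [EuclideanSpace.norm_sq_eq, Finset.sum_div, Finset.mul_sum, ← Finset.sum_add_distrib]
    apply Finset.sum_congr rfl
    intro i _
    have := hL i
    simp only [hα, hβ, Real.norm_eq_abs, sq_abs]
    field_simp
    ring
  have hcoord : ∀ i, Continuous fun x : EuclideanSpace ℝ (Fin n) => x i := fun i => by fun_prop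
  have hΩo : IsOpen Ω := by
    rw [hΩ, Set.setOf_forall]
    exact isOpen_iInter_of_finite fun i => isOpen_Ioo.preimage (hcoord i)
  have hcl : closure Ω ⊆ {x | ∀ i, x i ∈ Set.Icc 0 (L i)} := by
    apply closure_minimal
    · rw [hΩ]; intro x hx i; exact Set.Ioo_subset_Icc_self (hx i)
    · rw [Set.setOf_forall]
      exact isClosed_iInter fun i => isClosed_Icc.preimage (hcoord i)
  have hΩc : IsCompact (closure Ω) := by
    refine Metric.isCompact_of_isClosed_isBounded isClosed_closure ?_
    refine (Metric.isBounded_closedBall (x := 0) (r := √(∑ i, L i ^ 2))).subset ?_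
    intro x hx
    rw [mem_closedBall_zero_iff, EuclideanSpace.norm_eq]
    apply Real.sqrt_le_sqrt
    apply Finset.sum_le_sum
    intro i _
    have := hcl hx i
    rw [Real.norm_eq_abs, sq_abs]
    exact pow_le_pow_left₀ this.1 this.2 2
  have hφ : ∀ x ∈ closure Ω, 0 < phi α β γ x := by
    intro x hx
    apply Finset.prod_pos
    intro i _
    have h := hcl hx i
    have hLi := hL i
    apply mul_pos (Real.exp_pos _)
    have e : β i * x i + γ i = Real.pi * ((x i + δ) / (L i + 2 * δ)) := by
      simp only [hγ, hβ]; ring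
    rw [e]
    have hpi := Real.pi_pos
    apply Real.sin_pos_of_pos_of_lt_pi
    · have := h.1; positivity
    · have : (x i + δ) / (L i + 2 * δ) < 1 := by
        rw [div_lt_one (by positivity)]; linarith [h.2]
      nlinarith
  obtain ⟨-, -, -, -, h, -, -, -, hfh⟩ := hf
  obtain ⟨-, hg0, -, -, hg'0, hgle⟩ := hg
  have hfle : ∀ N, 0 ≤ N → f N ≤ f'0 * N := fun N hN => (hfh N hN).2
  have hgle' : ∀ N, 0 ≤ N → g N ≤ g'0 * N := by
    intro N hN
    rcases eq_or_lt_of_le hN with h | h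
    · subst h; simp [hg0]
    · exact hgle N h
  set Λ := ∑ i, d * (α i ^ 2 + β i ^ 2) with hΛdef
  set ρ := g'0 * Real.exp (f'0 - Λ) with hρ
  have hρ0 : 0 ≤ ρ := by positivity
  have hρ1 : ρ < 1 := by
    rw [hρ]
    nth_rewrite 1 [← Real.exp_log hg'0]
    rw [← Real.exp_add, Real.exp_lt_one_iff]
    rw [← hΛ] at hδr
    linarith
  obtain ⟨C, hC⟩ : ∃ C : ℝ, ∀ x ∈ closure Ω, sol.N 0 x / phi α β γ x ≤ C := by
    have hc : ContinuousOn (fun x => sol.N 0 x / phi α β γ x) (closure Ω) :=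
      (sol.N_cont 0).div (phi_cont α β γ).continuousOn fun x hx => (hφ x hx).ne'
    obtain ⟨C, hC⟩ := hΩc.bddAbove_image hc
    exact ⟨C, fun x hx => hC ⟨x, hx, rfl⟩⟩
  have hbound : ∀ m, ∀ x ∈ closure Ω, sol.N m x ≤ max C 0 * ρ ^ m * phi α β γ x := by
    intro m
    induction m with
    | zero =>
      intro x hx
      have h1 := (hC x hx).trans (le_max_left C 0)
      rw [div_le_iff₀ (hφ x hx)] at h1
      simpa using h1
    | succ m ih =>
      intro x hx
      rw [sol.recur m x hx]
      have := aux_compare Ω hΩo hΩc d hd α β γ hφ f f'0 hfle (sol.u m) (sol.u_nonneg m)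
        (sol.u_cont m) (sol.u_space_C2 m) (sol.u_time_C1 m) (by
          intro x hx t ht
          rw [sol.pde m x hx t ht]
          have e : ∀ i, 2 * d * α i = a i := by
            intro i; simp only [hα]; field_simp
          simp only [e]) (sol.bdry m) (max C 0 * ρ ^ m * g'0) (by positivity) (by
          intro x hx
          have hx' := subset_closure hx
          rw [sol.init m x hx]
          have h1 := hgle' _ (sol.N_nonneg m x hx')
          have h2 := mul_le_mul_of_nonneg_left (ih x hx') hg'0.le
          linarith) x hx
      refine this.trans (le_of_eq ?_)
      rw [pow_succ, hρ]
      ring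
  intro x hx
  have hx' := subset_closure hx
  refine squeeze_zero (fun m => sol.N_nonneg m x hx') (fun m => hbound m x hx') ?_
  have := ((tendsto_pow_atTop_nhds_zero_of_lt_one hρ0 hρ1).const_mul (max C 0)).mul_const
    (phi α β γ x)
  simpa using this
end
end
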